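/- arXiv:1808.06980 — 5 statements merged into one kernel-verified Lean document; each statement's English description precedes it below -/
import Mathlib

section
/- The entropy of a channel is additive under tensor products: H(N ⊗ M) = H(N) + H(M), where H(N) = inf over pure bipartite input states of the conditional entropy H(B|R) of the output. -/
open Matrix BigOperators
open scoped Kronecker ComplexOrder

namespace QCh

variable {n m : Type*} [Fintype n] [DecidableEq n] [Fintype m] [DecidableEq m]

/-- Density matrix: positive semidefinite with unit trace. -/
def IsDensity (ρ : Matrix n n ℂ) : Prop := ρ.PosSemidef ∧ ρ.trace = 1

/-- Pure state: density matrix that is a projection. -/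
def IsPure (ρ : Matrix n n ℂ) : Prop := IsDensity ρ ∧ ρ * ρ = ρ

/-- Apply a real function to a Hermitian matrix via its spectral decomposition. -/
noncomputable def matFun (f : ℝ → ℝ) (A : Matrix n n ℂ) : Matrix n n ℂ :=
  if h : A.IsHermitian then
    (h.eigenvectorUnitary : Matrix n n ℂ) * Matrix.diagonal (fun i => (f (h.eigenvalues i) : ℂ)) *
      (star h.eigenvectorUnitary : Matrix n n ℂ)
  else 0

/-- von Neumann entropy in bits. -/
noncomputable def vnEntropy (ρ : Matrix n n ℂ) : ℝ :=
  if h : ρ.IsHermitian then -∑ i, h.eigenvalues i * Real.logb 2 (h.eigenvalues i) else 0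

/-- Base-2 matrix logarithm (on the support, via spectral calculus). -/
noncomputable def matLog2 (A : Matrix n n ℂ) : Matrix n n ℂ := matFun (Real.logb 2) A

/-- Quantum relative entropy in bits. -/
noncomputable def relEnt (ρ σ : Matrix n n ℂ) : ℝ :=
  ((ρ * (matLog2 ρ - matLog2 σ)).trace).re

/-- Partial trace over the second tensor factor. -/
noncomputable def ptR {p : Type*} [Fintype p] (M : Matrix (n × p) (n × p) ℂ) : Matrix n n ℂ :=
  Matrix.of fun i j => ∑ k, M (i, k) (j, k)

/-- Partial trace over the first tensor factor. -/
noncomputable def ptL {p : Type*} [Fintype p] (M : Matrix (p × n) (p × n) ℂ) : Matrix n n ℂ :=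
  Matrix.of fun i j => ∑ k, M (k, i) (k, j)

/-- Conditional entropy H(B|R) of a state on R ⊗ B. -/
noncomputable def condEntB {R B : Type*} [Fintype R] [DecidableEq R] [Fintype B] [DecidableEq B]
    (ω : Matrix (R × B) (R × B) ℂ) : ℝ := vnEntropy ω - vnEntropy (ptR ω)

/-- Extension id_R ⊗ N of a map N on system A, acting on a state of R ⊗ A. -/
noncomputable def ext {R A B : Type*} [Fintype R] [DecidableEq R] [Fintype A] [DecidableEq A]
    [Fintype B] [DecidableEq B] (N : Matrix A A ℂ → Matrix B B ℂ)
    (ψ : Matrix (R × A) (R × A) ℂ) : Matrix (R × B) (R × B) ℂ :=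
  Matrix.of fun p q => N (Matrix.of fun a a' => ψ (p.1, a) (q.1, a')) p.2 q.2

/-- The channel with Kraus operators K. -/
noncomputable def krausMap {A B ι : Type*} [Fintype A] [Fintype B] [Fintype ι]
    (K : ι → Matrix B A ℂ) (X : Matrix A A ℂ) : Matrix B B ℂ :=
  ∑ i, K i * X * (K i)ᴴ

/-- Entropy of a channel: infimum of H(B|R) of the output over pure bipartite inputs,
with the reference system isomorphic to the channel input. -/
noncomputable def chEnt {A B : Type*} [Fintype A] [DecidableEq A] [Fintype B] [DecidableEq B]
    (N : Matrix A A ℂ → Matrix B B ℂ) : ℝ :=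
  sInf {x | ∃ ψ : Matrix (A × A) (A × A) ℂ, IsPure ψ ∧ x = condEntB (ext N ψ)}

/-! ### Part 1: spectral facts about the entropy -/

/-- Shannon-type sum attached to a multiset of complex numbers. -/
noncomputable def etaSum (s : Multiset ℂ) : ℝ := (s.map fun z => z.re * Real.logb 2 z.re).sum

lemma vn_eq_roots {ρ : Matrix n n ℂ} (h : ρ.IsHermitian) :
    vnEntropy ρ = -etaSum ρ.charpoly.roots := by
  rw [vnEntropy, dif_pos h, h.roots_charpoly_eq_eigenvalues, etaSum]
  simp [Multiset.map_map]

lemma etaSum_X_pow_mul (k : ℕ) (P : Polynomial ℂ) (hP : P ≠ 0) :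
    etaSum (Polynomial.X ^ k * P).roots = etaSum P.roots := by
  rw [Polynomial.roots_mul (mul_ne_zero (pow_ne_zero _ Polynomial.X_ne_zero) hP)]
  simp [etaSum, Multiset.nsmul_singleton]

lemma vn_mul_comm (A : Matrix n m ℂ) (B : Matrix m n ℂ) (h1 : (A * B).IsHermitian)
    (h2 : (B * A).IsHermitian) : vnEntropy (A * B) = vnEntropy (B * A) := by
  rw [vn_eq_roots h1, vn_eq_roots h2,
    ← etaSum_X_pow_mul (Fintype.card m) _ (A * B).charpoly_monic.ne_zero,
    Matrix.charpoly_mul_comm', etaSum_X_pow_mul _ _ (B * A).charpoly_monic.ne_zero]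

lemma vn_transpose {ρ : Matrix n n ℂ} (h : ρ.IsHermitian) : vnEntropy ρᵀ = vnEntropy ρ := by
  rw [vn_eq_roots h, vn_eq_roots h.transpose, Matrix.charpoly_transpose]

lemma vn_submatrix {ρ : Matrix n n ℂ} (h : ρ.IsHermitian) (e : m ≃ n) :
    vnEntropy (ρ.submatrix e e) = vnEntropy ρ := by
  rw [vn_eq_roots h, vn_eq_roots (h.submatrix e)]
  have := Matrix.charpoly_reindex e.symm ρ
  rw [Matrix.reindex_apply] at this
  simp only [Equiv.symm_symm] at this
  rw [this]

/-- `ρ = U diag(p) U†` with `U` unitary (possibly between different index types). -/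
structure Spec {X I : Type*} [Fintype X] [DecidableEq X] [Fintype I] [DecidableEq I]
    (ρ : Matrix X X ℂ) (U : Matrix X I ℂ) (p : I → ℝ) : Prop where
  left : Uᴴ * U = 1
  right : U * Uᴴ = 1
  eq : ρ = U * Matrix.diagonal (fun i => (p i : ℂ)) * Uᴴ

lemma Spec.herm {ρ : Matrix n n ℂ} {U : Matrix n m ℂ} {p : m → ℝ} (h : Spec ρ U p) :
    ρ.IsHermitian := by
  rw [h.eq]
  apply Matrix.isHermitian_mul_mul_conjTranspose
  rw [Matrix.IsHermitian, Matrix.diagonal_conjTranspose]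
  congr 1; funext i; simp

lemma Spec.vn {ρ : Matrix n n ℂ} {U : Matrix n m ℂ} {p : m → ℝ} (h : Spec ρ U p) :
    vnEntropy ρ = -∑ i, p i * Real.logb 2 (p i) := by
  have hd : (Matrix.diagonal (fun i => (p i : ℂ))).IsHermitian := by
    rw [Matrix.IsHermitian, Matrix.diagonal_conjTranspose]
    congr 1; funext i; simp
  have e : Uᴴ * (U * Matrix.diagonal (fun i => (p i : ℂ))) = Matrix.diagonal (fun i => (p i : ℂ)) := by
    rw [← Matrix.mul_assoc, h.left, Matrix.one_mul]
  have := vn_mul_comm (U * Matrix.diagonal (fun i => (p i : ℂ))) Uᴴ (h.eq ▸ h.herm)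
    (by rw [e]; exact hd)
  rw [e, ← h.eq] at this
  rw [this, vn_eq_roots hd, Matrix.charpoly_diagonal, Polynomial.roots_prod _ _
    (Finset.prod_ne_zero_iff.mpr fun i _ => Polynomial.X_sub_C_ne_zero _)]
  simp [etaSum]

lemma spec_of_herm {ρ : Matrix n n ℂ} (h : ρ.IsHermitian) :
    Spec ρ (h.eigenvectorUnitary : Matrix n n ℂ) h.eigenvalues := by
  refine ⟨Unitary.coe_star_mul_self _, Unitary.coe_mul_star_self _, ?_⟩
  have := h.spectral_theorem
  rw [Unitary.conjStarAlgAut_apply] at this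
  exact this

lemma Spec.add_smul {ρ : Matrix n n ℂ} {U : Matrix n m ℂ} {p : m → ℝ} (h : Spec ρ U p) (ε : ℝ) :
    Spec (ρ + (ε : ℂ) • (1 : Matrix n n ℂ)) U (fun i => p i + ε) := by
  refine ⟨h.left, h.right, ?_⟩
  have : Matrix.diagonal (fun i => ((p i + ε : ℝ) : ℂ)) =
      Matrix.diagonal (fun i => (p i : ℂ)) + (ε : ℂ) • (1 : Matrix m m ℂ) := by
    ext i j
    by_cases hij : i = j <;> simp [Matrix.diagonal, hij]
  rw [this, Matrix.mul_add, Matrix.add_mul, ← h.eq]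
  simp [h.right]

lemma tendsto_vn_add {ρ : Matrix n n ℂ} (h : ρ.IsHermitian) (c : ℝ) :
    Filter.Tendsto (fun ε : ℝ => vnEntropy (ρ + ((c * ε : ℝ) : ℂ) • (1 : Matrix n n ℂ)))
      (nhdsWithin 0 (Set.Ioi 0)) (nhds (vnEntropy ρ)) := by
  have e : (fun ε : ℝ => vnEntropy (ρ + ((c * ε : ℝ) : ℂ) • (1 : Matrix n n ℂ))) =
      fun ε => -∑ i, (h.eigenvalues i + c * ε) * Real.logb 2 (h.eigenvalues i + c * ε) := by
    funext ε
    exact ((spec_of_herm h).add_smul (c * ε)).vn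
  have hc : Continuous
      fun ε => -∑ i, (h.eigenvalues i + c * ε) * Real.logb 2 (h.eigenvalues i + c * ε) := by
    have hl : Continuous fun x : ℝ => x * Real.logb 2 x := by
      simp only [Real.logb, ← mul_div_assoc]
      exact Real.continuous_mul_log.div_const _
    refine (continuous_finsetSum _ fun i _ => ?_).neg
    exact hl.comp (by fun_prop : Continuous fun ε : ℝ => h.eigenvalues i + c * ε)
  rw [e]
  have := hc.tendsto 0
  simp only [mul_zero, add_zero] at this
  rw [(spec_of_herm h).vn]
  exact this.mono_left nhdsWithin_le_nhds

set_option linter.unusedSectionVars false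

/-! ### Part 2: data processing through a quadratic variational formula -/

section dpi

variable {X I J : Type*} [Fintype X] [DecidableEq X] [Fintype I] [DecidableEq I]
  [Fintype J] [DecidableEq J]

/-- The quadratic functional whose supremum gives the integrand of the relative entropy. -/
noncomputable def quadFun (ρ σ : Matrix X X ℂ) (s : ℝ) (Z : Matrix X X ℂ) : ℝ :=
  2 * ((Zᴴ * ρ).trace.re - (Zᴴ * σ).trace.re) - s * (Zᴴ * σ * Z).trace.re
    - (1 - s) * (Z * ρ * Zᴴ).trace.re

lemma quadFun_eq {ρ σ : Matrix X X ℂ} {U : Matrix X I ℂ} {p : I → ℝ} {V : Matrix X J ℂ}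
    {q : J → ℝ} (hρ : Spec ρ U p) (hσ : Spec σ V q) (s : ℝ) (Y : Matrix J I ℂ) :
    quadFun ρ σ s (V * Y * Uᴴ) = ∑ i, ∑ j,
      (2 * (p i - q j) * (star (Y j i) * (Vᴴ * U) j i).re
        - (s * q j + (1 - s) * p i) * Complex.normSq (Y j i)) := by
  have t1 : ((V * Y * Uᴴ)ᴴ * ρ).trace =
      (Yᴴ * ((Vᴴ * U) * Matrix.diagonal (fun i => (p i : ℂ)))).trace := by
    rw [Matrix.conjTranspose_mul, Matrix.conjTranspose_mul, Matrix.conjTranspose_conjTranspose,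
      Matrix.mul_assoc, Matrix.trace_mul_comm]
    congr 1
    rw [hρ.eq]
    simp only [Matrix.mul_assoc, hρ.left, Matrix.mul_one]
  have t2 : ((V * Y * Uᴴ)ᴴ * σ).trace =
      (Yᴴ * (Matrix.diagonal (fun i => (q i : ℂ)) * (Vᴴ * U))).trace := by
    rw [Matrix.conjTranspose_mul, Matrix.conjTranspose_mul, Matrix.conjTranspose_conjTranspose,
      Matrix.mul_assoc, Matrix.trace_mul_comm]
    congr 1
    rw [hσ.eq]
    simp only [Matrix.mul_assoc]
    rw [← Matrix.mul_assoc Vᴴ V, hσ.left, Matrix.one_mul]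
  have t3 : ((V * Y * Uᴴ)ᴴ * σ * (V * Y * Uᴴ)).trace =
      (Yᴴ * (Matrix.diagonal (fun i => (q i : ℂ)) * Y)).trace := by
    rw [Matrix.conjTranspose_mul, Matrix.conjTranspose_mul, Matrix.conjTranspose_conjTranspose,
      Matrix.mul_assoc, Matrix.mul_assoc, Matrix.trace_mul_comm, hσ.eq]
    congr 1
    simp only [Matrix.mul_assoc, hρ.left, Matrix.mul_one]
    rw [← Matrix.mul_assoc Vᴴ V, hσ.left, Matrix.one_mul, ← Matrix.mul_assoc Vᴴ V, hσ.left,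
      Matrix.one_mul]
  have t4 : ((V * Y * Uᴴ) * ρ * (V * Y * Uᴴ)ᴴ).trace =
      (Yᴴ * (Y * Matrix.diagonal (fun i => (p i : ℂ)))).trace := by
    rw [Matrix.trace_mul_comm, Matrix.conjTranspose_mul, Matrix.conjTranspose_mul,
      Matrix.conjTranspose_conjTranspose, Matrix.mul_assoc, Matrix.trace_mul_comm, hρ.eq]
    congr 1
    simp only [Matrix.mul_assoc, hρ.left, Matrix.mul_one]
    rw [← Matrix.mul_assoc Uᴴ U, hρ.left, Matrix.one_mul, ← Matrix.mul_assoc Vᴴ V, hσ.left,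
      Matrix.one_mul]
  rw [quadFun, t1, t2, t3, t4]
  generalize Vᴴ * U = W
  simp only [Matrix.trace, Matrix.diag, Matrix.mul_apply (M := Yᴴ), Matrix.mul_diagonal,
    Matrix.diagonal_mul, Matrix.conjTranspose_apply, Complex.re_sum, mul_sub, Finset.mul_sum,
    ← Finset.sum_sub_distrib]
  refine Finset.sum_congr rfl fun i _ => Finset.sum_congr rfl fun j _ => ?_
  simp [Complex.normSq_apply]
  ring

lemma scalar_bound (d c : ℝ) (hc : 0 < c) (y w : ℂ) :
    2 * d * (star y * w).re - c * Complex.normSq y ≤ Complex.normSq w * (d ^ 2 / c) := by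
  have h : Complex.normSq w * (d ^ 2 / c) - (2 * d * (star y * w).re - c * Complex.normSq y)
      = ((d * w.re - c * y.re) ^ 2 + (d * w.im - c * y.im) ^ 2) / c := by
    field_simp
    simp [Complex.normSq_apply]
    ring
  have : 0 ≤ ((d * w.re - c * y.re) ^ 2 + (d * w.im - c * y.im) ^ 2) / c := by positivity
  linarith

lemma scalar_eq (d c : ℝ) (hc : 0 < c) (w : ℂ) :
    2 * d * (star (((d / c : ℝ) : ℂ) * w) * w).re - c * Complex.normSq (((d / c : ℝ) : ℂ) * w)
      = Complex.normSq w * (d ^ 2 / c) := by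
  simp only [Complex.normSq_apply, star_mul', Complex.star_def, Complex.conj_ofReal,
    Complex.mul_re, Complex.mul_im, Complex.conj_re, Complex.conj_im, Complex.ofReal_re,
    Complex.ofReal_im]
  field_simp
  ring

/-- Integrand of the relative entropy. -/
noncomputable def relInt (W : Matrix J I ℂ) (p : I → ℝ) (q : J → ℝ) (s : ℝ) : ℝ :=
  ∑ i, ∑ j, Complex.normSq (W j i) * ((p i - q j) ^ 2 / (s * q j + (1 - s) * p i))

lemma cpos {p q s : ℝ} (hp : 0 < p) (hq : 0 < q) (h0 : 0 ≤ s) (h1 : s ≤ 1) :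
    0 < s * q + (1 - s) * p := by
  rcases h0.eq_or_lt with h | h
  · subst h; simpa using hp
  · have : 0 ≤ (1 - s) * p := mul_nonneg (by linarith) hp.le
    have : 0 < s * q := mul_pos h hq
    linarith

lemma quadFun_le {ρ σ : Matrix X X ℂ} {U : Matrix X I ℂ} {p : I → ℝ} {V : Matrix X J ℂ}
    {q : J → ℝ} (hρ : Spec ρ U p) (hσ : Spec σ V q) (hp : ∀ i, 0 < p i) (hq : ∀ j, 0 < q j)
    {s : ℝ} (h0 : 0 ≤ s) (h1 : s ≤ 1) (Z : Matrix X X ℂ) :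
    quadFun ρ σ s Z ≤ relInt (Vᴴ * U) p q s := by
  have : Z = V * (Vᴴ * Z * U) * Uᴴ := by
    simp only [Matrix.mul_assoc, hρ.right, Matrix.mul_one]
    rw [← Matrix.mul_assoc, hσ.right, Matrix.one_mul]
  rw [this, quadFun_eq hρ hσ, relInt]
  exact Finset.sum_le_sum fun i _ => Finset.sum_le_sum fun j _ =>
    scalar_bound _ _ (cpos (hp i) (hq j) h0 h1) _ _

lemma exists_quadFun_eq {ρ σ : Matrix X X ℂ} {U : Matrix X I ℂ} {p : I → ℝ} {V : Matrix X J ℂ}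
    {q : J → ℝ} (hρ : Spec ρ U p) (hσ : Spec σ V q) (hp : ∀ i, 0 < p i) (hq : ∀ j, 0 < q j)
    {s : ℝ} (h0 : 0 ≤ s) (h1 : s ≤ 1) :
    ∃ Z, quadFun ρ σ s Z = relInt (Vᴴ * U) p q s := by
  refine ⟨V * (Matrix.of fun j i =>
    (((p i - q j) / (s * q j + (1 - s) * p i) : ℝ) : ℂ) * (Vᴴ * U) j i) * Uᴴ, ?_⟩
  rw [quadFun_eq hρ hσ, relInt]
  exact Finset.sum_congr rfl fun i _ => Finset.sum_congr rfl fun j _ =>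
    scalar_eq _ _ (cpos (hp i) (hq j) h0 h1) _

lemma scalar_cont {p q : ℝ} (hp : 0 < p) (hq : 0 < q) :
    ContinuousOn (fun s : ℝ => s * ((p - q) ^ 2 / (s * q + (1 - s) * p))) (Set.uIcc 0 1) := by
  rw [Set.uIcc_of_le zero_le_one]
  refine continuousOn_id.mul (ContinuousOn.div (by fun_prop) (by fun_prop) fun s hs => ?_)
  exact (cpos hp hq hs.1 hs.2).ne'

lemma scalar_integral {p q : ℝ} (hp : 0 < p) (hq : 0 < q) :
    ∫ s in (0 : ℝ)..1, s * ((p - q) ^ 2 / (s * q + (1 - s) * p)) =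
      p * Real.log p - p * Real.log q - p + q := by
  have hd : ∀ s ∈ Set.uIcc (0 : ℝ) 1, HasDerivAt
      (fun s : ℝ => (q - p) * s - p * Real.log (s * q + (1 - s) * p))
      (s * ((p - q) ^ 2 / (s * q + (1 - s) * p))) s := by
    intro s hs
    rw [Set.uIcc_of_le zero_le_one] at hs
    have hc := cpos hp hq hs.1 hs.2
    have h1 : HasDerivAt (fun s : ℝ => s * q + (1 - s) * p) (1 * q + (0 - 1) * p) s :=
      ((hasDerivAt_id s).mul_const q).add (((hasDerivAt_const s (1:ℝ)).sub (hasDerivAt_id s)).mul_const p)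
    have h2 := ((hasDerivAt_id s).const_mul (q - p)).sub ((h1.log hc.ne').const_mul p)
    refine h2.congr_deriv ?_
    have hc' := hc.ne'
    obtain ⟨c, hcd⟩ : ∃ c, c = s * q + (1 - s) * p := ⟨_, rfl⟩
    rw [← hcd] at hc' ⊢
    field_simp
    rw [hcd]
    ring
  rw [intervalIntegral.integral_eq_sub_of_hasDerivAt hd (scalar_cont hp hq).intervalIntegrable]
  simp
  ring

lemma relInt_integrable (W : Matrix J I ℂ) {p : I → ℝ} {q : J → ℝ} (hp : ∀ i, 0 < p i)
    (hq : ∀ j, 0 < q j) :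
    IntervalIntegrable (fun s => s * relInt W p q s) MeasureTheory.volume 0 1 := by
  apply ContinuousOn.intervalIntegrable
  have : (fun s => s * relInt W p q s) = fun s => ∑ i, ∑ j, Complex.normSq (W j i) *
      (s * ((p i - q j) ^ 2 / (s * q j + (1 - s) * p i))) := by
    funext s
    simp only [relInt, Finset.mul_sum]
    refine Finset.sum_congr rfl fun i _ => Finset.sum_congr rfl fun j _ => by ring
  rw [this]
  exact continuousOn_finsetSum _ fun i _ => continuousOn_finsetSum _ fun j _ =>
    continuousOn_const.mul (scalar_cont (hp i) (hq j))

/-- Relative entropy (natural log, with trace correction) in terms of spectral data. -/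
noncomputable def relSum (W : Matrix J I ℂ) (p : I → ℝ) (q : J → ℝ) : ℝ :=
  ∑ i, ∑ j, Complex.normSq (W j i) * (p i * Real.log (p i) - p i * Real.log (q j) - p i + q j)

lemma relInt_integral (W : Matrix J I ℂ) {p : I → ℝ} {q : J → ℝ} (hp : ∀ i, 0 < p i)
    (hq : ∀ j, 0 < q j) :
    ∫ s in (0 : ℝ)..1, s * relInt W p q s = relSum W p q := by
  have : (fun s => s * relInt W p q s) = fun s => ∑ i, ∑ j, Complex.normSq (W j i) *
      (s * ((p i - q j) ^ 2 / (s * q j + (1 - s) * p i))) := by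
    funext s
    simp only [relInt, Finset.mul_sum]
    refine Finset.sum_congr rfl fun i _ => Finset.sum_congr rfl fun j _ => by ring
  have hi : ∀ i j, IntervalIntegrable (fun s : ℝ => Complex.normSq (W j i) *
      (s * ((p i - q j) ^ 2 / (s * q j + (1 - s) * p i)))) MeasureTheory.volume 0 1 :=
    fun i j => (scalar_cont (hp i) (hq j)).intervalIntegrable.const_mul _
  have hi2 : ∀ i ∈ Finset.univ, IntervalIntegrable (fun s : ℝ => ∑ j, Complex.normSq (W j i) *
      (s * ((p i - q j) ^ 2 / (s * q j + (1 - s) * p i)))) MeasureTheory.volume 0 1 :=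
    fun i _ => (continuousOn_finsetSum _ fun j _ =>
      continuousOn_const.mul (scalar_cont (hp i) (hq j))).intervalIntegrable
  rw [this, intervalIntegral.integral_finsetSum hi2, relSum]
  refine Finset.sum_congr rfl fun i _ => ?_
  rw [intervalIntegral.integral_finsetSum (fun j _ => hi i j)]
  refine Finset.sum_congr rfl fun j _ => ?_
  rw [intervalIntegral.integral_const_mul, scalar_integral (hp i) (hq j)]

/-- Data processing: if every test operator on the small system can be lifted to the big system
without changing the quadratic functional, the relative entropy decreases. -/
lemma relSum_mono {X' I' J' : Type*} [Fintype X'] [DecidableEq X'] [Fintype I'] [DecidableEq I']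
    [Fintype J'] [DecidableEq J']
    {ρ σ : Matrix X X ℂ} {U : Matrix X I ℂ} {p : I → ℝ} {V : Matrix X J ℂ} {q : J → ℝ}
    (hρ : Spec ρ U p) (hσ : Spec σ V q) (hp : ∀ i, 0 < p i) (hq : ∀ j, 0 < q j)
    {ρ' σ' : Matrix X' X' ℂ} {U' : Matrix X' I' ℂ} {p' : I' → ℝ} {V' : Matrix X' J' ℂ}
    {q' : J' → ℝ}
    (hρ' : Spec ρ' U' p') (hσ' : Spec σ' V' q') (hp' : ∀ i, 0 < p' i) (hq' : ∀ j, 0 < q' j)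
    (lift : Matrix X' X' ℂ → Matrix X X ℂ)
    (hl : ∀ s Z, quadFun ρ σ s (lift Z) = quadFun ρ' σ' s Z) :
    relSum (V'ᴴ * U') p' q' ≤ relSum (Vᴴ * U) p q := by
  rw [← relInt_integral _ hp hq, ← relInt_integral _ hp' hq']
  refine intervalIntegral.integral_mono_on zero_le_one (relInt_integrable _ hp' hq')
    (relInt_integrable _ hp hq) fun s hs => ?_
  refine mul_le_mul_of_nonneg_left ?_ hs.1
  obtain ⟨Z, hZ⟩ := exists_quadFun_eq hρ' hσ' hp' hq' hs.1 hs.2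
  rw [← hZ, ← hl]
  exact quadFun_le hρ hσ hp hq hs.1 hs.2 _

lemma relSum_eq {ρ σ : Matrix X X ℂ} {U : Matrix X I ℂ} {p : I → ℝ} {V : Matrix X J ℂ} {q : J → ℝ}
    (hρ : Spec ρ U p) (hσ : Spec σ V q) :
    relSum (Vᴴ * U) p q = ∑ i, p i * Real.log (p i)
      - ∑ j, Real.log (q j) * ((Vᴴ * ρ * V) j j).re - ρ.trace.re + σ.trace.re := by
  have c1 : ∀ i, ∑ j, Complex.normSq ((Vᴴ * U) j i) = 1 := by
    intro i
    have h : ((Vᴴ * U)ᴴ * (Vᴴ * U)) = 1 := by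
      rw [Matrix.conjTranspose_mul, Matrix.conjTranspose_conjTranspose, Matrix.mul_assoc,
        ← Matrix.mul_assoc V, hσ.right, Matrix.one_mul, hρ.left]
    have := congrArg Complex.re (congrFun (congrFun h i) i)
    rw [Matrix.mul_apply] at this
    simpa [Complex.normSq_apply] using this
  have c2 : ∀ j, ∑ i, Complex.normSq ((Vᴴ * U) j i) = 1 := by
    intro j
    have h : ((Vᴴ * U) * (Vᴴ * U)ᴴ) = 1 := by
      rw [Matrix.conjTranspose_mul, Matrix.conjTranspose_conjTranspose, Matrix.mul_assoc,
        ← Matrix.mul_assoc U, hρ.right, Matrix.one_mul, hσ.left]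
    have := congrArg Complex.re (congrFun (congrFun h j) j)
    rw [Matrix.mul_apply] at this
    simpa [Complex.normSq_apply] using this
  have c3 : ∀ j, ((Vᴴ * ρ * V) j j).re = ∑ i, Complex.normSq ((Vᴴ * U) j i) * p i := by
    intro j
    have h : Vᴴ * ρ * V = ((Vᴴ * U) * Matrix.diagonal (fun i => (p i : ℂ))) * (Vᴴ * U)ᴴ := by
      rw [hρ.eq, Matrix.conjTranspose_mul, Matrix.conjTranspose_conjTranspose]
      simp only [Matrix.mul_assoc]
    rw [h]
    generalize Vᴴ * U = W
    rw [Matrix.mul_apply]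
    simp only [Matrix.mul_diagonal, Matrix.conjTranspose_apply, Complex.re_sum]
    refine Finset.sum_congr rfl fun i _ => ?_
    simp [Complex.normSq_apply]
    ring
  have tr1 : ρ.trace.re = ∑ i, p i := by
    rw [hρ.eq, Matrix.trace_mul_comm, ← Matrix.mul_assoc, hρ.left, Matrix.one_mul]
    simp [Matrix.trace]
  have tr2 : σ.trace.re = ∑ i, q i := by
    rw [hσ.eq, Matrix.trace_mul_comm, ← Matrix.mul_assoc, hσ.left, Matrix.one_mul]
    simp [Matrix.trace]
  rw [tr1, tr2]
  simp only [c3, relSum, mul_add, mul_sub, Finset.sum_add_distrib, Finset.sum_sub_distrib]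
  congr 1
  · congr 1
    · congr 1
      · exact Finset.sum_congr rfl fun i _ => by rw [← Finset.sum_mul, c1, one_mul]
      · rw [Finset.sum_comm]
        refine Finset.sum_congr rfl fun j _ => ?_
        rw [Finset.mul_sum]
        exact Finset.sum_congr rfl fun i _ => by ring
    · exact Finset.sum_congr rfl fun i _ => by rw [← Finset.sum_mul, c1, one_mul]
  · rw [Finset.sum_comm]
    exact Finset.sum_congr rfl fun i _ => by rw [← Finset.sum_mul, c2, one_mul]

end dpi

/-! ### Part 3: strong subadditivity -/

section ssa

variable {A B C D J I : Type*} [Fintype A] [DecidableEq A] [Fintype B] [DecidableEq B]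
  [Fintype C] [DecidableEq C] [Fintype D] [DecidableEq D] [Fintype J] [DecidableEq J]
  [Fintype I] [DecidableEq I]

/-- Partial trace over the last of three factors. -/
noncomputable def trC (ρ : Matrix (A × (B × C)) (A × (B × C)) ℂ) : Matrix (A × B) (A × B) ℂ :=
  Matrix.of fun x y => ∑ c, ρ (x.1, (x.2, c)) (y.1, (y.2, c))

/-- Tensor product of `Z` with the identity on `C`. -/
noncomputable def liftC (Z : Matrix (A × B) (A × B) ℂ) : Matrix (A × (B × C)) (A × (B × C)) ℂ :=
  (Z ⊗ₖ (1 : Matrix C C ℂ)).submatrix (Equiv.prodAssoc A B C).symm (Equiv.prodAssoc A B C).symm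

lemma liftC_mul (Z Z' : Matrix (A × B) (A × B) ℂ) :
    (liftC (Z * Z') : Matrix (A × (B × C)) (A × (B × C)) ℂ) = liftC Z * liftC Z' := by
  simp only [liftC]
  rw [Matrix.submatrix_mul_equiv, ← Matrix.mul_kronecker_mul, Matrix.one_mul]

lemma liftC_star (Z : Matrix (A × B) (A × B) ℂ) :
    (liftC Zᴴ : Matrix (A × (B × C)) (A × (B × C)) ℂ) = (liftC Z)ᴴ := by
  simp only [liftC]
  rw [Matrix.conjTranspose_submatrix, Matrix.conjTranspose_kronecker, Matrix.conjTranspose_one]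

lemma trace_liftC_mul (Z : Matrix (A × B) (A × B) ℂ) (ρ : Matrix (A × (B × C)) (A × (B × C)) ℂ) :
    (liftC Z * ρ).trace = (Z * trC ρ).trace := by
  simp only [Matrix.trace, Matrix.diag, Matrix.mul_apply, liftC, trC, Matrix.submatrix_apply,
    Matrix.of_apply, Fintype.sum_prod_type, Equiv.prodAssoc_symm_apply,
    Matrix.kroneckerMap_apply, Matrix.one_apply, mul_ite, mul_one, mul_zero, ite_mul, zero_mul,
    Finset.sum_ite_eq, Finset.mem_univ, if_true, Finset.mul_sum]
  refine Finset.sum_congr rfl fun a _ => Finset.sum_congr rfl fun b _ => ?_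
  rw [Finset.sum_comm]
  refine Finset.sum_congr rfl fun a' _ => ?_
  rw [Finset.sum_comm]

lemma quadFun_liftC (ρ σ : Matrix (A × (B × C)) (A × (B × C)) ℂ) (s : ℝ)
    (Z : Matrix (A × B) (A × B) ℂ) :
    quadFun ρ σ s (liftC Z) = quadFun (trC ρ) (trC σ) s Z := by
  have e3 : ((liftC Z)ᴴ * σ * liftC Z).trace = (Zᴴ * trC σ * Z).trace := by
    rw [Matrix.trace_mul_comm, ← Matrix.mul_assoc, ← liftC_star, ← liftC_mul, trace_liftC_mul,
      Matrix.mul_assoc, Matrix.trace_mul_comm]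
  have e4 : (liftC Z * ρ * (liftC Z)ᴴ).trace = (Z * trC ρ * Zᴴ).trace := by
    rw [Matrix.trace_mul_comm, ← Matrix.mul_assoc, ← liftC_star, ← liftC_mul, trace_liftC_mul,
      Matrix.mul_assoc, Matrix.trace_mul_comm]
  rw [quadFun, quadFun, e3, e4, ← liftC_star, trace_liftC_mul, trace_liftC_mul]

lemma trC_one_kron (ρ : Matrix (A × (B × C)) (A × (B × C)) ℂ) :
    trC ((1 : Matrix A A ℂ) ⊗ₖ ptL ρ) = (1 : Matrix A A ℂ) ⊗ₖ ptL (trC ρ) := by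
  ext ⟨a, b⟩ ⟨a', b'⟩
  simp only [trC, ptL, Matrix.of_apply, Matrix.kroneckerMap_apply]
  show ∑ x : C, (1 : Matrix A A ℂ) a a' * ∑ k, ρ (k, b, x) (k, b', x) =
    (1 : Matrix A A ℂ) a a' * ∑ k, ∑ x, ρ (k, b, x) (k, b', x)
  rw [← Finset.mul_sum, Finset.sum_comm]

lemma Spec.one_kron {τ : Matrix D D ℂ} {V : Matrix D J ℂ} {q : J → ℝ} (h : Spec τ V q) :
    Spec ((1 : Matrix A A ℂ) ⊗ₖ τ) ((1 : Matrix A A ℂ) ⊗ₖ V) (fun x => q x.2) := by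
  refine ⟨?_, ?_, ?_⟩
  · rw [Matrix.conjTranspose_kronecker, ← Matrix.mul_kronecker_mul, h.left]; simp
  · rw [Matrix.conjTranspose_kronecker, ← Matrix.mul_kronecker_mul, h.right]; simp
  · have : Matrix.diagonal (fun x : A × J => (q x.2 : ℂ)) =
        (1 : Matrix A A ℂ) ⊗ₖ Matrix.diagonal (fun j => (q j : ℂ)) := by
      rw [← Matrix.diagonal_one, Matrix.diagonal_kronecker_diagonal]
      simp
    rw [this, Matrix.conjTranspose_kronecker, ← Matrix.mul_kronecker_mul,
      ← Matrix.mul_kronecker_mul, ← h.eq]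
    simp

lemma sum_conj_one_kron (ρ : Matrix (A × D) (A × D) ℂ) (V : Matrix D J ℂ) (j : J) :
    ∑ a, (((1 : Matrix A A ℂ) ⊗ₖ V)ᴴ * ρ * ((1 : Matrix A A ℂ) ⊗ₖ V)) (a, j) (a, j) =
      (Vᴴ * ptL ρ * V) j j := by
  simp only [Matrix.mul_apply, Matrix.conjTranspose_apply, Matrix.kroneckerMap_apply, ptL,
    Matrix.of_apply, Fintype.sum_prod_type, Matrix.one_apply, ite_mul, one_mul, zero_mul,
    mul_ite, mul_zero, apply_ite (star : ℂ → ℂ), star_zero]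
  simp only [Finset.sum_comm (s := (Finset.univ : Finset A)) (t := (Finset.univ : Finset D)),
    Finset.sum_ite_eq', Finset.mem_univ, if_true, Finset.mul_sum, Finset.sum_mul]

lemma relSum_cond {ρ : Matrix (A × D) (A × D) ℂ} {U : Matrix (A × D) I ℂ} {p : I → ℝ}
    {V : Matrix D J ℂ} {q : J → ℝ} (hρ : Spec ρ U p) (hτ : Spec (ptL ρ) V q) :
    relSum (((1 : Matrix A A ℂ) ⊗ₖ V)ᴴ * U) p (fun x => q x.2) =
      Real.log 2 * (vnEntropy (ptL ρ) - vnEntropy ρ) - ρ.trace.re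
        + ((1 : Matrix A A ℂ) ⊗ₖ ptL ρ).trace.re := by
  rw [relSum_eq hρ hτ.one_kron, hρ.vn, hτ.vn]
  have h2 : Real.log 2 ≠ 0 := (Real.log_pos one_lt_two).ne'
  have e1 : ∀ {K : Type _} [Fintype K] (r : K → ℝ), ∑ i, r i * Real.log (r i) =
      Real.log 2 * ∑ i, r i * Real.logb 2 (r i) := by
    intro K _ r
    rw [Finset.mul_sum]
    refine Finset.sum_congr rfl fun i _ => ?_
    rw [Real.logb]; field_simp
  have e1' : ∑ i, q i * Real.log (q i) = Real.log 2 * ∑ i, q i * Real.logb 2 (q i) := by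
    rw [Finset.mul_sum]
    refine Finset.sum_congr rfl fun i _ => ?_
    rw [Real.logb]; field_simp
  have e2 : ∑ x : A × J, Real.log (q x.2) *
      ((((1 : Matrix A A ℂ) ⊗ₖ V)ᴴ * ρ * ((1 : Matrix A A ℂ) ⊗ₖ V)) x x).re =
      ∑ j, q j * Real.log (q j) := by
    rw [Fintype.sum_prod_type, Finset.sum_comm]
    refine Finset.sum_congr rfl fun j _ => ?_
    dsimp only
    rw [← Finset.mul_sum, ← Complex.re_sum, sum_conj_one_kron, hτ.eq]
    have : Vᴴ * (V * Matrix.diagonal (fun i => (q i : ℂ)) * Vᴴ) * V =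
        Matrix.diagonal (fun i => (q i : ℂ)) := by
      simp only [Matrix.mul_assoc, hτ.left, Matrix.mul_one]
      rw [← Matrix.mul_assoc, hτ.left, Matrix.one_mul]
    rw [this]
    simp [mul_comm]
  rw [e2, e1, e1']
  ring

lemma ptL_posSemidef {ρ : Matrix (A × D) (A × D) ℂ} (h : ρ.PosSemidef) : (ptL ρ).PosSemidef := by
  have : ptL ρ = ∑ a, ρ.submatrix (fun d => (a, d)) (fun d => (a, d)) := by
    ext i j; simp [ptL, Matrix.sum_apply]
  rw [this]
  exact Matrix.posSemidef_sum _ fun a _ => h.submatrix _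

lemma ptR_posSemidef {ρ : Matrix (D × A) (D × A) ℂ} (h : ρ.PosSemidef) : (ptR ρ).PosSemidef := by
  have : ptR ρ = ∑ a, ρ.submatrix (fun d => (d, a)) (fun d => (d, a)) := by
    ext i j; simp [ptR, Matrix.sum_apply]
  rw [this]
  exact Matrix.posSemidef_sum _ fun a _ => h.submatrix _

lemma trC_posSemidef {ρ : Matrix (A × (B × C)) (A × (B × C)) ℂ} (h : ρ.PosSemidef) :
    (trC ρ).PosSemidef := by
  have : trC ρ = ∑ c, ρ.submatrix (fun x => (x.1, (x.2, c))) (fun x => (x.1, (x.2, c))) := by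
    ext i j; simp [trC, Matrix.sum_apply]
  rw [this]
  exact Matrix.posSemidef_sum _ fun a _ => h.submatrix _

lemma ptL_add_smul (ρ : Matrix (A × D) (A × D) ℂ) (ε : ℂ) :
    ptL (ρ + ε • (1 : Matrix (A × D) (A × D) ℂ)) =
      ptL ρ + ((Fintype.card A : ℂ) * ε) • (1 : Matrix D D ℂ) := by
  ext i j
  by_cases h : i = j <;> simp [ptL, Matrix.one_apply, Finset.sum_add_distrib, h]

lemma trC_add_smul (ρ : Matrix (A × (B × C)) (A × (B × C)) ℂ) (ε : ℂ) :
    trC (ρ + ε • (1 : Matrix (A × (B × C)) (A × (B × C)) ℂ)) =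
      trC ρ + ((Fintype.card C : ℂ) * ε) • (1 : Matrix (A × B) (A × B) ℂ) := by
  ext ⟨i, i'⟩ ⟨j, j'⟩
  by_cases h : i = j <;> by_cases h' : i' = j' <;>
    simp [trC, Matrix.one_apply, Finset.sum_add_distrib, h, h']

lemma ssa_pos {ρ : Matrix (A × (B × C)) (A × (B × C)) ℂ} (h : ρ.PosDef)
    (h1 : (ptL ρ).PosDef) (h2 : (trC ρ).PosDef) (h3 : (ptL (trC ρ)).PosDef) :
    vnEntropy ρ + vnEntropy (ptL (trC ρ)) ≤ vnEntropy (ptL ρ) + vnEntropy (trC ρ) := by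
  have s0 := spec_of_herm h.isHermitian
  have s1 := spec_of_herm h1.isHermitian
  have s2 := spec_of_herm h2.isHermitian
  have s3 := spec_of_herm h3.isHermitian
  have s1' := s1.one_kron (A := A)
  have s3' := s3.one_kron (A := A)
  have key := relSum_mono s0 s1' (fun i => h.eigenvalues_pos i) (fun j => h1.eigenvalues_pos j.2)
    s2 s3' (fun i => h2.eigenvalues_pos i) (fun j => h3.eigenvalues_pos j.2) liftC
    (fun s Z => by rw [quadFun_liftC, trC_one_kron])
  rw [relSum_cond s0 s1, relSum_cond s2 s3] at key
  have t1 : ∀ σ : Matrix (A × (B × C)) (A × (B × C)) ℂ, (trC σ).trace = σ.trace := by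
    intro σ
    simp [trC, Matrix.trace, Fintype.sum_prod_type]
  rw [t1 ρ, ← trC_one_kron, t1] at key
  have hl : 0 < Real.log 2 := Real.log_pos one_lt_two
  have : Real.log 2 * (vnEntropy (ptL (trC ρ)) - vnEntropy (trC ρ)) ≤
      Real.log 2 * (vnEntropy (ptL ρ) - vnEntropy ρ) := by linarith
  have := le_of_mul_le_mul_left this hl
  linarith

lemma posDef_add_smul {X : Type*} [Fintype X] [DecidableEq X] {ρ : Matrix X X ℂ}
    (h : ρ.PosSemidef) {ε : ℝ} (hε : 0 < ε) :
    (ρ + (ε : ℂ) • (1 : Matrix X X ℂ)).PosDef := by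
  refine Matrix.PosDef.posSemidef_add h ?_
  exact Matrix.PosDef.one.smul (by exact_mod_cast hε)

/-- Strong subadditivity of the von Neumann entropy. -/
theorem ssa [Nonempty A] [Nonempty C] {ρ : Matrix (A × (B × C)) (A × (B × C)) ℂ}
    (h : ρ.PosSemidef) :
    vnEntropy ρ + vnEntropy (ptL (trC ρ)) ≤ vnEntropy (ptL ρ) + vnEntropy (trC ρ) := by
  have l0 := tendsto_vn_add h.isHermitian 1
  have l1 := tendsto_vn_add (ptL_posSemidef h).isHermitian (Fintype.card A)
  have l2 := tendsto_vn_add (trC_posSemidef h).isHermitian (Fintype.card C)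
  have l3 := tendsto_vn_add (ptL_posSemidef (trC_posSemidef h)).isHermitian
    (Fintype.card A * Fintype.card C)
  refine le_of_tendsto_of_tendsto (l0.add l3) (l1.add l2) ?_
  filter_upwards [self_mem_nhdsWithin] with ε hε
  have hε : 0 < ε := hε
  have cA : (0 : ℝ) < Fintype.card A := by exact_mod_cast Fintype.card_pos
  have cC : (0 : ℝ) < Fintype.card C := by exact_mod_cast Fintype.card_pos
  have e1 := ptL_add_smul ρ ((1 * ε : ℝ) : ℂ)
  have e2 := trC_add_smul ρ ((1 * ε : ℝ) : ℂ)
  have e3 := ptL_add_smul (trC ρ) (((Fintype.card C : ℝ) * ε : ℝ) : ℂ)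
  have c1 : (Fintype.card A : ℂ) * ((1 * ε : ℝ) : ℂ) = (((Fintype.card A : ℝ) * ε : ℝ) : ℂ) := by
    push_cast; ring
  have c2 : (Fintype.card C : ℂ) * ((1 * ε : ℝ) : ℂ) = (((Fintype.card C : ℝ) * ε : ℝ) : ℂ) := by
    push_cast; ring
  have c3 : (Fintype.card A : ℂ) * (((Fintype.card C : ℝ) * ε : ℝ) : ℂ) =
      (((Fintype.card A : ℝ) * (Fintype.card C : ℝ) * ε : ℝ) : ℂ) := by
    push_cast; ring
  rw [c1] at e1
  rw [c2] at e2
  rw [c3] at e3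
  have key := ssa_pos (ρ := ρ + ((1 * ε : ℝ) : ℂ) • 1) (posDef_add_smul h (by linarith))
    (by rw [e1]; exact posDef_add_smul (ptL_posSemidef h) (by positivity))
    (by rw [e2]; exact posDef_add_smul (trC_posSemidef h) (by positivity))
    (by rw [e2, e3]; exact posDef_add_smul (ptL_posSemidef (trC_posSemidef h)) (by positivity))
  rw [e1, e2, e3] at key
  exact key

end ssa

/-! ### Part 4: reduction of the channel entropy to the environment -/

section chan

variable {A B ι R : Type*} [Fintype A] [DecidableEq A] [Fintype B] [DecidableEq B]
  [Fintype ι] [DecidableEq ι] [Fintype R] [DecidableEq R]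

/-- Stinespring isometry. -/
def stK (K : ι → Matrix B A ℂ) : Matrix (ι × B) A ℂ := Matrix.of fun x a => K x.1 x.2 a

/-- Environment state (complementary channel). -/
noncomputable def env (K : ι → Matrix B A ℂ) (ρ : Matrix A A ℂ) : Matrix ι ι ℂ :=
  ptR (stK K * ρ * (stK K)ᴴ)

/-- Entropy difference environment minus input. -/
noncomputable def entDiff (K : ι → Matrix B A ℂ) (ρ : Matrix A A ℂ) : ℝ :=
  vnEntropy (env K ρ) - vnEntropy ρ

lemma stK_isom {K : ι → Matrix B A ℂ} (hK : ∑ i, (K i)ᴴ * K i = 1) : (stK K)ᴴ * stK K = 1 := by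
  rw [← hK]
  ext a a'
  simp [Matrix.mul_apply, stK, Matrix.sum_apply, Fintype.sum_prod_type]

lemma condEnt_vec {K : ι → Matrix B A ℂ} (hK : ∑ i, (K i)ᴴ * K i = 1) (T : Matrix A R ℂ) :
    condEntB (ext (krausMap K) (Matrix.vecMulVec (fun x : R × A => T x.2 x.1)
      (star fun x : R × A => T x.2 x.1))) = entDiff K (T * Tᴴ) := by
  set G : Matrix (R × B) ι ℂ := Matrix.of fun x i => (K i * T) x.2 x.1 with hG
  have e1 : ext (krausMap K) (Matrix.vecMulVec (fun x : R × A => T x.2 x.1)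
      (star fun x : R × A => T x.2 x.1)) = G * Gᴴ := by
    ext ⟨r, b⟩ ⟨r', b'⟩
    simp only [ext, krausMap, Matrix.of_apply, Matrix.sum_apply, Matrix.mul_apply, hG,
      Matrix.conjTranspose_apply, Matrix.vecMulVec_apply, Pi.star_apply, star_sum, star_mul']
    refine Finset.sum_congr rfl fun i _ => ?_
    rw [Finset.mul_sum]
    refine Finset.sum_congr rfl fun a' _ => ?_
    rw [Finset.sum_mul, Finset.sum_mul]
    exact Finset.sum_congr rfl fun a _ => by ring
  have e2 : Gᴴ * G = (env K (T * Tᴴ))ᵀ := by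
    have : stK K * (T * Tᴴ) * (stK K)ᴴ = (stK K * T) * (stK K * T)ᴴ := by
      rw [Matrix.conjTranspose_mul]; simp only [Matrix.mul_assoc]
    ext i j
    rw [env, this, Matrix.transpose_apply, ptR, Matrix.of_apply]
    simp only [Matrix.mul_apply (M := Gᴴ), Fintype.sum_prod_type,
      Matrix.mul_apply (M := stK K * T)]
    rw [Finset.sum_comm]
    refine Finset.sum_congr rfl fun b _ => Finset.sum_congr rfl fun r _ => ?_
    rw [mul_comm]
    rfl
  have e3 : ptR (G * Gᴴ) = (Tᴴ * T)ᵀ := by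
    have : Tᴴ * T = ∑ i, (K i * T)ᴴ * (K i * T) := by
      have h : ∀ i, (K i * T)ᴴ * (K i * T) = Tᴴ * ((K i)ᴴ * K i) * T := fun i => by
        rw [Matrix.conjTranspose_mul]; simp only [Matrix.mul_assoc]
      simp only [h]
      rw [← Matrix.sum_mul, ← Matrix.mul_sum, hK, Matrix.mul_one]
    ext r r'
    rw [this, Matrix.transpose_apply, ptR, Matrix.of_apply, Matrix.sum_apply]
    simp only [Matrix.mul_apply (M := G), Matrix.mul_apply (M := (K _ * T)ᴴ)]
    rw [Finset.sum_comm]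
    refine Finset.sum_congr rfl fun i _ => Finset.sum_congr rfl fun b _ => ?_
    rw [mul_comm]
    rfl
  have hGG : (Gᴴ * G).IsHermitian := Matrix.isHermitian_conjTranspose_mul_self G
  have henv : (env K (T * Tᴴ)).IsHermitian := by
    have := hGG.transpose
    rwa [e2, Matrix.transpose_transpose] at this
  rw [condEntB, e1, e3, vn_mul_comm _ _ (Matrix.isHermitian_mul_conjTranspose_self G) hGG, e2,
    vn_transpose henv, vn_transpose (Matrix.isHermitian_conjTranspose_mul_self T),
    vn_mul_comm _ _ (Matrix.isHermitian_conjTranspose_mul_self T)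
      (Matrix.isHermitian_mul_conjTranspose_self T), entDiff]

lemma pure_eq_vec {ψ : Matrix n n ℂ} (h : IsPure ψ) :
    ∃ v : n → ℂ, ψ = Matrix.vecMulVec v (star v) := by
  obtain ⟨⟨hpsd, htr⟩, hid⟩ := h
  have s := spec_of_herm hpsd.isHermitian
  have hnn := hpsd.eigenvalues_nonneg
  generalize hpsd.isHermitian.eigenvalues = p at s hnn
  generalize (hpsd.isHermitian.eigenvectorUnitary : Matrix n n ℂ) = U at s
  have hd : Uᴴ * ψ * U = Matrix.diagonal (fun i => (p i : ℂ)) := by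
    rw [s.eq]
    simp only [Matrix.mul_assoc, s.left, Matrix.mul_one]
    rw [← Matrix.mul_assoc, s.left, Matrix.one_mul]
  have hsq : ∀ i, p i * p i = p i := by
    intro i
    have : Matrix.diagonal (fun i => (p i : ℂ)) * Matrix.diagonal (fun i => (p i : ℂ)) =
        Matrix.diagonal (fun i => (p i : ℂ)) := by
      conv_rhs => rw [← hd, ← hid]
      rw [← hd]
      simp only [Matrix.mul_assoc]
      rw [← Matrix.mul_assoc U, s.right, Matrix.one_mul]
    have := congrFun (congrFun this i) i
    rw [Matrix.diagonal_mul_diagonal] at this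
    simp only [Matrix.diagonal_apply_eq] at this
    exact_mod_cast this
  have hsum : ∑ i, p i = 1 := by
    have : ((∑ i, p i : ℝ) : ℂ) = 1 := by
      rw [← htr, s.eq, Matrix.trace_mul_comm, ← Matrix.mul_assoc, s.left, Matrix.one_mul]
      simp [Matrix.trace]
    exact_mod_cast this
  obtain ⟨k, hk⟩ : ∃ k, p k ≠ 0 := by
    by_contra! hcon
    simp [hcon] at hsum
  have hk1 : p k = 1 := mul_right_cancel₀ hk (by rw [hsq, one_mul])
  have hz : ∀ i, i ≠ k → p i = 0 := by
    intro i hik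
    rw [← Finset.add_sum_erase _ _ (Finset.mem_univ k), hk1] at hsum
    have h0 : ∑ x ∈ Finset.univ.erase k, p x = 0 := by linarith
    rw [Finset.sum_eq_zero_iff_of_nonneg (fun i _ => hnn i)] at h0
    exact h0 i (Finset.mem_erase.mpr ⟨hik, Finset.mem_univ _⟩)
  refine ⟨fun x => U x k, ?_⟩
  ext x y
  conv_lhs => rw [s.eq]
  rw [Matrix.mul_apply, Finset.sum_eq_single k]
  · simp [Matrix.mul_diagonal, hk1, Matrix.vecMulVec_apply]
  · intro b _ hb
    simp [Matrix.mul_diagonal, hz b hb]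
  · simp

lemma exists_sqrt {ρ : Matrix n n ℂ} (h : ρ.PosSemidef) : ∃ T : Matrix n n ℂ, ρ = T * Tᴴ := by
  have s := spec_of_herm h.isHermitian
  have hnn := h.eigenvalues_nonneg
  refine ⟨(h.isHermitian.eigenvectorUnitary : Matrix n n ℂ) *
    Matrix.diagonal (fun i => (Real.sqrt (h.isHermitian.eigenvalues i) : ℂ)), s.eq.trans ?_⟩
  rw [Matrix.conjTranspose_mul, Matrix.diagonal_conjTranspose, Matrix.mul_assoc, Matrix.mul_assoc,
    ← Matrix.mul_assoc (Matrix.diagonal _) (Matrix.diagonal _), Matrix.diagonal_mul_diagonal]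
  congr 3
  funext i
  simp only [Pi.star_apply, Complex.star_def, Complex.conj_ofReal]
  rw [← Complex.ofReal_mul, Real.mul_self_sqrt (hnn i)]

lemma vec_trace (T : Matrix A R ℂ) :
    (Matrix.vecMulVec (fun x : R × A => T x.2 x.1) (star fun x : R × A => T x.2 x.1)).trace =
      (T * Tᴴ).trace := by
  simp only [Matrix.trace, Matrix.diag, Matrix.vecMulVec_apply, Fintype.sum_prod_type,
    Matrix.mul_apply, Pi.star_apply, Matrix.conjTranspose_apply]
  rw [Finset.sum_comm]

lemma chEnt_eq {K : ι → Matrix B A ℂ} (hK : ∑ i, (K i)ᴴ * K i = 1) :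
    chEnt (krausMap K) = sInf {x | ∃ ρ : Matrix A A ℂ, IsDensity ρ ∧ x = entDiff K ρ} := by
  rw [chEnt]
  congr 1
  ext x
  constructor
  · rintro ⟨ψ, hψ, rfl⟩
    obtain ⟨v, rfl⟩ := pure_eq_vec hψ
    set T : Matrix A A ℂ := Matrix.of fun a r => v (r, a) with hT
    have hv : v = fun x : A × A => T x.2 x.1 := by
      funext x; simp [hT]
    refine ⟨T * Tᴴ, ⟨Matrix.posSemidef_self_mul_conjTranspose T, ?_⟩, ?_⟩
    · rw [← vec_trace, ← hv]; exact hψ.1.2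
    · rw [← condEnt_vec hK, ← hv]
  · rintro ⟨ρ, ⟨hρ, htr⟩, rfl⟩
    obtain ⟨T, rfl⟩ := exists_sqrt hρ
    have ht := vec_trace T
    rw [htr] at ht
    refine ⟨_, ⟨⟨Matrix.posSemidef_vecMulVec_self_star _, ht⟩, ?_⟩, (condEnt_vec hK T).symm⟩
    rw [Matrix.trace_vecMulVec] at ht
    rw [Matrix.vecMulVec_mul_vecMulVec, dotProduct_comm, ht]
    simp

lemma density_eig {ρ : Matrix n n ℂ} (h : IsDensity ρ) :
    ∃ (U : Matrix n n ℂ) (p : n → ℝ), Spec ρ U p ∧ (∀ i, 0 ≤ p i) ∧ ∑ i, p i = 1 := by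
  have s := spec_of_herm h.1.isHermitian
  refine ⟨_, _, s, h.1.eigenvalues_nonneg, ?_⟩
  have := h.1.isHermitian.trace_eq_sum_eigenvalues.symm.trans h.2
  apply Complex.ofReal_injective
  rw [Complex.ofReal_sum, Complex.ofReal_one]
  exact this

lemma vn_nonneg {ρ : Matrix n n ℂ} (h : IsDensity ρ) : 0 ≤ vnEntropy ρ := by
  obtain ⟨U, p, s, hp, hs⟩ := density_eig h
  rw [s.vn, neg_nonneg]
  refine Finset.sum_nonpos fun i _ => mul_nonpos_of_nonneg_of_nonpos (hp i) ?_
  refine Real.logb_nonpos one_lt_two (hp i) ?_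
  rw [← hs]
  exact Finset.single_le_sum (fun j _ => hp j) (Finset.mem_univ i)

lemma vn_le {ρ : Matrix n n ℂ} (h : IsDensity ρ) : vnEntropy ρ ≤ Fintype.card n * (1 / Real.log 2) := by
  obtain ⟨U, p, s, hp, hs⟩ := density_eig h
  rw [s.vn, ← Finset.sum_neg_distrib]
  have : ∀ i ∈ Finset.univ, -(p i * Real.logb 2 (p i)) ≤ 1 / Real.log 2 := by
    intro i _
    have hl : 0 < Real.log 2 := Real.log_pos one_lt_two
    rw [Real.logb, ← mul_div_assoc, ← neg_div]
    refine div_le_div_of_nonneg_right ?_ hl.le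
    rcases (hp i).eq_or_lt with h0 | h0
    · simp [← h0]
    · have h1 := mul_le_mul_of_nonneg_left (Real.one_sub_inv_le_log_of_pos h0) h0.le
      have h2 : p i * (1 - (p i)⁻¹) = p i - 1 := by field_simp
      linarith
  have := Finset.sum_le_card_nsmul _ _ _ this
  simpa using this

lemma trace_ptR {D : Type*} [Fintype D] (M : Matrix (n × D) (n × D) ℂ) :
    (ptR M).trace = M.trace := by
  simp [ptR, Matrix.trace, Fintype.sum_prod_type]

lemma trace_ptL {D : Type*} [Fintype D] (M : Matrix (D × n) (D × n) ℂ) :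
    (ptL M).trace = M.trace := by
  simp only [ptL, Matrix.trace, Fintype.sum_prod_type, Matrix.diag, Matrix.of_apply]
  rw [Finset.sum_comm]

lemma env_density {K : ι → Matrix B A ℂ} (hK : ∑ i, (K i)ᴴ * K i = 1) {ρ : Matrix A A ℂ}
    (h : IsDensity ρ) : IsDensity (env K ρ) := by
  refine ⟨ptR_posSemidef (h.1.mul_mul_conjTranspose_same _), ?_⟩
  rw [env, trace_ptR, Matrix.trace_mul_comm, ← Matrix.mul_assoc, stK_isom hK, Matrix.one_mul, h.2]

lemma bddBelow_ent {K : ι → Matrix B A ℂ} (hK : ∑ i, (K i)ᴴ * K i = 1) :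
    BddBelow {x | ∃ ρ : Matrix A A ℂ, IsDensity ρ ∧ x = entDiff K ρ} := by
  refine ⟨-(Fintype.card A * (1 / Real.log 2)), ?_⟩
  rintro x ⟨ρ, hρ, rfl⟩
  have h1 := vn_nonneg (env_density hK hρ)
  have h2 := vn_le hρ
  rw [entDiff]; linarith

lemma nonempty_ent [Nonempty A] (K : ι → Matrix B A ℂ) :
    {x | ∃ ρ : Matrix A A ℂ, IsDensity ρ ∧ x = entDiff K ρ}.Nonempty := by
  obtain ⟨a⟩ := ‹Nonempty A›
  refine ⟨_, Matrix.diagonal (Pi.single a 1), ⟨Matrix.PosSemidef.diagonal ?_, ?_⟩, rfl⟩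
  · exact Pi.single_nonneg.mpr zero_le_one
  · simp [Matrix.trace_diagonal]

end chan

/-! ### Part 5: tensor products -/

section tens

variable {A₁ B₁ A₂ B₂ ι κ E F : Type*}
    [Fintype A₁] [DecidableEq A₁] [Fintype B₁] [DecidableEq B₁]
    [Fintype A₂] [DecidableEq A₂] [Fintype B₂] [DecidableEq B₂]
    [Fintype ι] [DecidableEq ι] [Fintype κ] [DecidableEq κ]
    [Fintype E] [DecidableEq E] [Fintype F] [DecidableEq F]

lemma vn_kron {ρ : Matrix n n ℂ} {τ : Matrix m m ℂ} (h1 : IsDensity ρ) (h2 : IsDensity τ) :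
    vnEntropy (ρ ⊗ₖ τ) = vnEntropy ρ + vnEntropy τ := by
  obtain ⟨U, p, s, hp, hs⟩ := density_eig h1
  obtain ⟨V, q, t, hq, ht⟩ := density_eig h2
  have st : Spec (ρ ⊗ₖ τ) (U ⊗ₖ V) (fun x : n × m => p x.1 * q x.2) := by
    refine ⟨?_, ?_, ?_⟩
    · rw [Matrix.conjTranspose_kronecker, ← Matrix.mul_kronecker_mul, s.left, t.left]; simp
    · rw [Matrix.conjTranspose_kronecker, ← Matrix.mul_kronecker_mul, s.right, t.right]; simp
    · have : Matrix.diagonal (fun x : n × m => ((p x.1 * q x.2 : ℝ) : ℂ)) =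
          Matrix.diagonal (fun j => (p j : ℂ)) ⊗ₖ Matrix.diagonal (fun j => (q j : ℂ)) := by
        rw [Matrix.diagonal_kronecker_diagonal]
        simp
      rw [this, Matrix.conjTranspose_kronecker, ← Matrix.mul_kronecker_mul,
        ← Matrix.mul_kronecker_mul, ← s.eq, ← t.eq]
  rw [st.vn, s.vn, t.vn, Fintype.sum_prod_type, ← neg_add]
  congr 1
  have key : ∀ i j, p i * q j * Real.logb 2 (p i * q j) =
      (p i * Real.logb 2 (p i)) * q j + p i * (q j * Real.logb 2 (q j)) := by
    intro i j
    rcases eq_or_ne (p i) 0 with h | h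
    · simp [h]
    rcases eq_or_ne (q j) 0 with h' | h'
    · simp [h']
    rw [Real.logb_mul h h']; ring
  simp only [key, Finset.sum_add_distrib, ← Finset.mul_sum, ← Finset.sum_mul, hs, ht, mul_one,
    one_mul]

lemma kron_density {ρ : Matrix n n ℂ} {τ : Matrix m m ℂ} (h1 : IsDensity ρ) (h2 : IsDensity τ) :
    IsDensity (ρ ⊗ₖ τ) :=
  ⟨h1.1.kronecker h2.1, by rw [Matrix.trace_kronecker, h1.2, h2.2, one_mul]⟩

lemma env_apply_kron (K : ι → Matrix B₁ A₁ ℂ) (L : κ → Matrix B₂ A₂ ℂ)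
    (ρ : Matrix (A₁ × A₂) (A₁ × A₂) ℂ) :
    env (fun p : ι × κ => K p.1 ⊗ₖ L p.2) ρ = Matrix.of fun x y => ∑ b, ∑ c,
      ((stK K ⊗ₖ stK L) * ρ * (stK K ⊗ₖ stK L)ᴴ) ((x.1, b), (x.2, c)) ((y.1, b), (y.2, c)) := by
  ext x y
  rw [env, ptR, Matrix.of_apply, Matrix.of_apply, Fintype.sum_prod_type]
  rfl

lemma env_kron (K : ι → Matrix B₁ A₁ ℂ) (L : κ → Matrix B₂ A₂ ℂ)
    (ρ : Matrix A₁ A₁ ℂ) (τ : Matrix A₂ A₂ ℂ) :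
    env (fun p : ι × κ => K p.1 ⊗ₖ L p.2) (ρ ⊗ₖ τ) = env K ρ ⊗ₖ env L τ := by
  rw [env_apply_kron, Matrix.conjTranspose_kronecker, ← Matrix.mul_kronecker_mul,
    ← Matrix.mul_kronecker_mul]
  ext x y
  simp only [env, ptR, Matrix.of_apply, Matrix.kroneckerMap_apply]
  rw [Finset.sum_mul_sum]

lemma ptR_conj_kron (V : Matrix E A₁ ℂ) (W : Matrix F A₂ ℂ) (hW : Wᴴ * W = 1)
    (ρ : Matrix (A₁ × A₂) (A₁ × A₂) ℂ) :
    ptR ((V ⊗ₖ W) * ρ * (V ⊗ₖ W)ᴴ) = V * ptR ρ * Vᴴ := by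
  have h : ∀ b d, ∑ k, W k b * star (W k d) = if d = b then 1 else 0 := by
    intro b d
    have := congrFun (congrFun hW d) b
    rw [Matrix.mul_apply, Matrix.one_apply] at this
    rw [← this]
    exact Finset.sum_congr rfl fun k _ => mul_comm _ _
  ext i i'
  simp only [ptR, Matrix.of_apply, Matrix.mul_apply, Matrix.conjTranspose_apply,
    Matrix.kroneckerMap_apply, Fintype.sum_prod_type, star_mul']
  calc _ = ∑ c, ∑ d, ∑ a, ∑ b, V i a * ρ (a, b) (c, d) * star (V i' c) *
        ∑ k, W k b * star (W k d) := by
        simp only [Finset.sum_mul, Finset.mul_sum]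
        rw [Finset.sum_comm]
        refine Finset.sum_congr rfl fun c _ => ?_
        rw [Finset.sum_comm]
        refine Finset.sum_congr rfl fun d _ => ?_
        rw [Finset.sum_comm]
        refine Finset.sum_congr rfl fun a _ => ?_
        rw [Finset.sum_comm]
        exact Finset.sum_congr rfl fun b _ => Finset.sum_congr rfl fun k _ => by ring
    _ = _ := by
        simp only [h, mul_ite, mul_one, mul_zero, Finset.sum_ite_eq, Finset.mem_univ, if_true,
          Finset.sum_mul, Finset.mul_sum]
        refine Finset.sum_congr rfl fun c _ => ?_
        rw [Finset.sum_comm]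

lemma ptL_conj_kron (V : Matrix E A₁ ℂ) (W : Matrix F A₂ ℂ) (hV : Vᴴ * V = 1)
    (ρ : Matrix (A₁ × A₂) (A₁ × A₂) ℂ) :
    ptL ((V ⊗ₖ W) * ρ * (V ⊗ₖ W)ᴴ) = W * ptL ρ * Wᴴ := by
  have h := ptR_conj_kron W V hV (ρ.submatrix Prod.swap Prod.swap)
  have e : (W ⊗ₖ V) * (ρ.submatrix Prod.swap Prod.swap) * (W ⊗ₖ V)ᴴ =
      ((V ⊗ₖ W) * ρ * (V ⊗ₖ W)ᴴ).submatrix (Equiv.prodComm F E) (Equiv.prodComm F E) := by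
    have e1 : W ⊗ₖ V = (V ⊗ₖ W).submatrix (Equiv.prodComm F E) (Equiv.prodComm A₂ A₁) := by
      ext x y
      simp [mul_comm]
    have e2 : ρ.submatrix Prod.swap Prod.swap =
      ρ.submatrix (Equiv.prodComm A₂ A₁) (Equiv.prodComm A₂ A₁) := rfl
    rw [e1, e2, Matrix.conjTranspose_submatrix, Matrix.submatrix_mul_equiv,
      Matrix.submatrix_mul_equiv]
  rw [e] at h
  exact h

lemma vn_isom {V : Matrix E A₁ ℂ} (hV : Vᴴ * V = 1) {ρ : Matrix A₁ A₁ ℂ} (h : ρ.PosSemidef) :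
    vnEntropy (V * ρ * Vᴴ) = vnEntropy ρ := by
  have e : Vᴴ * (V * ρ) = ρ := by rw [← Matrix.mul_assoc, hV, Matrix.one_mul]
  rw [vn_mul_comm (V * ρ) Vᴴ (h.mul_mul_conjTranspose_same V).isHermitian
    (by rw [e]; exact h.isHermitian), e]

/-- Subadditivity of the conditional entropy in the form needed here. -/
lemma cond_subadd [Nonempty ι] [Nonempty κ] [Nonempty B₁] [Nonempty B₂]
    {τ : Matrix ((ι × B₁) × (κ × B₂)) ((ι × B₁) × (κ × B₂)) ℂ} (h : τ.PosSemidef) :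
    vnEntropy τ + vnEntropy (ptR (ptR τ)) + vnEntropy (ptR (ptL τ)) ≤
      vnEntropy (ptR τ) + vnEntropy (ptL τ) + vnEntropy (Matrix.of fun x y : ι × κ => ∑ b, ∑ c,
        τ ((x.1, b), (x.2, c)) ((y.1, b), (y.2, c))) := by
  let e1 : B₁ × (ι × (κ × B₂)) ≃ (ι × B₁) × (κ × B₂) :=
    ⟨fun x => ((x.2.1, x.1), x.2.2), fun y => (y.1.2, (y.1.1, y.2)), fun _ => rfl, fun _ => rfl⟩
  let e2 : B₂ × (κ × ι) ≃ ι × (κ × B₂) :=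
    ⟨fun x => (x.2.2, (x.2.1, x.1)), fun y => (y.2.2, (y.2.1, y.1)), fun _ => rfl, fun _ => rfl⟩
  have h1 : (τ.submatrix e1 e1).PosSemidef := h.submatrix e1
  have hη := ptL_posSemidef h1
  have h2 : ((ptL (τ.submatrix e1 e1)).submatrix e2 e2).PosSemidef := hη.submatrix e2
  have s1 := ssa h1
  have s2 := ssa h2
  rw [vn_submatrix h.isHermitian] at s1
  rw [vn_submatrix hη.isHermitian] at s2
  have a1 : trC (τ.submatrix e1 e1) =
      (ptR τ).submatrix (Equiv.prodComm B₁ ι) (Equiv.prodComm B₁ ι) := by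
    ext x y; rfl
  have a2 : ptL (trC (τ.submatrix e1 e1)) = ptR (ptR τ) := by
    rw [a1]; ext x y; rfl
  have a3 : trC ((ptL (τ.submatrix e1 e1)).submatrix e2 e2) =
      (ptL τ).submatrix (Equiv.prodComm B₂ κ) (Equiv.prodComm B₂ κ) := by
    ext x y
    simp only [trC, ptL, Matrix.of_apply, Matrix.submatrix_apply, Fintype.sum_prod_type]
    rfl
  have a4 : ptL (trC ((ptL (τ.submatrix e1 e1)).submatrix e2 e2)) = ptR (ptL τ) := by
    rw [a3]; ext x y; rfl
  have a5 : ptL ((ptL (τ.submatrix e1 e1)).submatrix e2 e2) =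
      (Matrix.of fun x y : ι × κ => ∑ b, ∑ c,
        τ ((x.1, b), (x.2, c)) ((y.1, b), (y.2, c))).submatrix
          (Equiv.prodComm κ ι) (Equiv.prodComm κ ι) := by
    ext x y
    simp only [ptL, Matrix.of_apply, Matrix.submatrix_apply]
    rw [Finset.sum_comm]
    rfl
  have hh : (Matrix.of fun x y : ι × κ => ∑ b, ∑ c,
        τ ((x.1, b), (x.2, c)) ((y.1, b), (y.2, c))).IsHermitian := by
    have := ((ptL_posSemidef h2).submatrix (Equiv.prodComm ι κ)).isHermitian
    rw [a5, Matrix.submatrix_submatrix] at this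
    exact this
  rw [a2, a1, vn_submatrix (ptR_posSemidef h).isHermitian] at s1
  rw [a4, a3, a5, vn_submatrix (ptL_posSemidef h).isHermitian, vn_submatrix hh] at s2
  linarith

lemma nonempty_of_kraus {A B ι : Type*} [Fintype A] [DecidableEq A] [Nonempty A] [Fintype B]
    [Fintype ι] {K : ι → Matrix B A ℂ} (hK : ∑ i, (K i)ᴴ * K i = 1) : Nonempty ι ∧ Nonempty B := by
  obtain ⟨a⟩ := ‹Nonempty A›
  have h := congrFun (congrFun hK a) a
  constructor
  · by_contra hc
    rw [not_nonempty_iff] at hc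
    simp at h
  · by_contra hc
    rw [not_nonempty_iff] at hc
    simp [Matrix.sum_apply, Matrix.mul_apply] at h

lemma entDiff_superadd [Nonempty A₁] [Nonempty A₂] {K : ι → Matrix B₁ A₁ ℂ}
    (hK : ∑ i, (K i)ᴴ * K i = 1) {L : κ → Matrix B₂ A₂ ℂ} (hL : ∑ j, (L j)ᴴ * L j = 1)
    {ρ : Matrix (A₁ × A₂) (A₁ × A₂) ℂ} (h : ρ.PosSemidef) :
    entDiff K (ptR ρ) + entDiff L (ptL ρ) ≤ entDiff (fun p : ι × κ => K p.1 ⊗ₖ L p.2) ρ := by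
  obtain ⟨_, _⟩ := nonempty_of_kraus hK
  obtain ⟨_, _⟩ := nonempty_of_kraus hL
  have iK := stK_isom hK
  have iL := stK_isom hL
  have iKL : (stK K ⊗ₖ stK L)ᴴ * (stK K ⊗ₖ stK L) = 1 := by
    rw [Matrix.conjTranspose_kronecker, ← Matrix.mul_kronecker_mul, iK, iL]; simp
  have key := cond_subadd (h.mul_mul_conjTranspose_same (stK K ⊗ₖ stK L))
  rw [← env_apply_kron, ptR_conj_kron _ _ iL, ptL_conj_kron _ _ iK, vn_isom iKL h,
    vn_isom iK (ptR_posSemidef h), vn_isom iL (ptL_posSemidef h)] at key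
  simp only [entDiff]
  rw [env, env]
  linarith

lemma kraus_kron {K : ι → Matrix B₁ A₁ ℂ}
    (hK : ∑ i, (K i)ᴴ * K i = 1) {L : κ → Matrix B₂ A₂ ℂ} (hL : ∑ j, (L j)ᴴ * L j = 1) :
    ∑ p : ι × κ, (K p.1 ⊗ₖ L p.2)ᴴ * (K p.1 ⊗ₖ L p.2) = 1 := by
  have : ∀ p : ι × κ, (K p.1 ⊗ₖ L p.2)ᴴ * (K p.1 ⊗ₖ L p.2) =
      ((K p.1)ᴴ * K p.1) ⊗ₖ ((L p.2)ᴴ * L p.2) := fun p => by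
    rw [Matrix.conjTranspose_kronecker, ← Matrix.mul_kronecker_mul]
  simp only [this]
  rw [← Matrix.one_kronecker_one, ← hK, ← hL]
  ext x y
  simp only [Matrix.sum_apply, Matrix.kroneckerMap_apply, Fintype.sum_prod_type,
    Finset.sum_mul_sum]

end tens

/-- Additivity of the entropy of a channel under tensor products:
H(N ⊗ M) = H(N) + H(M). -/
theorem chEnt_additive
    {A₁ B₁ A₂ B₂ ι κ : Type*}
    [Fintype A₁] [DecidableEq A₁] [Nonempty A₁] [Fintype B₁] [DecidableEq B₁]
    [Fintype A₂] [DecidableEq A₂] [Nonempty A₂] [Fintype B₂] [DecidableEq B₂]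
    [Fintype ι] [Fintype κ]
    (K : ι → Matrix B₁ A₁ ℂ) (hK : ∑ i, (K i)ᴴ * K i = 1)
    (L : κ → Matrix B₂ A₂ ℂ) (hL : ∑ j, (L j)ᴴ * L j = 1) :
    chEnt (krausMap (fun p : ι × κ => K p.1 ⊗ₖ L p.2)) =
      chEnt (krausMap K) + chEnt (krausMap L) := by
  classical
  have hKL := kraus_kron hK hL
  rw [chEnt_eq hK, chEnt_eq hL, chEnt_eq hKL]
  apply le_antisymm
  · rw [← sub_le_iff_le_add]
    refine le_csInf (nonempty_ent K) ?_
    rintro x ⟨ρ, hρ, rfl⟩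
    rw [sub_le_comm]
    refine le_csInf (nonempty_ent L) ?_
    rintro y ⟨τ, hτ, rfl⟩
    rw [sub_le_iff_le_add']
    refine csInf_le (bddBelow_ent hKL) ⟨ρ ⊗ₖ τ, kron_density hρ hτ, ?_⟩
    simp only [entDiff]
    rw [env_kron, vn_kron (env_density hK hρ) (env_density hL hτ), vn_kron hρ hτ]
    ring
  · refine le_csInf (nonempty_ent _) ?_
    rintro x ⟨ρ, hρ, rfl⟩
    refine le_trans (add_le_add ?_ ?_) (entDiff_superadd hK hL hρ.1)
    · exact csInf_le (bddBelow_ent hK)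
        ⟨ptR ρ, ⟨ptR_posSemidef hρ.1, by rw [trace_ptR, hρ.2]⟩, rfl⟩
    · exact csInf_le (bddBelow_ent hL)
        ⟨ptL ρ, ⟨ptL_posSemidef hρ.1, by rw [trace_ptL, hρ.2]⟩, rfl⟩

end QCh
end

section
/- For the completely randomizing channel R_{A→B}(X) = Tr(X)π_B, the channel relative entropy satisfies: for any bipartite states ρ_{RA}, σ_{RA}, D(N(ρ_{RA}) ‖ R(σ_{RA})) = D(N(ρ_{RA}) ‖ R(ρ_{RA})) + D(ρ_R ‖ σ_R). Consequently inf_σ D(N(ρ)‖R(σ)) = D(N(ρ)‖R(ρ)), so the adversarial channel divergence to R equals the ordinary channel divergence: D^adv(N‖R) = D(N‖R). -/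
open Matrix BigOperators
open scoped Kronecker ComplexOrder

namespace QCh

variable {n m : Type*} [Fintype n] [DecidableEq n] [Fintype m] [DecidableEq m]

open scoped Classical

/-- Extended-real-valued quantum relative entropy: +∞ when supp ρ ⊄ supp σ. -/
noncomputable def relEntE {A : Type*} [Fintype A] [DecidableEq A]
    (ρ σ : Matrix A A ℂ) : EReal :=
  if ∀ v : A → ℂ, σ *ᵥ v = 0 → ρ *ᵥ v = 0 then ((relEnt ρ σ : ℝ) : EReal) else ⊤

lemma matFun_eq_of_diag {A U : Matrix n n ℂ} (d : n → ℝ) (f : ℝ → ℝ)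
    (hU : Uᴴ * U = 1) (hA : A = U * Matrix.diagonal (fun i => (d i : ℂ)) * Uᴴ) :
    matFun f A = U * Matrix.diagonal (fun i => (f (d i) : ℂ)) * Uᴴ := by
  have hU' : U * Uᴴ = 1 := mul_eq_one_comm.mp hU
  have h : A.IsHermitian := by
    rw [hA, Matrix.IsHermitian]
    simp only [conjTranspose_mul, conjTranspose_conjTranspose, diagonal_conjTranspose, mul_assoc]
    congr 3
    ext i
    simp
  rw [matFun, dif_pos h]
  set V : Matrix n n ℂ := (h.eigenvectorUnitary : Matrix n n ℂ) with hV
  set e := h.eigenvalues with he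
  have hs : (star h.eigenvectorUnitary : Matrix n n ℂ) = Vᴴ := rfl
  rw [hs]
  have hVV : Vᴴ * V = 1 := by
    have := (Matrix.mem_unitaryGroup_iff' (A := V)).mp h.eigenvectorUnitary.2
    simpa [star_eq_conjTranspose] using this
  have hVV' : V * Vᴴ = 1 := mul_eq_one_comm.mp hVV
  have hA2 : A = V * Matrix.diagonal (fun i => (e i : ℂ)) * Vᴴ := by
    have := h.spectral_theorem
    rw [Unitary.conjStarAlgAut_apply] at this
    exact this
  -- intertwiner
  have hW : Matrix.diagonal (fun i => (d i : ℂ)) * (Uᴴ * V)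
      = (Uᴴ * V) * Matrix.diagonal (fun i => (e i : ℂ)) := by
    have h1 : Uᴴ * A * V = Matrix.diagonal (fun i => (d i : ℂ)) * (Uᴴ * V) := by
      rw [hA]
      calc _ = (Uᴴ * U) * diagonal (fun i => (d i : ℂ)) * (Uᴴ * V) := by noncomm_ring
        _ = _ := by rw [hU, one_mul]
    have h2 : Uᴴ * A * V = (Uᴴ * V) * Matrix.diagonal (fun i => (e i : ℂ)) := by
      rw [hA2]
      calc _ = (Uᴴ * V) * diagonal (fun i => (e i : ℂ)) * (Vᴴ * V) := by noncomm_ring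
        _ = _ := by rw [hVV, mul_one]
    rw [← h1, h2]
  have hW' : Matrix.diagonal (fun i => (f (d i) : ℂ)) * (Uᴴ * V)
      = (Uᴴ * V) * Matrix.diagonal (fun i => (f (e i) : ℂ)) := by
    ext i j
    have := congrFun (congrFun hW i) j
    rw [diagonal_mul, mul_diagonal] at this ⊢
    by_cases hz : (Uᴴ * V) i j = 0
    · simp [hz]
    · rw [mul_comm] at this
      have h3 := mul_left_cancel₀ hz this
      have h4 : d i = e j := by exact_mod_cast h3
      rw [h4, mul_comm]
  calc V * diagonal (fun i => (f (e i) : ℂ)) * Vᴴ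
      = (U * Uᴴ) * V * diagonal (fun i => (f (e i) : ℂ)) * Vᴴ := by rw [hU', one_mul]
    _ = U * ((Uᴴ * V) * diagonal (fun i => (f (e i) : ℂ))) * Vᴴ := by noncomm_ring
    _ = U * diagonal (fun i => (f (d i) : ℂ)) * Uᴴ * (V * Vᴴ) := by rw [← hW']; noncomm_ring
    _ = _ := by rw [hVV', mul_one]

lemma exists_diag {A : Matrix n n ℂ} (h : A.PosSemidef) :
    ∃ (U : Matrix n n ℂ) (d : n → ℝ), Uᴴ * U = 1 ∧ U * Uᴴ = 1 ∧ (∀ i, 0 ≤ d i) ∧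
      A = U * Matrix.diagonal (fun i => (d i : ℂ)) * Uᴴ := by
  have hVV : (h.1.eigenvectorUnitary : Matrix n n ℂ)ᴴ * (h.1.eigenvectorUnitary : Matrix n n ℂ)
      = 1 := by
    have := (Matrix.mem_unitaryGroup_iff').mp h.1.eigenvectorUnitary.2
    simpa [star_eq_conjTranspose] using this
  refine ⟨h.1.eigenvectorUnitary, h.1.eigenvalues, hVV, mul_eq_one_comm.mp hVV,
    h.eigenvalues_nonneg, ?_⟩
  have := h.1.spectral_theorem
  rw [Unitary.conjStarAlgAut_apply] at this
  exact this

lemma trace_two {U V : Matrix n n ℂ} (a b : n → ℝ) :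
    ((U * Matrix.diagonal (fun i => (a i : ℂ)) * Uᴴ) *
      (V * Matrix.diagonal (fun i => (b i : ℂ)) * Vᴴ)).trace
      = ((∑ i, ∑ j, Complex.normSq ((Uᴴ * V) i j) * (a i * b j) : ℝ) : ℂ) := by
  have : ((U * Matrix.diagonal (fun i => (a i : ℂ)) * Uᴴ) *
      (V * Matrix.diagonal (fun i => (b i : ℂ)) * Vᴴ)).trace
      = (diagonal (fun i => (a i : ℂ)) * ((Uᴴ * V) * diagonal (fun i => (b i : ℂ)) *
        (Uᴴ * V)ᴴ)).trace := by
    rw [show (U * Matrix.diagonal (fun i => (a i : ℂ)) * Uᴴ) *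
      (V * Matrix.diagonal (fun i => (b i : ℂ)) * Vᴴ) = U * (Matrix.diagonal (fun i => (a i : ℂ)) * Uᴴ *
      (V * Matrix.diagonal (fun i => (b i : ℂ)) * Vᴴ)) by noncomm_ring, trace_mul_comm]
    congr 1
    rw [conjTranspose_mul, conjTranspose_conjTranspose]
    noncomm_ring
  rw [this]
  generalize Uᴴ * V = W
  simp only [trace, diag_apply, diagonal_mul]
  push_cast
  refine Finset.sum_congr rfl fun i _ => ?_
  rw [mul_apply, Finset.mul_sum]
  refine Finset.sum_congr rfl fun j _ => ?_
  rw [mul_diagonal, conjTranspose_apply, Complex.normSq_eq_conj_mul_self]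
  simp only [Complex.star_def]
  ring

lemma scalar_klein {p q : ℝ} (hp : 0 ≤ p) (hq : 0 < q) :
    (p - q) / Real.log 2 ≤ p * (Real.logb 2 p - Real.logb 2 q) := by
  have h2 : 0 < Real.log 2 := Real.log_pos (by norm_num)
  rw [Real.logb, Real.logb, ← sub_div, ← mul_div_assoc]
  gcongr
  rcases hp.eq_or_lt with rfl | hp
  · simp; exact hq.le
  · have := Real.log_le_sub_one_of_pos (div_pos hq hp)
    rw [Real.log_div hq.ne' hp.ne'] at this
    have h3 := mul_le_mul_of_nonneg_left this hp.le
    have : p * (q / p - 1) = q - p := by field_simp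
    linarith

lemma relEnt_nonneg {ρ σ : Matrix n n ℂ} (hρ : IsDensity ρ) (hσ : IsDensity σ)
    (hs : ∀ v : n → ℂ, σ *ᵥ v = 0 → ρ *ᵥ v = 0) : 0 ≤ relEnt ρ σ := by
  obtain ⟨U, p, hU, hU', hp, hA⟩ := exists_diag hρ.1
  obtain ⟨V, q, hV, hV', hq, hB⟩ := exists_diag hσ.1
  have hlogρ : ρ * matLog2 ρ = (U * diagonal (fun i => ((p i * Real.logb 2 (p i) : ℝ) : ℂ)) * Uᴴ)
      * (V * diagonal (fun i => ((1 : ℝ) : ℂ)) * Vᴴ) := by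
    rw [matLog2, matFun_eq_of_diag p _ hU hA]
    conv_lhs => enter [1]; rw [hA]
    have : (V * diagonal (fun i => ((1 : ℝ) : ℂ)) * Vᴴ) = 1 := by simp [hV']
    rw [this, mul_one]
    calc _ = U * diagonal (fun i => (p i : ℂ)) * (Uᴴ * U) *
          diagonal (fun i => (Real.logb 2 (p i) : ℂ)) * Uᴴ := by noncomm_ring
      _ = _ := by
        rw [hU, mul_one, mul_assoc U, diagonal_mul_diagonal]
        simp
  have hlogσ : ρ * matLog2 σ = (U * diagonal (fun i => (p i : ℂ)) * Uᴴ)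
      * (V * diagonal (fun i => (Real.logb 2 (q i) : ℂ)) * Vᴴ) := by
    rw [matLog2, matFun_eq_of_diag q _ hV hB, ← hA]
  have htρ : ρ.trace = ((U * diagonal (fun i => (p i : ℂ)) * Uᴴ)
      * (V * diagonal (fun i => ((1 : ℝ) : ℂ)) * Vᴴ)).trace := by
    rw [← hA]; simp [hV']
  have htσ : σ.trace = ((U * diagonal (fun i => ((1 : ℝ) : ℂ)) * Uᴴ)
      * (V * diagonal (fun i => (q i : ℂ)) * Vᴴ)).trace := by
    rw [← hB]; simp [hU']
  rw [trace_two, hρ.2] at htρ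
  rw [trace_two, hσ.2] at htσ
  have htρ' : (1 : ℝ) = ∑ i, ∑ j, Complex.normSq ((Uᴴ * V) i j) * (p i * 1) := by
    exact_mod_cast htρ
  have htσ' : (1 : ℝ) = ∑ i, ∑ j, Complex.normSq ((Uᴴ * V) i j) * (1 * q j) := by
    exact_mod_cast htσ
  have hker : ∀ i j, q j = 0 → (p i : ℂ) * (Uᴴ * V) i j = 0 := by
    intro i j hj
    have h1 : σ *ᵥ (V.col j) = 0 := by
      have : σ * V = V * diagonal (fun i => (q i : ℂ)) := by
        rw [hB, mul_assoc, hV, mul_one]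
      ext k
      have := congrFun (congrFun this k) j
      rw [mul_diagonal, hj] at this
      simpa [mul_apply, mulVec, dotProduct] using this
    have h2 := hs _ h1
    have h3 : (Uᴴ *ᵥ (ρ *ᵥ V.col j)) i = 0 := by rw [h2]; simp
    have h4 : Uᴴ * ρ * V = diagonal (fun i => (p i : ℂ)) * (Uᴴ * V) := by
      rw [hA]
      calc _ = (Uᴴ * U) * diagonal (fun i => (p i : ℂ)) * (Uᴴ * V) := by noncomm_ring
        _ = _ := by rw [hU, one_mul]
    rw [mulVec_mulVec] at h3
    have := congrFun (congrFun h4 i) j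
    rw [diagonal_mul] at this
    rw [← this, ← h3]
    simp [mul_apply, mulVec, dotProduct]
  rw [relEnt, mul_sub, hlogρ, hlogσ, trace_sub, trace_two, trace_two, ← Complex.ofReal_sub,
    Complex.ofReal_re, ← Finset.sum_sub_distrib]
  have key : ∑ i, ∑ j, Complex.normSq ((Uᴴ * V) i j) * ((p i - q j) / Real.log 2) = 0 := by
    have : ∑ i, ∑ j, Complex.normSq ((Uᴴ * V) i j) * ((p i - q j) / Real.log 2)
      = (∑ i, ∑ j, Complex.normSq ((Uᴴ * V) i j) * (p i * 1)
        - ∑ i, ∑ j, Complex.normSq ((Uᴴ * V) i j) * (1 * q j)) / Real.log 2 := by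
      rw [← Finset.sum_sub_distrib, Finset.sum_div]
      refine Finset.sum_congr rfl fun i _ => ?_
      rw [← Finset.sum_sub_distrib, Finset.sum_div]
      refine Finset.sum_congr rfl fun j _ => ?_
      ring
    rw [this, ← htρ', ← htσ']; simp
  rw [← key]
  refine Finset.sum_le_sum fun i _ => ?_
  rw [← Finset.sum_sub_distrib]
  refine Finset.sum_le_sum fun j _ => ?_
  rw [← mul_sub, mul_one, ← mul_sub]
  rcases (hq j).eq_or_lt with h0 | h0
  · rcases mul_eq_zero.mp (hker i j h0.symm) with h | h
    · have : p i = 0 := by exact_mod_cast h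
      simp [this, ← h0]
    · simp [h]
  · exact mul_le_mul_of_nonneg_left (scalar_klein (hp i) h0) (Complex.normSq_nonneg _)

section bip
variable {R B : Type*} [Fintype R] [DecidableEq R] [Fintype B] [DecidableEq B]

lemma ptR_eq_sum (M : Matrix (R × B) (R × B) ℂ) :
    ptR M = ∑ b, M.submatrix (fun i => (i, b)) (fun i => (i, b)) := by
  ext i j
  simp [ptR, Matrix.sum_apply]

lemma ptR_psd {M : Matrix (R × B) (R × B) ℂ} (h : M.PosSemidef) : (ptR M).PosSemidef := by
  rw [ptR_eq_sum]
  exact posSemidef_sum _ fun b _ => h.submatrix _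

lemma ptR_trace (M : Matrix (R × B) (R × B) ℂ) : (ptR M).trace = M.trace := by
  simp [ptR, trace, Fintype.sum_prod_type]

lemma ptR_density {M : Matrix (R × B) (R × B) ℂ} (h : IsDensity M) : IsDensity (ptR M) :=
  ⟨ptR_psd h.1, (ptR_trace M).trans h.2⟩

lemma trace_mul_kron_one (M : Matrix (R × B) (R × B) ℂ) (X : Matrix R R ℂ) :
    (M * (X ⊗ₖ (1 : Matrix B B ℂ))).trace = (ptR M * X).trace := by
  simp only [trace, diag_apply, mul_apply, Fintype.sum_prod_type, kroneckerMap_apply, ptR, of_apply,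
    one_apply, mul_ite, mul_one, mul_zero, Finset.sum_ite_eq', Finset.mem_univ, if_true,
    Finset.sum_mul]
  refine Finset.sum_congr rfl fun i _ => ?_
  rw [Finset.sum_comm]

/-- the vector `u ⊗ e_b` -/
noncomputable def prodVec (u : R → ℂ) (b : B) : R × B → ℂ := fun p => if p.2 = b then u p.1 else 0

lemma mulVec_prodVec (M : Matrix (R × B) (R × B) ℂ) (u : R → ℂ) (b : B) (p : R × B) :
    (M *ᵥ prodVec u b) p = ∑ i, M p (i, b) * u i := by
  simp [mulVec, dotProduct, prodVec, Fintype.sum_prod_type]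

lemma kron_mulVec (X : Matrix R R ℂ) (c : ℂ) (v : R × B → ℂ) (i : R) (b : B) :
    ((X ⊗ₖ (c • (1 : Matrix B B ℂ))) *ᵥ v) (i, b) = c * (X *ᵥ fun j => v (j, b)) i := by
  simp [mulVec, dotProduct, Fintype.sum_prod_type, one_apply, Finset.mul_sum]
  refine Finset.sum_congr rfl fun i _ => ?_
  ring

lemma quad_prodVec (M : Matrix (R × B) (R × B) ℂ) (u : R → ℂ) (b : B) :
    star (prodVec u b) ⬝ᵥ M *ᵥ prodVec u b =
      star u ⬝ᵥ (M.submatrix (fun i => (i, b)) (fun i => (i, b))) *ᵥ u := by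
  simp only [dotProduct, Fintype.sum_prod_type, mulVec_prodVec]
  refine Finset.sum_congr rfl fun i _ => ?_
  simp [prodVec, apply_ite, mulVec, dotProduct]

lemma mulVec_decomp (M : Matrix (R × B) (R × B) ℂ) (v : R × B → ℂ)
    (h : ∀ b, M *ᵥ prodVec (fun j => v (j, b)) b = 0) : M *ᵥ v = 0 := by
  ext p
  have : (M *ᵥ v) p = ∑ b, (M *ᵥ prodVec (fun j => v (j, b)) b) p := by
    simp only [mulVec_prodVec]
    rw [Finset.sum_comm]
    simp [mulVec, dotProduct, Fintype.sum_prod_type]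
  rw [this]
  simp [h]

lemma ker_ptR {M : Matrix (R × B) (R × B) ℂ} (hM : M.PosSemidef) (u : R → ℂ)
    (hu : ptR M *ᵥ u = 0) (b : B) : M *ᵥ prodVec u b = 0 := by
  rw [← hM.dotProduct_mulVec_zero_iff]
  have h0 : ∑ b, star (prodVec u b) ⬝ᵥ M *ᵥ prodVec u b = 0 := by
    simp only [quad_prodVec]
    rw [← dotProduct_sum, ← Matrix.sum_mulVec, ← ptR_eq_sum, hu, dotProduct_zero]
  rw [Finset.sum_eq_zero_iff_of_nonneg (fun b _ => hM.dotProduct_mulVec_nonneg _)] at h0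
  exact h0 b (Finset.mem_univ _)

lemma supp_iff {M : Matrix (R × B) (R × B) ℂ} (hM : M.PosSemidef) (τ : Matrix R R ℂ) {c : ℂ}
    (hc : c ≠ 0) :
    (∀ v, (τ ⊗ₖ (c • (1 : Matrix B B ℂ))) *ᵥ v = 0 → M *ᵥ v = 0) ↔
      ∀ u, τ *ᵥ u = 0 → ptR M *ᵥ u = 0 := by
  constructor
  · intro h u hu
    have h1 : ∀ b, M *ᵥ prodVec u b = 0 := by
      intro b
      apply h
      ext ⟨i, b'⟩
      rw [kron_mulVec]
      by_cases hb : b' = b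
      · simp [prodVec, hb, hu]
      · have : (fun j => prodVec u b (j, b')) = 0 := by ext j; simp [prodVec, hb]
        rw [this]; simp
    ext i
    have : (ptR M *ᵥ u) i = ∑ b, (M *ᵥ prodVec u b) (i, b) := by
      simp only [mulVec_prodVec]
      rw [Finset.sum_comm]
      simp [mulVec, dotProduct, ptR, Finset.sum_mul]
    rw [this]
    simp [h1]
  · intro h v hv
    apply mulVec_decomp
    intro b
    apply ker_ptR hM
    apply h
    ext i
    have := congrFun hv (i, b)
    rw [kron_mulVec] at this
    simpa [hc] using this

lemma matLog2_kron {τ : Matrix R R ℂ} (hτ : τ.PosSemidef) {c : ℝ} (hc : 0 < c) :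
    ∃ P : Matrix R R ℂ, τ * (1 - P) = 0 ∧
      matLog2 (τ ⊗ₖ ((c : ℂ) • (1 : Matrix B B ℂ))) =
        (matLog2 τ + (Real.logb 2 c : ℂ) • P) ⊗ₖ (1 : Matrix B B ℂ) := by
  obtain ⟨U, d, hU, hU', hd, hA⟩ := exists_diag hτ
  refine ⟨U * diagonal (fun i => if d i = 0 then 0 else 1) * Uᴴ, ?_, ?_⟩
  · rw [mul_sub, mul_one, sub_eq_zero]
    conv_rhs => rw [hA]
    calc τ = U * (diagonal (fun i => (d i : ℂ)) * diagonal (fun i => if d i = 0 then 0 else 1))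
          * Uᴴ := by
          rw [diagonal_mul_diagonal, hA]
          congr 3
          ext i
          by_cases h : d i = 0 <;> simp [h]
      _ = U * diagonal (fun i => (d i : ℂ)) * (Uᴴ * U) *
          diagonal (fun i => if d i = 0 then 0 else 1) * Uᴴ := by
          rw [hU, mul_one]; noncomm_ring
      _ = _ := by noncomm_ring
  · have hk : τ ⊗ₖ ((c : ℂ) • (1 : Matrix B B ℂ)) =
        (U ⊗ₖ (1 : Matrix B B ℂ)) * diagonal (fun p : R × B => ((d p.1 * c : ℝ) : ℂ)) *
          (U ⊗ₖ (1 : Matrix B B ℂ))ᴴ := by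
      have : diagonal (fun p : R × B => ((d p.1 * c : ℝ) : ℂ)) =
          diagonal (fun i => (d i : ℂ)) ⊗ₖ diagonal (fun _ : B => (c : ℂ)) := by
        rw [diagonal_kronecker_diagonal]; simp
      rw [this, conjTranspose_kronecker, ← mul_kronecker_mul, ← mul_kronecker_mul, ← hA]
      simp [smul_one_eq_diagonal]
    have hUU : (U ⊗ₖ (1 : Matrix B B ℂ))ᴴ * (U ⊗ₖ (1 : Matrix B B ℂ)) = 1 := by
      rw [conjTranspose_kronecker, ← mul_kronecker_mul, hU]; simp
    rw [matLog2, matFun_eq_of_diag _ _ hUU hk, matLog2, matFun_eq_of_diag d _ hU hA]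
    have : diagonal (fun p : R × B => ((Real.logb 2 (d p.1 * c) : ℝ) : ℂ)) =
          (diagonal (fun i => (Real.logb 2 (d i) : ℂ)) +
            (Real.logb 2 c : ℂ) • diagonal (fun i => if d i = 0 then 0 else 1))
            ⊗ₖ (1 : Matrix B B ℂ) := by
      rw [← diagonal_smul, diagonal_add, ← diagonal_one, diagonal_kronecker_diagonal]
      congr 1
      ext p
      by_cases h : d p.1 = 0
      · simp [h]
      · rw [Real.logb_mul h hc.ne']
        simp [h]
    rw [this, conjTranspose_kronecker, ← mul_kronecker_mul, ← mul_kronecker_mul]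
    simp [mul_add, add_mul]

lemma relEnt_kron {M : Matrix (R × B) (R × B) ℂ} (hM : IsDensity M)
    {τ : Matrix R R ℂ} (hτ : τ.PosSemidef) {c : ℝ} (hc : 0 < c)
    (hs : ∀ u, τ *ᵥ u = 0 → ptR M *ᵥ u = 0) :
    relEnt M (τ ⊗ₖ ((c : ℂ) • (1 : Matrix B B ℂ))) =
      (M * matLog2 M).trace.re - (ptR M * matLog2 τ).trace.re - Real.logb 2 c := by
  obtain ⟨P, hP, hlog⟩ := matLog2_kron (B := B) hτ hc
  have h1 : ptR M * (1 - P) = 0 := by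
    ext i j
    have h2 : τ *ᵥ ((1 - P).col j) = 0 := by
      ext k
      have := congrFun (congrFun hP k) j
      simpa only [mul_apply, mulVec, dotProduct, Matrix.col_apply, Matrix.zero_apply, Pi.zero_apply] using this
    have := congrFun (hs _ h2) i
    simpa only [mul_apply, mulVec, dotProduct, Matrix.col_apply, Matrix.zero_apply, Pi.zero_apply] using this
  have h3 : ptR M * P = ptR M := by
    rw [mul_sub, mul_one, sub_eq_zero] at h1
    exact h1.symm
  rw [relEnt, mul_sub, trace_sub, hlog, trace_mul_kron_one, mul_add, mul_smul_comm, h3, trace_add,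
    trace_smul, ptR_trace, hM.2]
  simp
  ring

end bip

section chan
variable {R A B ι : Type*} [Fintype R] [DecidableEq R] [Fintype A] [DecidableEq A]
    [Fintype B] [DecidableEq B] [Fintype ι]

lemma ext_eq (K : ι → Matrix B A ℂ) (ρ : Matrix (R × A) (R × A) ℂ) :
    ext (krausMap K) ρ = ∑ i, ((1 : Matrix R R ℂ) ⊗ₖ K i) * ρ * ((1 : Matrix R R ℂ) ⊗ₖ K i)ᴴ := by
  ext p q
  simp only [ext, krausMap, of_apply, Matrix.sum_apply]
  refine Finset.sum_congr rfl fun i _ => ?_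
  simp [mul_apply, Fintype.sum_prod_type, one_apply, conjTranspose_apply, apply_ite]

lemma ext_psd (K : ι → Matrix B A ℂ) {ρ : Matrix (R × A) (R × A) ℂ} (h : ρ.PosSemidef) :
    (ext (krausMap K) ρ).PosSemidef := by
  rw [ext_eq]
  exact posSemidef_sum _ fun i _ => h.mul_mul_conjTranspose_same _

lemma ptR_ext (K : ι → Matrix B A ℂ) (hK : ∑ i, (K i)ᴴ * K i = 1)
    (ρ : Matrix (R × A) (R × A) ℂ) : ptR (ext (krausMap K) ρ) = ptR ρ := by
  ext r s
  have : ∀ X : Matrix A A ℂ, (krausMap K X).trace = X.trace := by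
    intro X
    rw [krausMap, trace_sum]
    simp only [trace_mul_cycle (K _) X]
    rw [← trace_sum, ← Finset.sum_mul, hK, one_mul]
  exact this (Matrix.of fun a a' => ρ (r, a) (s, a'))

lemma ext_density (K : ι → Matrix B A ℂ) (hK : ∑ i, (K i)ᴴ * K i = 1)
    {ρ : Matrix (R × A) (R × A) ℂ} (h : IsDensity ρ) : IsDensity (ext (krausMap K) ρ) :=
  ⟨ext_psd K h.1, by rw [← ptR_trace, ptR_ext K hK, ptR_trace, h.2]⟩

end chan

/-- For the completely randomizing channel R(X) = Tr(X)π_B,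
D(N(ρ_{RA}) ‖ R(σ_{RA})) = D(N(ρ_{RA}) ‖ R(ρ_{RA})) + D(ρ_R ‖ σ_R) for all states
ρ_{RA}, σ_{RA}; consequently D^adv(N‖R) = D(N‖R). -/
theorem adversarial_divergence_to_randomizing
    {R A B ι : Type*} [Fintype R] [DecidableEq R] [Fintype A] [DecidableEq A]
    [Fintype B] [DecidableEq B] [Nonempty B] [Fintype ι]
    (K : ι → Matrix B A ℂ) (hK : ∑ i, (K i)ᴴ * K i = 1) :
    (∀ ρ σ : Matrix (R × A) (R × A) ℂ, IsDensity ρ → IsDensity σ →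
      relEntE (ext (krausMap K) ρ)
          ((ptR σ) ⊗ₖ (((Fintype.card B : ℂ))⁻¹ • (1 : Matrix B B ℂ))) =
        relEntE (ext (krausMap K) ρ)
            ((ptR ρ) ⊗ₖ (((Fintype.card B : ℂ))⁻¹ • (1 : Matrix B B ℂ))) +
          relEntE (ptR ρ) (ptR σ)) ∧
    (⨆ ρ : {ρ : Matrix (R × A) (R × A) ℂ // IsDensity ρ},
        ⨅ σ : {σ : Matrix (R × A) (R × A) ℂ // IsDensity σ},
          relEntE (ext (krausMap K) ρ.1)
            ((ptR σ.1) ⊗ₖ (((Fintype.card B : ℂ))⁻¹ • (1 : Matrix B B ℂ)))) =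
      (⨆ ρ : {ρ : Matrix (R × A) (R × A) ℂ // IsDensity ρ},
          relEntE (ext (krausMap K) ρ.1)
            ((ptR ρ.1) ⊗ₖ (((Fintype.card B : ℂ))⁻¹ • (1 : Matrix B B ℂ)))) := by
  have hcast : ((Fintype.card B : ℂ))⁻¹ = (((Fintype.card B : ℝ)⁻¹ : ℝ) : ℂ) := by simp
  have hc : (0 : ℝ) < (Fintype.card B : ℝ)⁻¹ := by
    have : 0 < Fintype.card B := Fintype.card_pos
    positivity
  rw [hcast]
  generalize (Fintype.card B : ℝ)⁻¹ = c at hc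
  have hc' : (c : ℂ) ≠ 0 := by exact_mod_cast hc.ne'
  have main : ∀ ρ σ : Matrix (R × A) (R × A) ℂ, IsDensity ρ → IsDensity σ →
      relEntE (ext (krausMap K) ρ) ((ptR σ) ⊗ₖ ((c : ℂ) • (1 : Matrix B B ℂ))) =
        relEntE (ext (krausMap K) ρ) ((ptR ρ) ⊗ₖ ((c : ℂ) • (1 : Matrix B B ℂ))) +
          relEntE (ptR ρ) (ptR σ) := by
    intro ρ σ hρ hσ
    have hω := ext_density K hK hρ
    have hpt := ptR_ext K hK ρ
    have h1 : ∀ u, ptR ρ *ᵥ u = 0 → ptR (ext (krausMap K) ρ) *ᵥ u = 0 := by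
      intro u hu; rw [hpt, hu]
    have hfin := (supp_iff hω.1 (ptR ρ) hc').mpr h1
    have hiff := supp_iff hω.1 (ptR σ) hc'
    unfold relEntE
    rw [if_pos hfin]
    by_cases hs : ∀ u, ptR σ *ᵥ u = 0 → ptR ρ *ᵥ u = 0
    · have hs' : ∀ u, ptR σ *ᵥ u = 0 → ptR (ext (krausMap K) ρ) *ᵥ u = 0 := by
        rw [hpt]; exact hs
      rw [if_pos (hiff.mpr hs'), if_pos hs, ← EReal.coe_add,
        relEnt_kron hω (ptR_psd hσ.1) hc hs', relEnt_kron hω (ptR_psd hρ.1) hc h1, hpt]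
      congr 1
      rw [relEnt, mul_sub, trace_sub, Complex.sub_re]
      ring
    · have hs' : ¬ ∀ v, (ptR σ ⊗ₖ ((c : ℂ) • (1 : Matrix B B ℂ))) *ᵥ v = 0 →
          ext (krausMap K) ρ *ᵥ v = 0 := by
        rw [hiff, hpt]; exact hs
      rw [if_neg hs', if_neg hs, EReal.coe_add_top]
  refine ⟨main, ?_⟩
  congr 1
  ext ρ
  apply le_antisymm
  · exact iInf_le _ ρ
  · refine le_iInf fun σ => ?_
    rw [main ρ.1 σ.1 ρ.2 σ.2]
    refine le_add_of_nonneg_right ?_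
    unfold relEntE
    split_ifs with hs
    · exact_mod_cast relEnt_nonneg (ptR_density ρ.2) (ptR_density σ.2) hs
    · exact le_top

end QCh
end

section
/- The min-entropy of a quantum channel equals minus the log of the operator norm of its (unnormalized) Choi operator: inf over pure bipartite inputs ψ_{RA} of H_min(B|R)_{N(ψ)} = −log₂‖N_{A→B}(Γ_{RA})‖_∞, where Γ_{RA} = |Γ⟩⟨Γ| with |Γ⟩ = Σᵢ |i⟩|i⟩. -/
open Matrix BigOperators
open scoped Kronecker ComplexOrder

namespace QCh

variable {n m : Type*} [Fintype n] [DecidableEq n] [Fintype m] [DecidableEq m]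

/-- Operator (spectral) norm of a matrix. -/
noncomputable def opNorm {A : Type*} [Fintype A] [DecidableEq A] (M : Matrix A A ℂ) : ℝ :=
  ‖(Matrix.toEuclideanCLM (𝕜 := ℂ) M : EuclideanSpace ℂ A →L[ℂ] EuclideanSpace ℂ A)‖

/-- Extended-real-valued max-relative entropy D_max(ρ‖X) = inf {λ : ρ ≤ 2^λ X}. -/
noncomputable def dMaxE {A : Type*} [Fintype A] [DecidableEq A]
    (ρ σ : Matrix A A ℂ) : EReal :=
  sInf ((fun l : ℝ => (l : EReal)) ''
    {l : ℝ | ((((2 : ℝ) ^ l : ℝ) : ℂ) • σ - ρ).PosSemidef})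

/-- Conditional min-entropy H_min(B|R)_ω = −inf_{σ_R} D_max(ω ‖ σ_R ⊗ I_B). -/
noncomputable def condHmin {R B : Type*} [Fintype R] [DecidableEq R]
    [Fintype B] [DecidableEq B] (ω : Matrix (R × B) (R × B) ℂ) : EReal :=
  -(⨅ σ : {σ : Matrix R R ℂ // IsDensity σ}, dMaxE ω (σ.1 ⊗ₖ (1 : Matrix B B ℂ)))

/-- The unnormalized maximally entangled operator Γ = |Γ⟩⟨Γ|, |Γ⟩ = Σᵢ |ii⟩. -/
noncomputable def gammaOp (A : Type*) [Fintype A] [DecidableEq A] :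
    Matrix (A × A) (A × A) ℂ :=
  Matrix.of fun p q => if p.1 = p.2 ∧ q.1 = q.2 then 1 else 0

/-- The Kraus form of the extended channel. -/
lemma ext_kraus {R A B ι : Type*} [Fintype R] [DecidableEq R] [Fintype A] [DecidableEq A]
    [Fintype B] [DecidableEq B] [Fintype ι] (K : ι → Matrix B A ℂ)
    (ψ : Matrix (R × A) (R × A) ℂ) :
    ext (krausMap K) ψ =
      ∑ i, ((1 : Matrix R R ℂ) ⊗ₖ K i) * ψ * ((1 : Matrix R R ℂ) ⊗ₖ K i)ᴴ := by
  ext ⟨r, b⟩ ⟨r', b'⟩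
  simp only [ext, krausMap, Matrix.of_apply, Matrix.sum_apply]
  refine Finset.sum_congr rfl fun i _ => ?_
  simp [Matrix.mul_apply, Fintype.sum_prod_type, Matrix.one_apply, ite_mul, apply_ite]

/-- The vectorised form of a matrix. -/
def vecOf {A B : Type*} (X : Matrix A B ℂ) : A × B → ℂ := fun p => X p.1 p.2

lemma kron_mulVec_s10 {A B C : Type*} [Fintype A] [DecidableEq A] [Fintype B] [DecidableEq B]
    [Fintype C] (X : Matrix C A ℂ) (W : Matrix A B ℂ) :
    (X ⊗ₖ (1 : Matrix B B ℂ)) *ᵥ vecOf W = vecOf (X * W) := by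
  ext ⟨r, b⟩
  simp [vecOf, Matrix.mulVec, dotProduct, Matrix.mul_apply, Fintype.sum_prod_type, Matrix.one_apply]

lemma gamma_eq (A : Type*) [Fintype A] [DecidableEq A] :
    gammaOp A = vecMulVec (vecOf (1 : Matrix A A ℂ)) (star (vecOf (1 : Matrix A A ℂ))) := by
  ext ⟨r, b⟩ ⟨r', b'⟩
  simp only [gammaOp, vecOf, vecMulVec_apply, Matrix.of_apply, Pi.star_apply, Matrix.one_apply]
  by_cases h : r = b <;> by_cases h' : r' = b' <;> simp [h, h']

lemma vec_eq {A : Type*} [Fintype A] [DecidableEq A] (X : Matrix A A ℂ) :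
    vecMulVec (vecOf X) (star (vecOf X)) =
      (X ⊗ₖ (1 : Matrix A A ℂ)) * gammaOp A * (X ⊗ₖ (1 : Matrix A A ℂ))ᴴ := by
  rw [gamma_eq, mul_vecMulVec, vecMulVec_mul, kron_mulVec_s10, ← star_mulVec, kron_mulVec_s10]
  simp

lemma ext_vec {A B ι : Type*} [Fintype A] [DecidableEq A]
    [Fintype B] [DecidableEq B] [Fintype ι] (K : ι → Matrix B A ℂ) (X : Matrix A A ℂ) :
    ext (krausMap K) (vecMulVec (vecOf X) (star (vecOf X))) =
      (X ⊗ₖ (1 : Matrix B B ℂ)) * ext (krausMap K) (gammaOp A) * (X ⊗ₖ (1 : Matrix B B ℂ))ᴴ := by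
  rw [ext_kraus, ext_kraus, vec_eq, Finset.mul_sum, Finset.sum_mul]
  refine Finset.sum_congr rfl fun i _ => ?_
  have h : (X ⊗ₖ (1 : Matrix B B ℂ)) * ((1 : Matrix A A ℂ) ⊗ₖ K i) =
      ((1 : Matrix A A ℂ) ⊗ₖ K i) * (X ⊗ₖ (1 : Matrix A A ℂ)) := by
    rw [← mul_kronecker_mul, ← mul_kronecker_mul]; simp
  have h2 := congrArg conjTranspose h
  rw [conjTranspose_mul, conjTranspose_mul] at h2
  calc _ = (((1 : Matrix A A ℂ) ⊗ₖ K i) * (X ⊗ₖ (1 : Matrix A A ℂ))) * gammaOp A *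
        ((X ⊗ₖ (1 : Matrix A A ℂ))ᴴ * ((1 : Matrix A A ℂ) ⊗ₖ K i)ᴴ) := by
        simp only [Matrix.mul_assoc]
    _ = _ := by rw [← h, ← h2]; simp only [Matrix.mul_assoc]

lemma gamma_psd (A : Type*) [Fintype A] [DecidableEq A] : (gammaOp A).PosSemidef := by
  rw [gamma_eq]; exact posSemidef_vecMulVec_self_star _

lemma choi_psd {A B ι : Type*} [Fintype A] [DecidableEq A]
    [Fintype B] [DecidableEq B] [Fintype ι] (K : ι → Matrix B A ℂ) :
    (ext (krausMap K) (gammaOp A)).PosSemidef := by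
  rw [ext_kraus]
  exact posSemidef_sum _ fun i _ => (gamma_psd A).mul_mul_conjTranspose_same _

lemma vec_norm {A B : Type*} [Fintype A] [Fintype B] (X : Matrix A B ℂ) :
    star (vecOf X) ⬝ᵥ vecOf X = (X * Xᴴ).trace := by
  simp [Matrix.trace, Matrix.mul_apply, dotProduct, vecOf, Fintype.sum_prod_type, mul_comm]

lemma choi_trace {A B ι : Type*} [Fintype A] [DecidableEq A]
    [Fintype B] [DecidableEq B] [Fintype ι] (K : ι → Matrix B A ℂ)
    (hK : ∑ i, (K i)ᴴ * K i = 1) :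
    (ext (krausMap K) (gammaOp A)).trace = Fintype.card A := by
  rw [ext_kraus, trace_sum]
  have : ∀ i, (((1 : Matrix A A ℂ) ⊗ₖ K i) * gammaOp A * ((1 : Matrix A A ℂ) ⊗ₖ K i)ᴴ).trace =
      (((1 : Matrix A A ℂ) ⊗ₖ ((K i)ᴴ * K i)) * gammaOp A).trace := by
    intro i
    rw [trace_mul_comm, ← Matrix.mul_assoc, conjTranspose_kronecker, ← mul_kronecker_mul]
    simp
  simp_rw [this]
  rw [← trace_sum, ← Finset.sum_mul]
  have h2 : ∑ i, ((1 : Matrix A A ℂ) ⊗ₖ ((K i)ᴴ * K i)) = 1 := by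
    have : ∑ i, ((1 : Matrix A A ℂ) ⊗ₖ ((K i)ᴴ * K i)) =
        (1 : Matrix A A ℂ) ⊗ₖ (∑ i, (K i)ᴴ * K i) := by
      ext ⟨r, b⟩ ⟨r', b'⟩
      simp [Matrix.sum_apply, Finset.mul_sum]
    rw [this, hK]; simp
  rw [h2, Matrix.one_mul]
  rw [gamma_eq, trace_vecMulVec, dotProduct_comm, vec_norm]
  simp

open scoped MatrixOrder Matrix.Norms.L2Operator in
lemma psd_opNorm {n : Type*} [Fintype n] [DecidableEq n] [Nonempty n] {J : Matrix n n ℂ}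
    (hJ : J.PosSemidef) :
    (((opNorm J : ℝ) : ℂ) • (1 : Matrix n n ℂ) - J).PosSemidef ∧
      ∃ φ : n → ℂ, star φ ⬝ᵥ φ = 1 ∧ J *ᵥ φ = ((opNorm J : ℝ) : ℂ) • φ := by
  have hn : opNorm J = ‖J‖ := rfl
  constructor
  · have := IsSelfAdjoint.le_algebraMap_norm_self (a := J) hJ.1
    rw [Matrix.le_iff] at this
    rw [hn]
    have e : ((‖J‖ : ℝ) : ℂ) • (1 : Matrix n n ℂ) = algebraMap ℝ (Matrix n n ℂ) ‖J‖ := by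
      ext i j
      simp [Algebra.algebraMap_eq_smul_one, Matrix.smul_apply]
    rw [e]
    exact this
  · have := CStarAlgebra.norm_mem_spectrum_of_nonneg (a := J) (Matrix.nonneg_iff_posSemidef.2 hJ)
    rw [hJ.1.spectrum_real_eq_range_eigenvalues] at this
    obtain ⟨i, hi⟩ := this
    refine ⟨(hJ.1.eigenvectorBasis i).ofLp, ?_, ?_⟩
    · have := hJ.1.eigenvectorBasis.orthonormal.1 i
      have h2 : inner ℂ (hJ.1.eigenvectorBasis i) (hJ.1.eigenvectorBasis i) = (1 : ℂ) := by
        rw [inner_self_eq_norm_sq_to_K, this]; simp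
      rw [EuclideanSpace.inner_eq_star_dotProduct] at h2
      rw [dotProduct_comm]; exact h2
    · rw [hJ.1.mulVec_eigenvectorBasis, hi, hn]
      ext j
      simp

lemma pure_rank_one {n : Type*} [Fintype n] [DecidableEq n] {ψ : Matrix n n ℂ} (h : IsPure ψ) :
    ∃ v : n → ℂ, ψ = vecMulVec v (star v) ∧ star v ⬝ᵥ v = 1 := by
  obtain ⟨⟨hp, ht⟩, hi⟩ := h
  have hne : ψ ≠ 0 := by rintro rfl; simp at ht
  obtain ⟨v, t, ht0, hv0, hv⟩ := hp.1.exists_eigenvector_of_ne_zero hne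
  have hv' : ψ *ᵥ v = v := by
    have h1 : ψ *ᵥ (ψ *ᵥ v) = ψ *ᵥ v := by rw [mulVec_mulVec, hi]
    rw [hv, mulVec_smul, hv] at h1
    have h2 : t • v = v := smul_right_injective _ ht0 h1
    rw [hv, h2]
  obtain ⟨s, hs0, hs⟩ : ∃ s : ℝ, 0 < s ∧ star v ⬝ᵥ v = ((s : ℝ) : ℂ) := by
    have : 0 < star v ⬝ᵥ v := dotProduct_star_self_pos_iff.2 hv0
    obtain ⟨h1, h2⟩ := Complex.pos_iff.1 this
    exact ⟨_, h1, Complex.ext rfl (by simp [← h2])⟩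
  set u : n → ℂ := (((Real.sqrt s)⁻¹ : ℝ) : ℂ) • v with hu
  have hu1 : star u ⬝ᵥ u = 1 := by
    rw [hu, star_smul, smul_dotProduct, dotProduct_smul, hs]
    simp only [smul_eq_mul, RCLike.star_def, Complex.conj_ofReal]
    norm_cast
    have := Real.mul_self_sqrt hs0.le
    have h3 := Real.sqrt_pos.2 hs0
    field_simp
    nlinarith
  have hu' : ψ *ᵥ u = u := by rw [hu, mulVec_smul, hv']
  have hu2 : star u ᵥ* ψ = star u := by
    have := congrArg star hu'
    rwa [star_mulVec, hp.1.eq] at this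
  refine ⟨u, ?_, hu1⟩
  set P := vecMulVec u (star u) with hP
  have hPh : Pᴴ = P := by rw [hP, conjTranspose_vecMulVec, star_star]
  have h1 : ψ * P = P := by rw [hP, mul_vecMulVec, hu']
  have h2 : P * ψ = P := by rw [hP, vecMulVec_mul, hu2]
  have h3 : P * P = P := by
    rw [hP, vecMulVec_mul_vecMulVec, hu1, one_smul]
  have h4 : (ψ - P) * (ψ - P)ᴴ = ψ - P := by
    rw [conjTranspose_sub, hPh, hp.1.eq, sub_mul, mul_sub, mul_sub, hi, h1, h2, h3]; abel
  have h5 : ((ψ - P) * (ψ - P)ᴴ).trace = 0 := by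
    rw [h4, trace_sub, ht, hP, trace_vecMulVec, dotProduct_comm, hu1, sub_self]
  exact sub_eq_zero.1 (trace_mul_conjTranspose_self_eq_zero_iff.1 h5)

lemma pure_of_vec {n : Type*} [Fintype n] [DecidableEq n] (v : n → ℂ) (h : star v ⬝ᵥ v = 1) :
    IsPure (vecMulVec v (star v)) := by
  refine ⟨⟨posSemidef_vecMulVec_self_star _, ?_⟩, ?_⟩
  · rw [trace_vecMulVec, dotProduct_comm, h]
  · rw [vecMulVec_mul_vecMulVec, h, one_smul]

/-- A polar-type decomposition. -/
lemma polar {A B : Type*} [Fintype A] [DecidableEq A] [Fintype B] (Y : Matrix A B ℂ) :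
    ∃ (X : Matrix A A ℂ) (W : Matrix A B ℂ) (d : A → ℝ), (∀ a, d a ≤ 1) ∧
      Xᴴ * W = Y ∧ W * Wᴴ = diagonal (fun a => (d a : ℂ)) ∧
      (X * Xᴴ).trace = (Y * Yᴴ).trace := by
  have hp := posSemidef_self_mul_conjTranspose Y
  set l := hp.1.eigenvalues with hl
  have hl0 : ∀ a, 0 ≤ l a := hp.eigenvalues_nonneg
  set U : Matrix A A ℂ := (hp.1.eigenvectorUnitary : Matrix A A ℂ) with hU
  have hUU : U * Uᴴ = 1 := Unitary.mul_star_self_of_mem hp.1.eigenvectorUnitary.2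
  have hUU' : Uᴴ * U = 1 := Unitary.star_mul_self_of_mem hp.1.eigenvectorUnitary.2
  have hsp : Y * Yᴴ = U * diagonal (fun a => (l a : ℂ)) * Uᴴ := hp.1.spectral_theorem
  set Z := Uᴴ * Y with hZ
  have hZZ : Z * Zᴴ = diagonal (fun a => (l a : ℂ)) := by
    calc Z * Zᴴ = Uᴴ * (Y * Yᴴ) * U := by
          rw [hZ, conjTranspose_mul, conjTranspose_conjTranspose]; simp only [Matrix.mul_assoc]
      _ = (Uᴴ * U) * diagonal (fun a => (l a : ℂ)) * (Uᴴ * U) := by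
          rw [hsp]; simp only [Matrix.mul_assoc]
      _ = _ := by rw [hUU']; simp
  have hrow : ∀ a, l a = 0 → ∀ b, Z a b = 0 := by
    intro a ha b
    have h1 := congrFun (congrFun hZZ a) a
    rw [diagonal_apply_eq, ha] at h1
    have h2 : (Z a) ⬝ᵥ star (Z a) = 0 := by simpa [Matrix.mul_apply, dotProduct] using h1
    exact congrFun (dotProduct_star_self_eq_zero.1 ((dotProduct_comm _ _).trans h2)) b
  set D : Matrix A A ℂ := diagonal (fun a => ((Real.sqrt (l a) : ℝ) : ℂ)) with hD
  set E : Matrix A A ℂ := diagonal (fun a => (((Real.sqrt (l a))⁻¹ : ℝ) : ℂ)) with hE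
  have hDh : Dᴴ = D := by rw [hD, diagonal_conjTranspose]; congr 1; ext a; simp
  have hEh : Eᴴ = E := by rw [hE, diagonal_conjTranspose]; congr 1; ext a; simp
  refine ⟨D * Uᴴ, E * Z, fun a => (Real.sqrt (l a))⁻¹ * l a * (Real.sqrt (l a))⁻¹, ?_, ?_, ?_, ?_⟩
  · intro a
    rcases (hl0 a).eq_or_lt with h | h
    · simp [← h]
    · have h1 := Real.mul_self_sqrt h.le
      have h3 := Real.sqrt_pos.2 h
      field_simp
      nlinarith
  · have hDE : D * (E * Z) = Z := by
      ext a b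
      rw [hD, hE, diagonal_mul, diagonal_mul]
      rcases (hl0 a).eq_or_lt with h | h
      · rw [hrow a h.symm b]; simp
      · have h3 := (Real.sqrt_pos.2 h).ne'
        rw [← mul_assoc, ← Complex.ofReal_mul, mul_inv_cancel₀ h3]; simp
    rw [conjTranspose_mul, conjTranspose_conjTranspose, hDh, Matrix.mul_assoc, hDE, hZ,
      ← Matrix.mul_assoc, hUU, Matrix.one_mul]
  · rw [conjTranspose_mul, hEh]
    calc E * Z * (Zᴴ * E) = E * (Z * Zᴴ) * E := by simp only [Matrix.mul_assoc]
      _ = _ := by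
        rw [hZZ, hE, diagonal_mul_diagonal, diagonal_mul_diagonal]; congr 1; ext a; push_cast; rfl
  · rw [conjTranspose_mul, conjTranspose_conjTranspose, hDh, hsp]
    have h1 : D * Uᴴ * (U * D) = D * (Uᴴ * U) * D := by simp only [Matrix.mul_assoc]
    have h2 : D * D = diagonal (fun a => (l a : ℂ)) := by
      rw [hD, diagonal_mul_diagonal]; congr 1; ext a
      rw [← Complex.ofReal_mul, Real.mul_self_sqrt (hl0 a)]
    rw [h1, hUU', Matrix.mul_one, h2, trace_mul_comm (U * _) Uᴴ, ← Matrix.mul_assoc, hUU',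
      Matrix.one_mul]

/-- The min-entropy of a channel equals minus the log of the operator
norm of its unnormalized Choi operator:
inf over pure ψ_{RA} of H_min(B|R)_{N(ψ)} = −log₂‖N(Γ_{RA})‖_∞. -/
theorem chMinEntropy_eq_neg_log_opNorm_choi
    {A B ι : Type*} [Fintype A] [DecidableEq A] [Nonempty A]
    [Fintype B] [DecidableEq B] [Fintype ι]
    (K : ι → Matrix B A ℂ) (hK : ∑ i, (K i)ᴴ * K i = 1) :
    (⨅ ψ : {ψ : Matrix (A × A) (A × A) ℂ // IsPure ψ},
        condHmin (ext (krausMap K) ψ.1)) =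
      ((-Real.logb 2 (opNorm (ext (krausMap K) (gammaOp A))) : ℝ) : EReal) := by
  set J := ext (krausMap K) (gammaOp A) with hJdef
  have hJ : J.PosSemidef := choi_psd K
  have htr : J.trace = Fintype.card A := choi_trace K hK
  have hne : Nonempty (A × B) := by
    by_contra hcon
    rw [not_nonempty_iff] at hcon
    have h0 : J.trace = 0 := by simp [Matrix.trace]
    rw [htr] at h0
    exact Fintype.card_ne_zero (Nat.cast_eq_zero.1 h0)
  obtain ⟨hle, φ, hφ1, hφ⟩ := psd_opNorm hJ
  set c := opNorm J with hc
  have hc0 : 0 < c := by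
    have hcn : 0 ≤ c := norm_nonneg _
    rcases hcn.eq_or_lt with h | h
    · exfalso
      have h1 := hle.trace_nonneg
      rw [← h, Complex.ofReal_zero, zero_smul, zero_sub, trace_neg, htr] at h1
      have h2 : (0 : ℝ) ≤ -(Fintype.card A : ℝ) := by exact_mod_cast h1
      have h3 : (0 : ℝ) < Fintype.card A := by exact_mod_cast Fintype.card_pos
      linarith
    · exact h
  have h2c : (2 : ℝ) ^ Real.logb 2 c = c := Real.rpow_logb (by norm_num) (by norm_num) hc0
  apply le_antisymm
  · -- the optimal input
    set Y : Matrix A B ℂ := Matrix.of fun a b => φ (a, b) with hY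
    have hYφ : vecOf Y = φ := rfl
    obtain ⟨X, W, d, hd, hXW, hWW, hXX⟩ := polar Y
    have hX1 : star (vecOf X) ⬝ᵥ vecOf X = 1 := by
      rw [vec_norm, hXX, ← vec_norm, hYφ, hφ1]
    refine (iInf_le _ ⟨_, pure_of_vec (vecOf X) hX1⟩).trans ?_
    unfold condHmin
    rw [EReal.coe_neg, EReal.neg_le_neg_iff]
    refine le_iInf fun σ => ?_
    obtain ⟨σ, hσ, hσt⟩ := σ
    refine le_sInf ?_
    rintro _ ⟨l, hl, rfl⟩
    rw [EReal.coe_le_coe_iff]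
    simp only [Set.mem_ofPred_eq] at hl
    rw [ext_vec, ← hJdef] at hl
    have h1 := hl.dotProduct_mulVec_nonneg (vecOf W)
    rw [sub_mulVec, dotProduct_sub, smul_mulVec, dotProduct_smul, kron_mulVec_s10] at h1
    have h2 : star (vecOf W) ⬝ᵥ ((X ⊗ₖ (1 : Matrix B B ℂ)) * J * (X ⊗ₖ (1 : Matrix B B ℂ))ᴴ) *ᵥ
        vecOf W = (c : ℂ) := by
      have h3 : (X ⊗ₖ (1 : Matrix B B ℂ))ᴴ *ᵥ vecOf W = φ := by
        rw [conjTranspose_kronecker, conjTranspose_one, kron_mulVec_s10, hXW, hYφ]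
      rw [← mulVec_mulVec, h3, ← mulVec_mulVec, hφ, dotProduct_mulVec]
      have h4 : star (vecOf W) ᵥ* (X ⊗ₖ (1 : Matrix B B ℂ)) = star φ := by
        rw [← h3, star_mulVec, conjTranspose_conjTranspose]
      rw [h4, dotProduct_smul, hφ1]; simp
    have h5 : star (vecOf W) ⬝ᵥ vecOf (σ * W) = ∑ a, σ a a * (d a : ℂ) := by
      have : star (vecOf W) ⬝ᵥ vecOf (σ * W) = (σ * (W * Wᴴ)).trace := by
        rw [← Matrix.mul_assoc]
        simp [Matrix.trace, Matrix.mul_apply (M := σ * W), dotProduct, vecOf,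
          Fintype.sum_prod_type, mul_comm]
      rw [this, hWW]
      simp [Matrix.trace, mul_diagonal]
    have h6 : star (vecOf W) ⬝ᵥ vecOf (σ * W) ≤ 1 := by
      rw [h5, ← hσt]
      refine Finset.sum_le_sum fun a _ => ?_
      have h7 : ((d a : ℝ) : ℂ) ≤ 1 := by exact_mod_cast hd a
      simpa using mul_le_mul_of_nonneg_left h7 (hσ.diag_nonneg (i := a))
    rw [h2, sub_nonneg, smul_eq_mul] at h1
    have h8 : (0 : ℂ) ≤ (((2 : ℝ) ^ l : ℝ) : ℂ) := by
      exact_mod_cast (Real.rpow_pos_of_pos (by norm_num : (0 : ℝ) < 2) l).le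
    have h9 := h1.trans (mul_le_mul_of_nonneg_left h6 h8)
    rw [mul_one] at h9
    have h10 : c ≤ (2 : ℝ) ^ l := by exact_mod_cast h9
    exact (Real.logb_le_iff_le_rpow (by norm_num) hc0).2 h10
  · -- every input
    refine le_iInf fun ψ => ?_
    obtain ⟨ψ, hψ⟩ := ψ
    obtain ⟨v, rfl, hv⟩ := pure_rank_one hψ
    obtain ⟨X, rfl⟩ : ∃ X : Matrix A A ℂ, vecOf X = v := ⟨Matrix.of fun a b => v (a, b), rfl⟩
    unfold condHmin
    rw [EReal.coe_neg, EReal.neg_le_neg_iff]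
    have hσ : IsDensity (X * Xᴴ) :=
      ⟨posSemidef_self_mul_conjTranspose X, by rw [← vec_norm, hv]⟩
    refine (iInf_le _ ⟨_, hσ⟩).trans (sInf_le ⟨_, ?_, rfl⟩)
    simp only [Set.mem_ofPred_eq]
    rw [h2c, ext_vec, ← hJdef]
    have h1 := hle.mul_mul_conjTranspose_same (X ⊗ₖ (1 : Matrix B B ℂ))
    have h2 : (X ⊗ₖ (1 : Matrix B B ℂ)) * (X ⊗ₖ (1 : Matrix B B ℂ))ᴴ =
        (X * Xᴴ) ⊗ₖ (1 : Matrix B B ℂ) := by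
      rw [conjTranspose_kronecker, conjTranspose_one, ← mul_kronecker_mul, Matrix.one_mul]
    rwa [mul_sub, sub_mul, Matrix.mul_smul, Matrix.smul_mul, Matrix.mul_one, h2] at h1

end QCh
end

section
/- For the d-dimensional quantum erasure channel E^p(ρ) = (1−p)ρ + p|e⟩⟨e| (with |e⟩ orthogonal to the input space), the channel entropy is H(E^p) = h₂(p) + (p−1)log₂ d, where h₂ is the binary entropy. -/
open Matrix BigOperators
open scoped Kronecker ComplexOrder

namespace QCh

variable {n m : Type*} [Fintype n] [DecidableEq n] [Fintype m] [DecidableEq m]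

/-- The d-dimensional quantum erasure channel with erasure probability p:
E^p(ρ) = (1−p)ρ + p Tr(ρ) |e⟩⟨e|, with the erasure flag |e⟩ orthogonal to the input. -/
noncomputable def erasureCh (d : ℕ) (p : ℝ) (ρ : Matrix (Fin d) (Fin d) ℂ) :
    Matrix (Fin d ⊕ Unit) (Fin d ⊕ Unit) ℂ :=
  ((1 - p : ℝ) : ℂ) • Matrix.fromBlocks ρ 0 0 0 +
    ((p : ℝ) : ℂ) • Matrix.fromBlocks 0 0 0 (ρ.trace • (1 : Matrix Unit Unit ℂ))

/-- The entropy function on complex roots. -/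
noncomputable def rootEnt (z : ℂ) : ℝ := z.re * Real.logb 2 z.re

lemma roots_prod_real {ι : Type*} [Fintype ι] (l : ι → ℂ) :
    (∏ i, (Polynomial.X - Polynomial.C (l i))).roots = Multiset.map l Finset.univ.val := by
  rw [Polynomial.roots_prod _ _ (by
      simp [Finset.prod_ne_zero_iff, Polynomial.X_sub_C_ne_zero])]
  simp

lemma vnEntropy_eq_roots {k : Type*} [Fintype k] [DecidableEq k] (A : Matrix k k ℂ)
    (h : A.IsHermitian) :
    vnEntropy A = -(A.charpoly.roots.map rootEnt).sum := by
  rw [vnEntropy, dif_pos h, h.roots_charpoly_eq_eigenvalues, Multiset.map_map]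
  simp [rootEnt]

lemma charpoly_smul_herm {k : Type*} [Fintype k] [DecidableEq k] (A : Matrix k k ℂ)
    (h : A.IsHermitian) (c : ℝ) :
    ((c : ℂ) • A).charpoly =
      ∏ i, (Polynomial.X - Polynomial.C (((c * h.eigenvalues i : ℝ)) : ℂ)) := by
  have h1 : ((c : ℂ) • A) = (h.eigenvectorUnitary : Matrix k k ℂ) *
      Matrix.diagonal (fun i => ((c * h.eigenvalues i : ℝ) : ℂ)) *
      (star h.eigenvectorUnitary : Matrix k k ℂ) := by
    have h2 : Matrix.diagonal (fun i => ((c * h.eigenvalues i : ℝ) : ℂ)) =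
        (c : ℂ) • Matrix.diagonal (RCLike.ofReal ∘ h.eigenvalues) := by
      ext i j
      by_cases hij : i = j <;> simp [Matrix.diagonal, hij]
    conv_lhs => rw [h.spectral_theorem]
    rw [h2]
    simp [Unitary.conjStarAlgAut_apply]
  rw [h1, Matrix.charpoly_mul_comm, ← mul_assoc]
  simp [Matrix.charpoly_diagonal]

lemma isHermitian_real_smul {k : Type*} (A : Matrix k k ℂ) (h : A.IsHermitian) (c : ℝ) :
    ((c : ℂ) • A).IsHermitian := by
  ext i j
  have := congrFun (congrFun h i) j
  simp only [Matrix.conjTranspose_apply] at this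
  simp [this]

lemma sum_eig {k : Type*} [Fintype k] [DecidableEq k] (A : Matrix k k ℂ)
    (h : A.IsHermitian) (ht : A.trace = 1) : ∑ i, h.eigenvalues i = 1 := by
  have := h.trace_eq_sum_eigenvalues
  rw [ht] at this
  apply Complex.ofReal_injective
  rw [Complex.ofReal_sum, Complex.ofReal_one]
  exact this.symm

lemma vnEntropy_smul {k : Type*} [Fintype k] [DecidableEq k] (A : Matrix k k ℂ)
    (h : A.IsHermitian) (ht : A.trace = 1) (c : ℝ) :
    vnEntropy ((c : ℂ) • A) = - (c * Real.logb 2 c) + c * vnEntropy A := by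
  rw [vnEntropy_eq_roots _ (isHermitian_real_smul A h c), charpoly_smul_herm A h c,
    roots_prod_real, Multiset.map_map, vnEntropy, dif_pos h]
  have key : ∀ i, rootEnt ((c * h.eigenvalues i : ℝ) : ℂ) =
      c * Real.logb 2 c * h.eigenvalues i +
        c * (h.eigenvalues i * Real.logb 2 (h.eigenvalues i)) := by
    intro i
    simp only [rootEnt, Complex.ofReal_re]
    by_cases hc : c = 0
    · simp [hc]
    by_cases hl : h.eigenvalues i = 0
    · simp [hl]
    rw [Real.logb_mul hc hl]; ring
  have : (Multiset.map (rootEnt ∘ fun i => ((c * h.eigenvalues i : ℝ) : ℂ))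
      Finset.univ.val).sum = ∑ i, rootEnt ((c * h.eigenvalues i : ℝ) : ℂ) := rfl
  rw [this, Finset.sum_congr rfl (fun i _ => key i), Finset.sum_add_distrib, ← Finset.mul_sum,
    ← Finset.mul_sum, sum_eig A h ht]
  ring

lemma vnEntropy_pure {k : Type*} [Fintype k] [DecidableEq k] (A : Matrix k k ℂ)
    (h : IsPure A) : vnEntropy A = 0 := by
  have hh := h.1.1.1
  rw [vnEntropy, dif_pos hh, neg_eq_zero]
  refine Finset.sum_eq_zero fun i _ => ?_
  have h1 := hh.eigenvalues_mem_spectrum_real i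
  have h2 := IsIdempotentElem.spectrum_subset ℝ (show IsIdempotentElem A from h.2) h1
  rcases h2 with h2 | h2
  · simp [h2]
  · simp [Set.mem_singleton_iff.1 h2]

lemma vnEntropy_le {k : Type*} [Fintype k] [DecidableEq k] (A : Matrix k k ℂ)
    (h : IsDensity A) : vnEntropy A ≤ Real.logb 2 (Fintype.card k) := by
  have hh := h.1.1
  have hs := sum_eig A hh h.2
  have hk : 0 < (Fintype.card k : ℝ) := by
    have : Nonempty k := by
      by_contra hne
      rw [not_nonempty_iff] at hne
      simp at hs
    exact_mod_cast Fintype.card_pos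
  set N : ℝ := (Fintype.card k : ℝ) with hN
  rw [vnEntropy, dif_pos hh]
  have l2 : 0 < Real.log 2 := Real.log_pos (by norm_num)
  have key : ∀ i, -(hh.eigenvalues i * Real.log (hh.eigenvalues i)) ≤
      hh.eigenvalues i * Real.log N + (1 / N - hh.eigenvalues i) := by
    intro i
    have h0 := h.1.eigenvalues_nonneg i
    rcases h0.eq_or_lt with h0 | h0
    · rw [← h0]; simp; exact hk.le
    · have := Real.log_le_sub_one_of_pos (x := 1 / (N * hh.eigenvalues i)) (by positivity)
      rw [one_div, Real.log_inv, Real.log_mul hk.ne' h0.ne'] at this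
      have h3 := mul_le_mul_of_nonneg_left this h0.le
      have h4 : hh.eigenvalues i * ((N * hh.eigenvalues i)⁻¹ - 1) =
        1 / N - hh.eigenvalues i := by field_simp
      rw [h4] at h3
      linarith
  have h5 := Finset.sum_le_sum (s := Finset.univ) (fun i _ => key i)
  rw [Finset.sum_neg_distrib, Finset.sum_add_distrib, ← Finset.sum_mul, hs,
    Finset.sum_sub_distrib, hs] at h5
  have h6 : ∑ _i : k, 1 / N = 1 := by
    simp [← hN, hk.ne']
  rw [h6] at h5
  have h7 : -∑ i, hh.eigenvalues i * Real.logb 2 (hh.eigenvalues i) =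
      (-∑ i, hh.eigenvalues i * Real.log (hh.eigenvalues i)) / Real.log 2 := by
    rw [neg_div, Finset.sum_div]
    simp [Real.logb, mul_div_assoc]
  rw [h7, Real.logb]
  gcongr
  linarith

lemma ptR_density_s12 {a b : Type*} [Fintype a] [DecidableEq a] [Fintype b] [DecidableEq b]
    (M : Matrix (a × b) (a × b) ℂ) (h : IsDensity M) : IsDensity (ptR M) := by
  constructor
  · have : ptR M = ∑ k, M.submatrix (fun i => (i, k)) (fun i => (i, k)) := by
      ext i j
      simp [ptR, Matrix.sum_apply]
    rw [this]
    exact Matrix.posSemidef_sum _ fun k _ => h.1.submatrix _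
  · rw [← h.2]
    simp [ptR, Matrix.trace, Fintype.sum_prod_type]

/-- Distributing a product over the flag. -/
def flagEquiv (d : ℕ) : (Fin d × Fin d) ⊕ Fin d ≃ Fin d × (Fin d ⊕ Unit) where
  toFun x := match x with
    | Sum.inl (r, a) => (r, Sum.inl a)
    | Sum.inr r => (r, Sum.inr ())
  invFun x := match x with
    | (r, Sum.inl a) => Sum.inl (r, a)
    | (r, Sum.inr _) => Sum.inr r
  left_inv x := by rcases x with ⟨r, a⟩ | r <;> rfl
  right_inv x := by rcases x with ⟨r, a | u⟩ <;> rfl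

lemma ext_erasure (d : ℕ) (p : ℝ) (ψ : Matrix (Fin d × Fin d) (Fin d × Fin d) ℂ) :
    ext (erasureCh d p) ψ = Matrix.reindex (flagEquiv d) (flagEquiv d)
      (Matrix.fromBlocks (((1 - p : ℝ) : ℂ) • ψ) 0 0 ((p : ℂ) • ptR ψ)) := by
  ext ⟨r, a | u⟩ ⟨r', a' | u'⟩ <;>
    simp [ext, erasureCh, flagEquiv, ptR, Matrix.trace]

lemma ptR_ext_erasure (d : ℕ) (p : ℝ) (ψ : Matrix (Fin d × Fin d) (Fin d × Fin d) ℂ) :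
    ptR (ext (erasureCh d p) ψ) = ptR ψ := by
  ext r r'
  simp [ptR, ext, erasureCh, Matrix.trace, ← Finset.mul_sum]
  ring

lemma condEnt_erasure (d : ℕ) (p : ℝ) (ψ : Matrix (Fin d × Fin d) (Fin d × Fin d) ℂ)
    (h : IsPure ψ) : condEntB (ext (erasureCh d p) ψ) =
      (-(p * Real.logb 2 p) - (1 - p) * Real.logb 2 (1 - p)) +
        (p - 1) * vnEntropy (ptR ψ) := by
  have hR := ptR_density_s12 ψ h.1
  have e1 := vnEntropy_smul ψ h.1.1.1 h.1.2 (1 - p)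
  have e2 := vnEntropy_smul (ptR ψ) hR.1.1 hR.2 p
  rw [vnEntropy_pure ψ h] at e1
  have g1 := isHermitian_real_smul ψ h.1.1.1 (1 - p)
  have g2 := isHermitian_real_smul (ptR ψ) hR.1.1 p
  have g3 : (ext (erasureCh d p) ψ).IsHermitian := by
    rw [ext_erasure, Matrix.reindex_apply]
    exact (Matrix.IsHermitian.fromBlocks g1 (by simp) g2).submatrix _
  have e3 : vnEntropy (ext (erasureCh d p) ψ) =
      vnEntropy (((1 - p : ℝ) : ℂ) • ψ) + vnEntropy ((p : ℂ) • ptR ψ) := by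
    rw [vnEntropy_eq_roots _ g3, vnEntropy_eq_roots _ g1, vnEntropy_eq_roots _ g2, ext_erasure,
      Matrix.charpoly_reindex, Matrix.charpoly_fromBlocks_zero₁₂, Polynomial.roots_mul
        (mul_ne_zero (Matrix.charpoly_monic _).ne_zero (Matrix.charpoly_monic _).ne_zero),
      Multiset.map_add, Multiset.sum_add]
    ring
  rw [condEntB, ptR_ext_erasure, e3, e1, e2]
  ring

/-- The maximally entangled vector. -/
noncomputable def maxVec (d : ℕ) : Fin d × Fin d → ℂ :=
  fun x => if x.1 = x.2 then ((1 / Real.sqrt d : ℝ) : ℂ) else 0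

lemma maxVec_norm (d : ℕ) (hd : 0 < d) : star (maxVec d) ⬝ᵥ maxVec d = 1 := by
  have hd' : (0 : ℝ) < d := by exact_mod_cast hd
  have h1 : ((1 / Real.sqrt d : ℝ) : ℂ) * ((1 / Real.sqrt d : ℝ) : ℂ) = 1 / d := by
    rw [← Complex.ofReal_mul, div_mul_div_comm, Real.mul_self_sqrt hd'.le]
    push_cast; ring
  have h2 : ∀ x : Fin d × Fin d, star (maxVec d x) * maxVec d x =
      if x.1 = x.2 then (1 / d : ℂ) else 0 := by
    intro x
    unfold maxVec
    split_ifs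
    · rw [← h1]
      congr 1
      exact Complex.conj_ofReal _
    · simp
  simp only [dotProduct, Pi.star_apply, h2, Fintype.sum_prod_type]
  have : (d : ℂ) ≠ 0 := by exact_mod_cast hd.ne'
  simp [this]

lemma maxVec_ptR (d : ℕ) (hd : 0 < d) :
    ptR (vecMulVec (maxVec d) (star (maxVec d))) = ((1 / d : ℝ) : ℂ) • (1 : Matrix _ _ ℂ) := by
  have hd' : (0 : ℝ) < d := by exact_mod_cast hd
  have h1 : ((1 / Real.sqrt d : ℝ) : ℂ) * ((1 / Real.sqrt d : ℝ) : ℂ) = ((1 / d : ℝ) : ℂ) := by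
    rw [← Complex.ofReal_mul, div_mul_div_comm, Real.mul_self_sqrt hd'.le, one_mul]
  have h3 : star ((1 / Real.sqrt d : ℝ) : ℂ) = ((1 / Real.sqrt d : ℝ) : ℂ) :=
    Complex.conj_ofReal _
  ext i j
  simp only [ptR, Matrix.of_apply, vecMulVec_apply, Pi.star_apply, maxVec, Matrix.smul_apply,
    Matrix.one_apply, smul_eq_mul]
  rw [Finset.sum_eq_single i]
  · by_cases hij : i = j
    · subst hij
      simp only [if_true, h3, h1, mul_one]
    · have : ¬ j = i := fun h => hij h.symm
      simp [hij, this]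
  · intro b _ hb
    have : ¬ i = b := fun h => hb h.symm
    simp [this]
  · simp

lemma maxVec_pure (d : ℕ) (hd : 0 < d) : IsPure (vecMulVec (maxVec d) (star (maxVec d))) := by
  refine ⟨⟨Matrix.posSemidef_vecMulVec_self_star _, ?_⟩, ?_⟩
  · rw [Matrix.trace_vecMulVec, dotProduct_comm, maxVec_norm d hd]
  · rw [Matrix.vecMulVec_mul_vecMulVec, maxVec_norm d hd]
    simp

lemma vnEntropy_mixed (d : ℕ) (hd : 0 < d) :
    vnEntropy (((1 / d : ℝ) : ℂ) • (1 : Matrix (Fin d) (Fin d) ℂ)) = Real.logb 2 d := by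
  have hd' : (d : ℝ) ≠ 0 := by exact_mod_cast hd.ne'
  rw [vnEntropy_eq_roots _ (isHermitian_real_smul _ Matrix.isHermitian_one _),
    Matrix.smul_one_eq_diagonal, Matrix.charpoly_diagonal, roots_prod_real, Multiset.map_map]
  have : (Multiset.map (rootEnt ∘ fun _ : Fin d => ((1 / d : ℝ) : ℂ))
      Finset.univ.val).sum = ∑ _i : Fin d, rootEnt ((1 / d : ℝ) : ℂ) := rfl
  rw [this]
  simp only [rootEnt, Complex.ofReal_re, Finset.sum_const, Finset.card_univ, Fintype.card_fin,
    nsmul_eq_mul, one_div, Real.logb_inv]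
  field_simp

/-- H(E^p) = h₂(p) + (p − 1) log₂ d for the d-dimensional erasure channel. -/
theorem chEnt_erasure (d : ℕ) (hd : 0 < d) (p : ℝ) (hp0 : 0 ≤ p) (hp1 : p ≤ 1) :
    chEnt (erasureCh d p) =
      (-(p * Real.logb 2 p) - (1 - p) * Real.logb 2 (1 - p)) +
        (p - 1) * Real.logb 2 d := by
  apply IsLeast.csInf_eq
  constructor
  · refine ⟨_, maxVec_pure d hd, ?_⟩
    rw [condEnt_erasure d p _ (maxVec_pure d hd), maxVec_ptR d hd, vnEntropy_mixed d hd]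
  · rintro x ⟨ψ, hψ, rfl⟩
    rw [condEnt_erasure d p ψ hψ]
    have := vnEntropy_le _ (ptR_density_s12 ψ hψ.1)
    rw [Fintype.card_fin] at this
    have h2 := mul_le_mul_of_nonneg_left this (sub_nonneg.2 hp1)
    linarith

end QCh
end

section
/- For the d-dimensional dephasing channel D^p(ρ) = Σ_{ℓ=0}^{d−1} p_ℓ Z^ℓ ρ Z^{ℓ†}, where Z|x⟩ = e^{2πix/d}|x⟩, the channel entropy is H(D^p) = H(p) − log₂ d, where H(p) is the Shannon entropy of the distribution (p_ℓ). -/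
open Matrix BigOperators
open scoped Kronecker ComplexOrder

namespace QCh

variable {n m : Type*} [Fintype n] [DecidableEq n] [Fintype m] [DecidableEq m]

/-- The clock operator Z on ℂ^d, Z|x⟩ = e^{2πi x/d}|x⟩. -/
noncomputable def clockZ (d : ℕ) : Matrix (Fin d) (Fin d) ℂ :=
  Matrix.diagonal fun x : Fin d => Complex.exp (2 * Real.pi * Complex.I * (x : ℕ) / d)

/-- The d-dimensional dephasing channel D^p(ρ) = Σ_ℓ p_ℓ Z^ℓ ρ Z^{ℓ†}. -/
noncomputable def dephasingCh (d : ℕ) (p : Fin d → ℝ) (ρ : Matrix (Fin d) (Fin d) ℂ) :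
    Matrix (Fin d) (Fin d) ℂ :=
  ∑ ℓ : Fin d, ((p ℓ : ℝ) : ℂ) • (clockZ d ^ (ℓ : ℕ) * ρ * (clockZ d ^ (ℓ : ℕ))ᴴ)


lemma deriv_nonneg_left (g : ℝ → ℝ) (g' : ℝ) (h : HasDerivAt g g' 1) (h1 : g 1 = 0)
    (hl : ∀ x ∈ Set.Icc (0:ℝ) 1, g x ≤ 0) : 0 ≤ g' := by
  have h2 := (hasDerivWithinAt_iff_tendsto_slope' (s := Set.Iio (1:ℝ)) (by simp)).1
    h.hasDerivWithinAt
  refine ge_of_tendsto h2 ?_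
  have : Set.Ioo (0:ℝ) 1 ∈ nhdsWithin (1:ℝ) (Set.Iio 1) := Ioo_mem_nhdsLT (by norm_num)
  filter_upwards [this] with x hx
  rw [slope_def_field, h1]
  apply div_nonneg_of_nonpos
  · have := hl x ⟨hx.1.le, hx.2.le⟩
    linarith
  · linarith [hx.2]

/-- Derivative form of the three lines theorem for exponential sums. -/
lemma exp_sum_three_lines {ι : Type*} [Fintype ι] (c : ι → ℂ) (t : ι → ℝ) (C : ℝ) (hC : 0 < C)
    (hc : ∑ k, c k = 1)
    (h0 : ∀ z : ℂ, z.re = 0 → ‖∑ k, c k * Complex.exp ((z - 1) * t k)‖ ≤ C)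
    (h1 : ∀ z : ℂ, z.re = 1 → ‖∑ k, c k * Complex.exp ((z - 1) * t k)‖ ≤ 1) :
    -Real.log C ≤ (∑ k, c k * t k).re := by
  set h : ℂ → ℂ := fun z => ∑ k, c k * Complex.exp ((z - 1) * t k) with hh
  have hdiff : Differentiable ℂ h := by
    rw [hh]; fun_prop
  have hB : BddAbove ((norm ∘ h) '' Complex.HadamardThreeLines.verticalClosedStrip 0 1) := by
    refine ⟨∑ k, ‖c k‖ * Real.exp |t k|, ?_⟩
    rintro _ ⟨z, hz, rfl⟩
    simp only [Complex.HadamardThreeLines.verticalClosedStrip, Set.mem_preimage, Set.mem_Icc] at hz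
    refine (norm_sum_le _ _).trans (Finset.sum_le_sum fun k _ => ?_)
    rw [norm_mul, Complex.norm_exp]
    refine mul_le_mul_of_nonneg_left (Real.exp_le_exp.2 ?_) (norm_nonneg _)
    have : ((z - 1) * (t k : ℂ)).re = (z.re - 1) * t k := by simp
    rw [this]
    refine (le_abs_self _).trans ?_
    rw [abs_mul]
    have : |z.re - 1| ≤ 1 := by rw [abs_le]; constructor <;> linarith [hz.1, hz.2]
    nlinarith [abs_nonneg (t k)]
  have key : ∀ x ∈ Set.Icc (0:ℝ) 1, (h x).re - C ^ (1 - x) ≤ 0 := by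
    intro x hx
    have := Complex.HadamardThreeLines.norm_le_interp_of_mem_verticalClosedStrip₀₁' h
      (z := (x:ℂ)) (a := C) (b := 1)
      (by simpa [Complex.HadamardThreeLines.verticalClosedStrip] using hx)
      hdiff.diffContOnCl hB (fun z hz => h0 z hz) (fun z hz => h1 z hz)
    simp only [Complex.ofReal_re, Real.one_rpow, mul_one] at this
    linarith [Complex.re_le_norm (h x)]
  have hd : HasDerivAt h (∑ k, c k * t k) (1:ℂ) := by
    have : ∀ k ∈ Finset.univ, HasDerivAt (fun z : ℂ => c k * Complex.exp ((z - 1) * t k))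
        (c k * t k) (1:ℂ) := by
      intro k _
      have h3 : HasDerivAt (fun z : ℂ => (z - 1) * t k) (1 * (t k : ℂ)) (1:ℂ) :=
        ((hasDerivAt_id (1:ℂ)).sub_const 1).mul_const _
      have := (h3.cexp).const_mul (c k)
      simpa using this
    have h4 := HasDerivAt.fun_sum this
    exact h4
  have hd2 : HasDerivAt (fun x : ℝ => (h x).re) (∑ k, c k * t k).re 1 := by
    apply HasDerivAt.real_of_complex
    simpa using hd
  have hd3 : HasDerivAt (fun x : ℝ => C ^ (1 - x)) (-Real.log C) 1 := by
    have := ((hasDerivAt_id (1:ℝ)).const_sub 1).const_rpow hC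
    simpa using this
  have hone : h 1 = 1 := by simp [hh, hc]
  have := deriv_nonneg_left _ _ (hd2.sub hd3) (by simp [hone]) key
  linarith

lemma vnEntropy_mul {n m : Type*} [Fintype n] [DecidableEq n] [Fintype m] [DecidableEq m]
    (A : Matrix n m ℂ) (B : Matrix m n ℂ) (v : m → ℝ)
    (hAB : (A * B).IsHermitian) (hBA : B * A = Matrix.diagonal fun i => (v i : ℂ)) :
    vnEntropy (A * B) = -∑ i, v i * Real.logb 2 (v i) := by
  have h := Matrix.charpoly_mul_comm' A B
  have h2 := congrArg Polynomial.roots h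
  have hne1 : (A * B).charpoly ≠ 0 := (Matrix.charpoly_monic _).ne_zero
  have hne2 : (B * A).charpoly ≠ 0 := (Matrix.charpoly_monic _).ne_zero
  rw [Polynomial.roots_mul (mul_ne_zero (pow_ne_zero _ Polynomial.X_ne_zero) hne1),
    Polynomial.roots_mul (mul_ne_zero (pow_ne_zero _ Polynomial.X_ne_zero) hne2),
    hAB.roots_charpoly_eq_eigenvalues, hBA, Matrix.charpoly_diagonal, Polynomial.roots_prod _ _ (by
      simp [Finset.prod_ne_zero_iff, Polynomial.X_sub_C_ne_zero])] at h2
  have h3 := congrArg (fun s : Multiset ℂ =>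
    (s.map fun z => z.re * Real.logb 2 z.re).sum) h2
  simp only [Polynomial.roots_X_pow, Polynomial.roots_X_sub_C, Multiset.bind_singleton,
    Multiset.map_add, Multiset.map_nsmul, Multiset.sum_add, Multiset.sum_nsmul,
    Multiset.map_singleton, Multiset.sum_singleton, Multiset.map_map, Complex.zero_re, zero_mul,
    smul_zero, zero_add, Function.comp_def] at h3
  rw [vnEntropy, dif_pos hAB]
  exact congrArg Neg.neg h3

lemma frob_eq {I N : Type*} [Fintype I] [Fintype N] (B : Matrix I N ℂ) :
    ((∑ i, ∑ l, ‖B i l‖ ^ 2 : ℝ) : ℂ) = (Bᴴ * B).trace := by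
  simp only [Matrix.trace, Matrix.diag, Matrix.mul_apply, Matrix.conjTranspose_apply]
  rw [Finset.sum_comm]
  push_cast
  refine Finset.sum_congr rfl fun i _ => Finset.sum_congr rfl fun l _ => ?_
  rw [Complex.star_def, Complex.conj_mul']

lemma frob_unitary {I N M : Type*} [Fintype I] [Fintype N] [Fintype M] [DecidableEq I]
    (U : Matrix I M ℂ) (hU : U * Uᴴ = 1) (B : Matrix I N ℂ) :
    ∑ i, ∑ l, ‖(Uᴴ * B) i l‖ ^ 2 = ∑ i, ∑ l, ‖B i l‖ ^ 2 := by
  have : ((∑ i, ∑ l, ‖(Uᴴ * B) i l‖ ^ 2 : ℝ) : ℂ) = ((∑ i, ∑ l, ‖B i l‖ ^ 2 : ℝ) : ℂ) := by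
    rw [frob_eq, frob_eq, Matrix.conjTranspose_mul, Matrix.conjTranspose_conjTranspose,
      Matrix.mul_assoc, ← Matrix.mul_assoc U, hU, Matrix.one_mul]
  exact_mod_cast this

lemma vec_isom {A L : Type*} [Fintype A] [Fintype L] [DecidableEq L] (F : Matrix A L ℂ) (D : ℝ)
    (hF : Fᴴ * F = (D : ℂ) • (1 : Matrix L L ℂ)) (y : L → ℂ) :
    ∑ a, ‖∑ l, F a l * y l‖ ^ 2 = D * ∑ l, ‖y l‖ ^ 2 := by
  have h := frob_eq (F * Matrix.of fun l (_ : Unit) => y l)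
  rw [Matrix.conjTranspose_mul, Matrix.mul_assoc, ← Matrix.mul_assoc Fᴴ, hF, Matrix.smul_mul,
    Matrix.one_mul, Matrix.mul_smul, Matrix.trace_smul, ← frob_eq, smul_eq_mul] at h
  simp only [Matrix.mul_apply, Matrix.of_apply, Finset.univ_unique, Finset.sum_singleton] at h
  exact_mod_cast h

/-- Rows of a matrix with orthogonal rows, rescaled: Bessel inequality on columns. -/
lemma bessel_col {J A : Type*} [Fintype J] [DecidableEq J] [Fintype A] (V : Matrix J A ℂ)
    (e : J → ℂ) (he : ∀ j, e j = 1 ∨ V j = 0) (hV : V * Vᴴ = Matrix.diagonal e) (a : A) :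
    ∑ j, ‖V j a‖ ^ 2 ≤ 1 := by
  have h1 : Vᴴ * V * (Vᴴ * V) = Vᴴ * V := by
    rw [Matrix.mul_assoc, ← Matrix.mul_assoc V, hV]
    congr 1
    ext j b
    rw [Matrix.diagonal_mul]
    rcases he j with h | h
    · rw [h, one_mul]
    · rw [h]; simp
  have h2 : (Vᴴ * V) a a = ((∑ j, ‖V j a‖ ^ 2 : ℝ) : ℂ) := by
    simp only [Matrix.mul_apply, Matrix.conjTranspose_apply]
    push_cast
    refine Finset.sum_congr rfl fun i _ => ?_
    rw [Complex.star_def, Complex.conj_mul']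
  have hH : (Vᴴ * V)ᴴ = Vᴴ * V := by simp
  have h3 : (Vᴴ * V) a a = ((∑ b, ‖(Vᴴ * V) b a‖ ^ 2 : ℝ) : ℂ) := by
    conv_lhs => rw [← h1, Matrix.mul_apply]
    push_cast
    refine Finset.sum_congr rfl fun i _ => ?_
    have : (Vᴴ * V) a i = star ((Vᴴ * V) i a) := by
      rw [← Matrix.conjTranspose_apply, hH]
    rw [this, Complex.star_def, Complex.conj_mul']
  set s := ∑ j, ‖V j a‖ ^ 2 with hs
  have h4 : s = ∑ b, ‖(Vᴴ * V) b a‖ ^ 2 := by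
    rw [h2] at h3; exact_mod_cast h3
  have h5 : ‖(Vᴴ * V) a a‖ ^ 2 ≤ ∑ b, ‖(Vᴴ * V) b a‖ ^ 2 :=
    Finset.single_le_sum (f := fun b => ‖(Vᴴ * V) b a‖ ^ 2) (fun _ _ => by positivity)
      (Finset.mem_univ a)
  rw [h2, ← h4, Complex.norm_real, Real.norm_eq_abs, sq_abs] at h5
  nlinarith

lemma norm_exp_half_log (w : ℂ) (r : ℝ) (hr : 0 < r) (hw : w.re = 1/2) :
    ‖Complex.exp (w * Real.log r)‖ ^ 2 = r := by
  rw [Complex.norm_exp]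
  have : (w * (Real.log r : ℂ)).re = 1/2 * Real.log r := by simp [hw]
  rw [this, ← Real.exp_nat_mul]
  push_cast
  rw [show 2 * (1/2 * Real.log r) = Real.log r by ring, Real.exp_log hr]

lemma norm_exp_neg_half_log (w : ℂ) (r : ℝ) (hr : 0 < r) (hw : w.re = -(1/2)) :
    ‖Complex.exp (w * Real.log r)‖ ^ 2 = r⁻¹ := by
  rw [Complex.norm_exp]
  have : (w * (Real.log r : ℂ)).re = -(1/2) * Real.log r := by simp [hw]
  rw [this, ← Real.exp_nat_mul]
  push_cast
  rw [show 2 * (-(1/2) * Real.log r) = -Real.log r by ring, Real.exp_neg, Real.exp_log hr]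

lemma norm_exp_im (w : ℂ) (r : ℝ) (hw : w.re = 0) : ‖Complex.exp (w * r)‖ = 1 := by
  rw [Complex.norm_exp]; simp [hw]


lemma sum_amgm {ι : Type*} [Fintype ι] (x y : ι → ℂ) (t : ℝ) (ht : 0 < t) :
    ‖∑ i, x i * y i‖ ≤ (t * ∑ i, ‖x i‖ ^ 2 + t⁻¹ * ∑ i, ‖y i‖ ^ 2) / 2 := by
  refine (norm_sum_le _ _).trans ?_
  rw [Finset.mul_sum, Finset.mul_sum, ← Finset.sum_add_distrib, Finset.sum_div]
  refine Finset.sum_le_sum fun i _ => ?_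
  rw [norm_mul]
  have h1 : t * t⁻¹ = 1 := mul_inv_cancel₀ ht.ne'
  have h2 : 0 ≤ t⁻¹ * (t * ‖x i‖ - ‖y i‖) ^ 2 := by positivity
  have h3 : t⁻¹ * (t * ‖x i‖ - ‖y i‖) ^ 2
      = (t * t⁻¹) * (t * ‖x i‖ ^ 2) - 2 * (t * t⁻¹) * (‖x i‖ * ‖y i‖) + t⁻¹ * ‖y i‖ ^ 2 := by ring
  rw [h3, h1] at h2
  linarith

theorem core {I J A L : Type*} [Fintype I] [DecidableEq I] [Fintype J] [DecidableEq J]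
    [Fintype A] [DecidableEq A] [Fintype L] [DecidableEq L]
    (U : Matrix (J × A) I ℂ) (hU1 : Uᴴ * U = 1) (hU2 : U * Uᴴ = 1)
    (lam : I → ℝ) (mu : J → ℝ) (p : L → ℝ) (hp0 : ∀ l, 0 ≤ p l) (hp1 : ∑ l, p l = 1)
    (Φ : Matrix J A ℂ) (hΦ : Φ * Φᴴ = Matrix.diagonal fun j => (mu j : ℂ)) (hmu : ∑ j, mu j = 1)
    (F : Matrix A L ℂ) (hFn : ∀ a l, ‖F a l‖ = 1) (D : ℝ) (hD : 0 < D)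
    (hF : Fᴴ * F = (D : ℂ) • (1 : Matrix L L ℂ))
    (K : Matrix (J × A) L ℂ)
    (hK : ∀ k l, K k l = Φ k.1 k.2 * F k.2 l * ((√(p l) : ℝ) : ℂ))
    (hX : (Uᴴ * K) * (Uᴴ * K)ᴴ = Matrix.diagonal fun i => (lam i : ℂ)) :
    ∑ i, lam i * Real.log (lam i) ≤
      ∑ j, mu j * Real.log (mu j) + ∑ l, p l * Real.log (p l) + Real.log D := by
  set X := Uᴴ * K with hXdef
  have hlam : ∀ i, lam i = ∑ l, ‖X i l‖ ^ 2 := by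
    intro i
    have h := congrFun (congrFun hX i) i
    rw [Matrix.diagonal_apply_eq, Matrix.mul_apply] at h
    have h2 : ((∑ l, ‖X i l‖ ^ 2 : ℝ) : ℂ) = lam i := by
      rw [← h]; push_cast
      refine Finset.sum_congr rfl fun l _ => ?_
      rw [Matrix.conjTranspose_apply, Complex.star_def, Complex.mul_conj']
    exact_mod_cast h2.symm
  have hmuj : ∀ i, mu i = ∑ l, ‖Φ i l‖ ^ 2 := by
    intro i
    have h := congrFun (congrFun hΦ i) i
    rw [Matrix.diagonal_apply_eq, Matrix.mul_apply] at h
    have h2 : ((∑ l, ‖Φ i l‖ ^ 2 : ℝ) : ℂ) = mu i := by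
      rw [← h]; push_cast
      refine Finset.sum_congr rfl fun l _ => ?_
      rw [Matrix.conjTranspose_apply, Complex.star_def, Complex.mul_conj']
    exact_mod_cast h2.symm
  have hlam0 : ∀ i, 0 ≤ lam i := fun i => by rw [hlam]; positivity
  have hmu0 : ∀ i, 0 ≤ mu i := fun i => by rw [hmuj]; positivity
  have hXz : ∀ i, lam i = 0 → ∀ l, X i l = 0 := by
    intro i hi l
    rw [hlam, Finset.sum_eq_zero_iff_of_nonneg (fun _ _ => by positivity)] at hi
    simpa using hi l (Finset.mem_univ l)
  have hΦz : ∀ i, mu i = 0 → ∀ l, Φ i l = 0 := by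
    intro i hi l
    rw [hmuj, Finset.sum_eq_zero_iff_of_nonneg (fun _ _ => by positivity)] at hi
    simpa using hi l (Finset.mem_univ l)
  have hKn : ∀ k l, ‖K k l‖ ^ 2 = ‖Φ k.1 k.2‖ ^ 2 * p l := by
    intro k l
    rw [hK, norm_mul, norm_mul, hFn, mul_one, mul_pow, Complex.norm_real, Real.norm_eq_abs, sq_abs,
      Real.sq_sqrt (hp0 l)]
  have hUX : U * X = K := by rw [hXdef, ← Matrix.mul_assoc, hU2, Matrix.one_mul]
  have hKtot : ∑ k, ∑ l, ‖K k l‖ ^ 2 = 1 := by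
    simp only [hKn, ← Finset.mul_sum, hp1, mul_one]
    rw [Fintype.sum_prod_type]
    simp only [← hmuj, hmu]
  have hXtot : ∑ k, ∑ l, ‖X k l‖ ^ 2 = 1 := by
    rw [hXdef, frob_unitary U hU2, hKtot]
  have hlamtot : ∑ i, lam i = 1 := by simp only [hlam, hXtot]
  let c : I × (J × A) × L → ℂ := fun x => star (U x.2.1 x.1) * K x.2.1 x.2.2 * star (X x.1 x.2.2)
  let t : I × (J × A) × L → ℝ := fun x =>
    (1/2) * (-Real.log (lam x.1) + Real.log (mu x.2.1.1) + Real.log (p x.2.2))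
  have S1 : ∀ w : I → ℂ, ∑ x, w x.1 * c x = ∑ i, w i * lam i := by
    intro w
    rw [Fintype.sum_prod_type]
    refine Finset.sum_congr rfl fun i _ => ?_
    dsimp only
    rw [← Finset.mul_sum, Fintype.sum_prod_type, Finset.sum_comm, hlam]
    push_cast
    congr 1
    refine Finset.sum_congr rfl fun l _ => ?_
    simp only [c]
    rw [← Finset.sum_mul, ← Complex.mul_conj', hXdef, Matrix.mul_apply]
    simp only [Matrix.conjTranspose_apply, Complex.star_def]
  have S2 : ∀ w : J × A → L → ℂ, ∑ x, w x.2.1 x.2.2 * c x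
      = ∑ k, ∑ l, w k l * ((‖K k l‖ ^ 2 : ℝ) : ℂ) := by
    intro w
    rw [Fintype.sum_prod_type, Finset.sum_comm, Fintype.sum_prod_type]
    refine Finset.sum_congr rfl fun k _ => Finset.sum_congr rfl fun l _ => ?_
    dsimp only
    rw [← Finset.mul_sum]
    congr 1
    simp only [c]
    have : star (K k l) = ∑ i, star (U k i) * star (X i l) := by
      rw [← hUX, Matrix.mul_apply, star_sum]
      refine Finset.sum_congr rfl fun i _ => ?_
      rw [star_mul, mul_comm]
    push_cast
    rw [← Complex.mul_conj', ← Complex.star_def, this, Finset.mul_sum]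
    refine Finset.sum_congr rfl fun i _ => ?_
    ring
  have hc : ∑ x, c x = 1 := by
    have := S2 (fun _ _ => 1)
    simp only [one_mul] at this
    rw [this]
    exact_mod_cast hKtot
  have hsplit : ∀ z : ℂ, ∑ x, c x * Complex.exp ((z - 1) * t x) =
      ∑ i, ∑ k : J × A, ∑ l, (star (U k i) * K k l * star (X i l)) *
        (Complex.exp ((1 - z) / 2 * Real.log (lam i)) *
        Complex.exp ((z - 1) / 2 * Real.log (mu k.1)) *
        Complex.exp ((z - 1) / 2 * Real.log (p l))) := by
    intro z
    rw [Fintype.sum_prod_type]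
    refine Finset.sum_congr rfl fun i _ => ?_
    rw [Fintype.sum_prod_type]
    refine Finset.sum_congr rfl fun k _ => Finset.sum_congr rfl fun l _ => ?_
    simp only [c, t]
    rw [← Complex.exp_add, ← Complex.exp_add]
    congr 2
    push_cast
    ring
  have h1 : ∀ z : ℂ, z.re = 1 → ‖∑ x, c x * Complex.exp ((z - 1) * t x)‖ ≤ 1 := by
    intro z hz
    rw [hsplit]
    set B : Matrix (J × A) L ℂ := Matrix.of fun k l =>
      Complex.exp ((z - 1) / 2 * Real.log (mu k.1)) * K k l with hB
    have hr1 : ((1 - z) / 2).re = 0 := by simp [hz]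
    have hr2 : ((z - 1) / 2).re = 0 := by simp [hz]
    have e1 : ∑ i, ∑ k : J × A, ∑ l, (star (U k i) * K k l * star (X i l)) *
        (Complex.exp ((1 - z) / 2 * Real.log (lam i)) *
        Complex.exp ((z - 1) / 2 * Real.log (mu k.1)) *
        Complex.exp ((z - 1) / 2 * Real.log (p l))) =
        ∑ x : I × L, (Complex.exp ((1 - z) / 2 * Real.log (lam x.1)) *
          Complex.exp ((z - 1) / 2 * Real.log (p x.2)) * star (X x.1 x.2)) * (Uᴴ * B) x.1 x.2 := by
      rw [Fintype.sum_prod_type]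
      refine Finset.sum_congr rfl fun i _ => ?_
      rw [Finset.sum_comm]
      refine Finset.sum_congr rfl fun l _ => ?_
      rw [Matrix.mul_apply, Finset.mul_sum]
      refine Finset.sum_congr rfl fun k _ => ?_
      simp only [hB, Matrix.of_apply, Matrix.conjTranspose_apply]
      ring
    rw [e1]
    refine (sum_amgm _ _ 1 one_pos).trans ?_
    rw [Fintype.sum_prod_type, Fintype.sum_prod_type, frob_unitary U hU2]
    simp only [hB, Matrix.of_apply, norm_mul, norm_exp_im _ _ hr1, norm_exp_im _ _ hr2, one_mul,
      norm_star, hXtot, hKtot]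
    norm_num
  have h0 : ∀ z : ℂ, z.re = 0 → ‖∑ x, c x * Complex.exp ((z - 1) * t x)‖ ≤ √D := by
    intro z hz
    rw [hsplit]
    have hr1 : ((1 - z) / 2).re = 1/2 := by simp [hz]
    have hr2 : ((z - 1) / 2).re = -(1/2) := by simp [hz]; norm_num
    set V : Matrix J A ℂ := Matrix.of fun j a =>
      Complex.exp ((z - 1) / 2 * Real.log (mu j)) * Φ j a with hV
    have hVb : ∀ a, ∑ j, ‖V j a‖ ^ 2 ≤ 1 := by
      apply bessel_col V (fun j => ((((mu j)⁻¹ * mu j : ℝ)) : ℂ))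
      · intro j
        by_cases hj : mu j = 0
        · right; ext a; simp [hV, hΦz j hj]
        · left; simp [hj]
      · have : V = Matrix.diagonal (fun j => Complex.exp ((z - 1) / 2 * Real.log (mu j))) * Φ := by
          ext j a; simp [hV, Matrix.diagonal_mul]
        rw [this, Matrix.conjTranspose_mul, Matrix.mul_assoc, ← Matrix.mul_assoc Φ, hΦ,
          Matrix.diagonal_conjTranspose, Matrix.diagonal_mul_diagonal,
          Matrix.diagonal_mul_diagonal]
        congr 1
        ext j
        by_cases hj : mu j = 0
        · simp [hj]
        · have := norm_exp_neg_half_log ((z - 1) / 2) (mu j)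
            (lt_of_le_of_ne (hmu0 j) (Ne.symm hj)) hr2
          rw [Complex.ofReal_mul, ← this]
          push_cast
          rw [← Complex.mul_conj']
          simp only [Pi.star_apply, Complex.star_def]
          ring
    have hterm : ∀ i, ‖∑ k : J × A, ∑ l, (star (U k i) * K k l * star (X i l)) *
        (Complex.exp ((1 - z) / 2 * Real.log (lam i)) *
        Complex.exp ((z - 1) / 2 * Real.log (mu k.1)) *
        Complex.exp ((z - 1) / 2 * Real.log (p l)))‖ ≤ √D * lam i := by
      intro i
      by_cases hi : lam i = 0
      · simp [hXz i hi, hi]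
      have hipos : 0 < lam i := lt_of_le_of_ne (hlam0 i) (Ne.symm hi)
      let y : L → ℂ := fun l =>
        ((√(p l) : ℝ) : ℂ) * Complex.exp ((z - 1) / 2 * Real.log (p l)) * star (X i l)
      have hy : ∑ l, ‖y l‖ ^ 2 ≤ lam i := by
        rw [hlam]
        refine Finset.sum_le_sum fun l _ => ?_
        simp only [y]
        rw [norm_mul, norm_mul, mul_pow, mul_pow, norm_star, Complex.norm_real, Real.norm_eq_abs,
          sq_abs, Real.sq_sqrt (hp0 l)]
        by_cases hl : p l = 0
        · simp [hl]
        · rw [norm_exp_neg_half_log _ _ (lt_of_le_of_ne (hp0 l) (Ne.symm hl)) hr2,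
            mul_inv_cancel₀ hl, one_mul]
      have e1 : ∑ k : J × A, ∑ l, (star (U k i) * K k l * star (X i l)) *
        (Complex.exp ((1 - z) / 2 * Real.log (lam i)) *
        Complex.exp ((z - 1) / 2 * Real.log (mu k.1)) *
        Complex.exp ((z - 1) / 2 * Real.log (p l))) =
        ∑ k : J × A, (Complex.exp ((1 - z) / 2 * Real.log (lam i)) * star (U k i)) *
          (V k.1 k.2 * ∑ l, F k.2 l * y l) := by
        refine Finset.sum_congr rfl fun k _ => ?_
        rw [Finset.mul_sum, Finset.mul_sum]
        refine Finset.sum_congr rfl fun l _ => ?_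
        simp only [hV, y, hK, Matrix.of_apply]
        ring
      rw [e1]
      have hsD : 0 < √D := Real.sqrt_pos.2 hD
      refine (sum_amgm _ _ (√D) hsD).trans ?_
      have b1 : ∑ k : J × A, ‖Complex.exp ((1 - z) / 2 * Real.log (lam i)) * star (U k i)‖ ^ 2
          = lam i := by
        simp only [norm_mul, mul_pow, norm_star, norm_exp_half_log _ _ hipos hr1, ← Finset.mul_sum]
        have h := congrFun (congrFun hU1 i) i
        rw [Matrix.one_apply_eq, Matrix.mul_apply] at h
        have h2 : ((∑ k, ‖U k i‖ ^ 2 : ℝ) : ℂ) = 1 := by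
          rw [← h]; push_cast
          refine Finset.sum_congr rfl fun l _ => ?_
          rw [Matrix.conjTranspose_apply, Complex.star_def, Complex.conj_mul']
        have h3 : ∑ k, ‖U k i‖ ^ 2 = 1 := by exact_mod_cast h2
        rw [h3, mul_one]
      have b2 : ∑ k : J × A, ‖V k.1 k.2 * ∑ l, F k.2 l * y l‖ ^ 2 ≤ D * lam i := by
        rw [Fintype.sum_prod_type, Finset.sum_comm]
        simp only [norm_mul, mul_pow, ← Finset.sum_mul]
        calc _ ≤ ∑ a, 1 * ‖∑ l, F a l * y l‖ ^ 2 :=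
              Finset.sum_le_sum fun a _ => mul_le_mul_of_nonneg_right (hVb a) (by positivity)
          _ = D * ∑ l, ‖y l‖ ^ 2 := by simp only [one_mul]; exact vec_isom F D hF y
          _ ≤ D * lam i := by gcongr
      rw [b1]
      have b3 : (√D)⁻¹ * (∑ k : J × A, ‖V k.1 k.2 * ∑ l, F k.2 l * y l‖ ^ 2) ≤ √D * lam i := by
        calc _ ≤ (√D)⁻¹ * (D * lam i) := by gcongr
          _ = (√D)⁻¹ * ((√D * √D) * lam i) := by rw [Real.mul_self_sqrt hD.le]
          _ = √D * lam i := by field_simp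
      linarith
    refine (norm_sum_le _ _).trans ((Finset.sum_le_sum fun i _ => hterm i).trans ?_)
    rw [← Finset.mul_sum, hlamtot, mul_one]
  have main := exp_sum_three_lines c t (√D) (Real.sqrt_pos.2 hD) hc h0 h1
  have hsum : ∑ x, c x * (t x : ℂ) = (((1/2) * (-(∑ i, lam i * Real.log (lam i))
      + ∑ j, mu j * Real.log (mu j) + ∑ l, p l * Real.log (p l)) : ℝ) : ℂ) := by
    have e1 : ∀ x, c x * (t x : ℂ) = (1/2) * (-((Real.log (lam x.1) : ℂ) * c x)
        + ((Real.log (mu x.2.1.1) + Real.log (p x.2.2) : ℝ) : ℂ) * c x) := by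
      intro x; simp only [t]; push_cast; ring
    simp only [e1]
    rw [← Finset.mul_sum, Finset.sum_add_distrib, Finset.sum_neg_distrib,
      S1 (fun i => (Real.log (lam i) : ℂ)),
      S2 (fun k l => ((Real.log (mu k.1) + Real.log (p l) : ℝ) : ℂ))]
    have e2 : ∑ k : J × A, ∑ l, (Real.log (mu k.1) + Real.log (p l)) * ‖K k l‖ ^ 2
        = ∑ j, mu j * Real.log (mu j) + ∑ l, p l * Real.log (p l) := by
      simp only [add_mul, Finset.sum_add_distrib, hKn]
      congr 1
      · rw [Fintype.sum_prod_type]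
        refine Finset.sum_congr rfl fun j _ => ?_
        simp only [← Finset.mul_sum, hp1, mul_one]
        rw [← hmuj, mul_comm]
      · rw [Finset.sum_comm]
        refine Finset.sum_congr rfl fun l _ => ?_
        rw [← Finset.mul_sum, ← Finset.sum_mul, Fintype.sum_prod_type]
        simp only [← hmuj, hmu]
        ring
    rw [add_assoc, ← e2]
    push_cast
    congr 2
    congr 1
    exact Finset.sum_congr rfl fun i _ => mul_comm _ _
  rw [hsum, Complex.ofReal_re, Real.log_sqrt hD.le] at main
  linarith


lemma spec {n : Type*} [Fintype n] [DecidableEq n] (A : Matrix n n ℂ) (hA : A.IsHermitian) :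
    ∃ U : Matrix n n ℂ, Uᴴ * U = 1 ∧ U * Uᴴ = 1 ∧
      Uᴴ * A * U = Matrix.diagonal fun i => (hA.eigenvalues i : ℂ) := by
  have h1 : (hA.eigenvectorUnitary : Matrix n n ℂ)ᴴ * hA.eigenvectorUnitary = 1 :=
    Unitary.coe_star_mul_self hA.eigenvectorUnitary
  have h2 : (hA.eigenvectorUnitary : Matrix n n ℂ) * (hA.eigenvectorUnitary : Matrix n n ℂ)ᴴ = 1 :=
    Unitary.coe_mul_star_self hA.eigenvectorUnitary
  refine ⟨hA.eigenvectorUnitary, h1, h2, ?_⟩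
  have h3 : A = (hA.eigenvectorUnitary : Matrix n n ℂ) *
      (Matrix.diagonal fun i => (hA.eigenvalues i : ℂ)) *
      (hA.eigenvectorUnitary : Matrix n n ℂ)ᴴ := by
    have := hA.spectral_theorem
    rw [Unitary.conjStarAlgAut_apply] at this
    exact this
  generalize (hA.eigenvectorUnitary : Matrix n n ℂ) = W at *
  generalize (Matrix.diagonal fun i => (hA.eigenvalues i : ℂ)) = Q at *
  rw [h3]
  calc Wᴴ * (W * Q * Wᴴ) * W = (Wᴴ * W) * Q * (Wᴴ * W) := by simp only [Matrix.mul_assoc]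
    _ = Q := by rw [h1, Matrix.one_mul, Matrix.mul_one]

lemma pure_vec {n : Type*} [Fintype n] [DecidableEq n] (ψ : Matrix n n ℂ) (h : IsPure ψ) :
    ∃ v : n → ℂ, (∀ x y, ψ x y = v x * star (v y)) ∧ ∑ x, v x * star (v x) = 1 := by
  obtain ⟨⟨hpos, htr⟩, hidem⟩ := h
  have hA := hpos.isHermitian
  obtain ⟨U, hU1, hU2, hd⟩ := spec ψ hA
  have hsq : ∀ i, hA.eigenvalues i * hA.eigenvalues i = hA.eigenvalues i := by
    intro i
    have : (Uᴴ * ψ * U) * (Uᴴ * ψ * U) = Uᴴ * ψ * U := by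
      calc (Uᴴ * ψ * U) * (Uᴴ * ψ * U) = Uᴴ * ψ * (U * Uᴴ) * ψ * U := by
            simp only [Matrix.mul_assoc]
        _ = Uᴴ * (ψ * ψ) * U := by rw [hU2, Matrix.mul_one]; simp only [Matrix.mul_assoc]
        _ = _ := by rw [hidem]
    rw [hd, Matrix.diagonal_mul_diagonal] at this
    have := congrFun (congrFun this i) i
    simp only [Matrix.diagonal_apply_eq] at this
    exact_mod_cast this
  have hval : ∀ i, hA.eigenvalues i = 0 ∨ hA.eigenvalues i = 1 := by
    intro i
    have := hsq i
    by_cases h0 : hA.eigenvalues i = 0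
    · exact Or.inl h0
    · exact Or.inr (mul_left_cancel₀ h0 (by rw [this, mul_one]))
  have hsum : ∑ i, hA.eigenvalues i = 1 := by
    have := hA.trace_eq_sum_eigenvalues
    rw [htr] at this
    have h5 : ((∑ i, hA.eigenvalues i : ℝ) : ℂ) = 1 := by
      rw [Complex.ofReal_sum]; exact this.symm
    exact_mod_cast h5
  have hψ : ψ = U * (Matrix.diagonal fun i => (hA.eigenvalues i : ℂ)) * Uᴴ := by
    rw [← hd]
    calc ψ = (U * Uᴴ) * ψ * (U * Uᴴ) := by rw [hU2, Matrix.one_mul, Matrix.mul_one]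
      _ = _ := by simp only [Matrix.mul_assoc]
  obtain ⟨i, hi⟩ : ∃ i, hA.eigenvalues i = 1 := by
    by_contra hcon
    push Not at hcon
    have : ∑ i, hA.eigenvalues i = 0 :=
      Finset.sum_eq_zero fun i _ => (hval i).resolve_right (hcon i)
    linarith
  have hj : ∀ j, j ≠ i → hA.eigenvalues j = 0 := by
    intro j hji
    rcases hval j with h | h
    · exact h
    · exfalso
      have h2 : ∑ k ∈ {i, j}, hA.eigenvalues k ≤ ∑ k, hA.eigenvalues k :=
        Finset.sum_le_sum_of_subset_of_nonneg (Finset.subset_univ _) fun k _ _ => by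
          rcases hval k with h | h <;> rw [h]; norm_num
      rw [Finset.sum_pair (Ne.symm hji), hi, h, hsum] at h2
      norm_num at h2
  refine ⟨fun x => U x i, ?_, ?_⟩
  · intro x y
    conv_lhs => rw [hψ]
    rw [Matrix.mul_apply, Finset.sum_eq_single i]
    · rw [Matrix.mul_diagonal, hi, Matrix.conjTranspose_apply]; simp
    · intro j _ hji
      rw [Matrix.mul_diagonal, hj j hji]; simp
    · simp
  · have := congrFun (congrFun hU1 i) i
    rw [Matrix.mul_apply, Matrix.one_apply_eq] at this
    rw [← this]
    exact Finset.sum_congr rfl fun x _ => by rw [Matrix.conjTranspose_apply, mul_comm]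

/-- The unnormalized Fourier matrix. -/
noncomputable def fou (d : ℕ) : Matrix (Fin d) (Fin d) ℂ :=
  Matrix.of fun a l => Complex.exp (2 * Real.pi * Complex.I * (a : ℕ) / d) ^ (l : ℕ)

lemma fou_norm (d : ℕ) (a l : Fin d) : ‖fou d a l‖ = 1 := by
  have : (2 * Real.pi * Complex.I * ((a : ℕ) : ℂ) / d) =
    ((2 * Real.pi * (a : ℕ) / d : ℝ) : ℂ) * Complex.I := by push_cast; ring
  rw [fou, Matrix.of_apply, norm_pow, this, Complex.norm_exp_ofReal_mul_I, one_pow]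

lemma fou_mul_star (d : ℕ) (a l : Fin d) : fou d a l * star (fou d a l) = 1 := by
  rw [Complex.star_def, Complex.mul_conj', fou_norm]; simp

lemma fou_unitary (d : ℕ) (hd : 0 < d) :
    (fou d)ᴴ * fou d = ((d : ℝ) : ℂ) • (1 : Matrix (Fin d) (Fin d) ℂ) := by
  set ζ := Complex.exp (2 * Real.pi * Complex.I / d) with hζ
  have hprim : IsPrimitiveRoot ζ d := Complex.isPrimitiveRoot_exp d hd.ne'
  have hfou : ∀ a l, fou d a l = (ζ ^ (l : ℕ)) ^ (a : ℕ) := by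
    intro a l
    rw [fou, Matrix.of_apply, hζ, ← Complex.exp_nat_mul, ← Complex.exp_nat_mul,
      ← Complex.exp_nat_mul]
    congr 1; ring
  have hzz : ∀ l : ℕ, star (ζ ^ l) * ζ ^ l = 1 := by
    intro l
    have : ‖ζ‖ = 1 := Complex.norm_eq_one_of_pow_eq_one hprim.pow_eq_one hd.ne'
    rw [Complex.star_def, Complex.conj_mul', norm_pow, this]; simp
  ext l m
  rw [Matrix.mul_apply, Matrix.smul_apply, smul_eq_mul]
  set r := star (ζ ^ (l : ℕ)) * ζ ^ (m : ℕ) with hr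
  have e1 : ∀ a : Fin d, (fou d)ᴴ l a * fou d a m = r ^ (a : ℕ) := by
    intro a
    rw [Matrix.conjTranspose_apply, hfou, hfou, star_pow, hr, mul_pow]
  simp only [e1]
  rw [Fin.sum_univ_eq_sum_range (fun a => r ^ a)]
  by_cases hlm : l = m
  · subst hlm
    rw [hzz] at hr
    rw [hr]; simp
  · rw [Matrix.one_apply_ne hlm, mul_zero]
    have hr1 : r ≠ 1 := by
      intro h
      have h2 : ζ ^ (l : ℕ) * r = ζ ^ (m : ℕ) := by
        rw [hr, ← mul_assoc, mul_comm (ζ ^ (l : ℕ)), hzz, one_mul]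
      rw [h, mul_one] at h2
      exact hlm (Fin.ext (hprim.pow_inj l.2 m.2 h2))
    have hrd : r ^ d = 1 := by
      rw [hr, mul_pow, ← star_pow, ← pow_mul, ← pow_mul, mul_comm (l : ℕ), mul_comm (m : ℕ),
        pow_mul, pow_mul, hprim.pow_eq_one]
      simp
    have := geom_sum_mul r d
    rw [hrd, sub_self] at this
    exact (mul_eq_zero.1 this).resolve_right (sub_ne_zero.2 hr1)

/-- Kraus-vector matrix of the output. -/
noncomputable def kmat (d : ℕ) (p : Fin d → ℝ) (v : Fin d × Fin d → ℂ) :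
    Matrix (Fin d × Fin d) (Fin d) ℂ :=
  Matrix.of fun k l => v k * fou d k.2 l * ((√(p l) : ℝ) : ℂ)

lemma ext_eq_s13 (d : ℕ) (p : Fin d → ℝ) (hp0 : ∀ l, 0 ≤ p l)
    (ψ : Matrix (Fin d × Fin d) (Fin d × Fin d) ℂ)
    (v : Fin d × Fin d → ℂ) (hv : ∀ x y, ψ x y = v x * star (v y)) :
    ext (dephasingCh d p) ψ = kmat d p v * (kmat d p v)ᴴ := by
  ext x y
  rw [ext, Matrix.of_apply, dephasingCh, Matrix.sum_apply, Matrix.mul_apply]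
  refine Finset.sum_congr rfl fun l _ => ?_
  have hpl : ((p l : ℝ) : ℂ) = ((√(p l) : ℝ) : ℂ) * ((√(p l) : ℝ) : ℂ) := by
    rw [← Complex.ofReal_mul, Real.mul_self_sqrt (hp0 l)]
  rw [clockZ, Matrix.diagonal_pow, Matrix.diagonal_conjTranspose, Matrix.smul_apply,
    Matrix.mul_diagonal, Matrix.diagonal_mul, Matrix.conjTranspose_apply, kmat, Matrix.of_apply,
    Matrix.of_apply, Matrix.of_apply, hv, fou, Matrix.of_apply, Matrix.of_apply, hpl]
  simp only [smul_eq_mul, Pi.star_apply, Pi.pow_apply, star_mul, Complex.star_def,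
    Complex.conj_ofReal]
  ring

lemma ptR_eq (d : ℕ) (p : Fin d → ℝ) (hp0 : ∀ l, 0 ≤ p l) (hp1 : ∑ l, p l = 1)
    (v : Fin d × Fin d → ℂ) :
    ptR (kmat d p v * (kmat d p v)ᴴ) =
      (Matrix.of fun r a => v (r, a)) * (Matrix.of fun r a => v (r, a))ᴴ := by
  ext r s
  rw [ptR, Matrix.of_apply, Matrix.mul_apply]
  refine Finset.sum_congr rfl fun a _ => ?_
  rw [Matrix.mul_apply]
  have : ∀ l, kmat d p v (r, a) l * (kmat d p v)ᴴ l (s, a) =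
      (v (r, a) * star (v (s, a))) * ((p l : ℝ) : ℂ) := by
    intro l
    have hpl : ((p l : ℝ) : ℂ) = ((√(p l) : ℝ) : ℂ) * ((√(p l) : ℝ) : ℂ) := by
      rw [← Complex.ofReal_mul, Real.mul_self_sqrt (hp0 l)]
    have hf := fou_mul_star d a l
    rw [Matrix.conjTranspose_apply, kmat, Matrix.of_apply, Matrix.of_apply, hpl]
    simp only [star_mul, Complex.star_def, Complex.conj_ofReal] at hf ⊢
    linear_combination (v (r, a) * (starRingEnd ℂ) (v (s, a)) * ((√(p l) : ℝ) : ℂ) ^ 2) * hf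
  simp only [this]
  rw [← Finset.mul_sum, ← Complex.ofReal_sum, hp1]
  simp

theorem lower (d : ℕ) (hd : 0 < d) (p : Fin d → ℝ)
    (hp0 : ∀ ℓ, 0 ≤ p ℓ) (hp1 : ∑ ℓ, p ℓ = 1)
    (ψ : Matrix (Fin d × Fin d) (Fin d × Fin d) ℂ) (hψ : IsPure ψ) :
    (-∑ ℓ, p ℓ * Real.logb 2 (p ℓ)) - Real.logb 2 d ≤ condEntB (ext (dephasingCh d p) ψ) := by
  obtain ⟨v, hv, hv1⟩ := pure_vec ψ hψ
  rw [condEntB, ext_eq_s13 d p hp0 ψ v hv, ptR_eq d p hp0 hp1]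
  set K0 := kmat d p v with hK0
  set Ψ : Matrix (Fin d) (Fin d) ℂ := Matrix.of fun r a => v (r, a) with hΨ
  have hω : (K0 * K0ᴴ).IsHermitian := Matrix.isHermitian_mul_conjTranspose_self K0
  have hρ : (Ψ * Ψᴴ).IsHermitian := Matrix.isHermitian_mul_conjTranspose_self Ψ
  obtain ⟨U0, hU1, hU2, hUd⟩ := spec _ hω
  obtain ⟨E, hE1, hE2, hEd⟩ := spec _ hρ
  set W : Matrix (Fin d × Fin d) (Fin d × Fin d) ℂ := Eᴴ ⊗ₖ (1 : Matrix (Fin d) (Fin d) ℂ) with hW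
  have hWH : Wᴴ = E ⊗ₖ (1 : Matrix (Fin d) (Fin d) ℂ) := by
    rw [hW, Matrix.conjTranspose_kronecker]; simp
  have hW1 : Wᴴ * W = 1 := by
    rw [hWH, hW, ← Matrix.mul_kronecker_mul, hE2, Matrix.one_mul, Matrix.one_kronecker_one]
  have hW2 : W * Wᴴ = 1 := by
    rw [hWH, hW, ← Matrix.mul_kronecker_mul, hE1, Matrix.one_mul, Matrix.one_kronecker_one]
  have hX : (W * U0)ᴴ * (W * K0) = U0ᴴ * K0 := by
    rw [Matrix.conjTranspose_mul, Matrix.mul_assoc, ← Matrix.mul_assoc Wᴴ, hW1, Matrix.one_mul]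
  have main := core (W * U0)
    (by rw [Matrix.conjTranspose_mul, Matrix.mul_assoc, ← Matrix.mul_assoc Wᴴ, hW1, Matrix.one_mul,
      hU1])
    (by rw [Matrix.conjTranspose_mul, Matrix.mul_assoc, ← Matrix.mul_assoc U0, hU2, Matrix.one_mul,
      hW2])
    hω.eigenvalues hρ.eigenvalues p hp0 hp1 (Eᴴ * Ψ)
    (by rw [← hEd, Matrix.conjTranspose_mul, Matrix.conjTranspose_conjTranspose]
        simp only [Matrix.mul_assoc])
    (by
      have h := hρ.trace_eq_sum_eigenvalues
      have h2 : (Ψ * Ψᴴ).trace = 1 := by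
        rw [← hv1, Fintype.sum_prod_type]
        simp [Matrix.trace, Matrix.mul_apply, hΨ]
      rw [h2] at h
      have h5 : ((∑ i, hρ.eigenvalues i : ℝ) : ℂ) = 1 := by
        rw [Complex.ofReal_sum]; exact h.symm
      exact_mod_cast h5)
    (fou d) (fou_norm d) (d : ℝ) (by exact_mod_cast hd) (fou_unitary d hd) (W * K0)
    (by
      intro k l
      rw [Matrix.mul_apply, Fintype.sum_prod_type, Matrix.mul_apply, Finset.sum_mul, Finset.sum_mul]
      refine Finset.sum_congr rfl fun r _ => ?_
      rw [Finset.sum_eq_single k.2]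
      · simp [hW, hK0, hΨ, kmat, Matrix.kroneckerMap_apply]; ring
      · intro b _ hb
        simp [hW, Matrix.kroneckerMap_apply, Matrix.one_apply_ne (Ne.symm hb)]
      · simp)
    (by rw [hX, ← hUd, Matrix.conjTranspose_mul, Matrix.conjTranspose_conjTranspose]
        simp only [Matrix.mul_assoc])
  rw [vnEntropy, dif_pos hω, vnEntropy, dif_pos hρ]
  have hl2 : 0 < Real.log 2 := Real.log_pos (by norm_num)
  simp only [Real.logb, ← mul_div_assoc, ← Finset.sum_div]
  rw [← sub_nonneg]
  have := div_nonneg (sub_nonneg.2 main) hl2.le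
  refine le_of_le_of_eq this ?_
  ring

theorem attained (d : ℕ) (hd : 0 < d) (p : Fin d → ℝ)
    (hp0 : ∀ ℓ, 0 ≤ p ℓ) (hp1 : ∑ ℓ, p ℓ = 1) :
    ∃ ψ : Matrix (Fin d × Fin d) (Fin d × Fin d) ℂ, IsPure ψ ∧
    (-∑ ℓ, p ℓ * Real.logb 2 (p ℓ)) - Real.logb 2 d = condEntB (ext (dephasingCh d p) ψ) := by
  have hdR : (0:ℝ) < d := by exact_mod_cast hd
  have hdC : (d : ℂ) ≠ 0 := by exact_mod_cast hd.ne'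
  have hsq : (((√(d:ℝ))⁻¹ : ℝ) : ℂ) * (((√(d:ℝ))⁻¹ : ℝ) : ℂ) = (d : ℂ)⁻¹ := by
    rw [← Complex.ofReal_mul, ← mul_inv, Real.mul_self_sqrt hdR.le]; simp
  let v : Fin d × Fin d → ℂ := fun x => if x.1 = x.2 then (((√(d:ℝ))⁻¹ : ℝ) : ℂ) else 0
  have hvv : ∀ r a, v (r, a) * star (v (r, a)) = if r = a then (d : ℂ)⁻¹ else 0 := by
    intro r a
    by_cases h : r = a
    · simp only [v, h, if_true, Complex.star_def, Complex.conj_ofReal, hsq]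
    · simp [v, h]
  have hv1 : ∑ x, v x * star (v x) = 1 := by
    rw [Fintype.sum_prod_type]
    simp only [hvv]
    simp [hdC]
  refine ⟨Matrix.vecMulVec v (star v), ⟨⟨Matrix.posSemidef_vecMulVec_self_star v, ?_⟩, ?_⟩, ?_⟩
  · simp only [Matrix.trace, Matrix.diag, Matrix.vecMulVec_apply]; exact hv1
  · ext x y
    rw [Matrix.mul_apply]
    simp only [Matrix.vecMulVec_apply, Pi.star_apply]
    calc ∑ j, v x * star (v j) * (v j * star (v y))
        = ∑ j, (v x * star (v y)) * (v j * star (v j)) :=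
          Finset.sum_congr rfl fun j _ => by ring
      _ = _ := by rw [← Finset.mul_sum, hv1, mul_one]
  · rw [condEntB, ext_eq_s13 d p hp0 (Matrix.vecMulVec v (star v)) v (fun x y => rfl), ptR_eq d p hp0 hp1]
    rw [vnEntropy_mul _ _ p (Matrix.isHermitian_mul_conjTranspose_self _),
      vnEntropy_mul _ _ (fun _ : Fin d => (d : ℝ)⁻¹) (Matrix.isHermitian_mul_conjTranspose_self _)]
    · simp [hdR.ne']
    · ext a b
      rw [Matrix.mul_apply]
      simp only [Matrix.conjTranspose_apply, Matrix.of_apply]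
      by_cases hab : a = b
      · subst hab
        rw [Matrix.diagonal_apply_eq]
        have : ∀ r, star (v (r, a)) * v (r, a) = if r = a then (d : ℂ)⁻¹ else 0 := by
          intro r; rw [mul_comm, hvv]
        simp only [this]
        simp
      · rw [Matrix.diagonal_apply_ne _ hab]
        refine Finset.sum_eq_zero fun r _ => ?_
        by_cases hra : r = a
        · have : r ≠ b := fun h => hab (hra.symm.trans h)
          simp [v, this]
        · simp [v, hra]
    · ext l m
      rw [Matrix.mul_apply, Fintype.sum_prod_type]
      have e1 : ∀ r a, (kmat d p v)ᴴ l (r, a) * kmat d p v (r, a) m =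
          if r = a then (d : ℂ)⁻¹ * ((√(p l) : ℝ) : ℂ) * ((√(p m) : ℝ) : ℂ) *
            ((fou d)ᴴ l a * fou d a m) else 0 := by
        intro r a
        have h := hvv r a
        rw [Matrix.conjTranspose_apply, Matrix.conjTranspose_apply, kmat, Matrix.of_apply,
          Matrix.of_apply]
        simp only [star_mul, Complex.star_def, Complex.conj_ofReal] at h ⊢
        split_ifs at h ⊢ with hra
        · rw [← h]; ring
        · simp [v, hra]
      simp only [e1, Finset.sum_ite_eq, Finset.mem_univ, if_true]
      rw [← Finset.mul_sum, ← Matrix.mul_apply, fou_unitary d hd]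
      by_cases hlm : l = m
      · subst hlm
        have hpl : ((p l : ℝ) : ℂ) = ((√(p l) : ℝ) : ℂ) * ((√(p l) : ℝ) : ℂ) := by
          rw [← Complex.ofReal_mul, Real.mul_self_sqrt (hp0 l)]
        rw [Matrix.diagonal_apply_eq, hpl]
        simp
        field_simp
      · simp [Matrix.diagonal_apply_ne _ hlm, Matrix.one_apply_ne hlm]

/-- H(D^p) = H(p) − log₂ d, with H(p) the Shannon entropy of (p_ℓ). -/
theorem chEnt_dephasing (d : ℕ) (hd : 0 < d) (p : Fin d → ℝ)
    (hp0 : ∀ ℓ, 0 ≤ p ℓ) (hp1 : ∑ ℓ, p ℓ = 1) :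
    chEnt (dephasingCh d p) =
      (-∑ ℓ, p ℓ * Real.logb 2 (p ℓ)) - Real.logb 2 d := by
  refine IsLeast.csInf_eq ⟨attained d hd p hp0 hp1, ?_⟩
  rintro x ⟨ψ, hψ, rfl⟩
  exact lower d hd p hp0 hp1 ψ hψ

end QCh
end
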